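/- Let k₀ ≥ 2 be an integer, ε>0, and let D be a bounded domain in ℝⁿ (n>2) with boundary of class C^{k₀,ε}. Then for all multi-indices α and β with |α|=k ≤ k₀ and |β|=ℓ ≤ k₀ there is a constant C_{k₀,ε} such that |∂^{k+ℓ}U(x,y)/∂x^β∂y^α| ≤ C_{k₀,ε}·(|x−y|+δ(y))^{−(n+k+ℓ−2)} for all x,y ∈ D. -/

import Mathlib

noncomputable section

open MeasureTheory Metric Set Real
open scoped ENNReal NNReal RealInnerProductSpace FourierTransform

/-- Euclidean space ℝⁿ. -/
abbrev Eu (n : ℕ) := EuclideanSpace ℝ (Fin n)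

variable {n : ℕ}

/-- δ(x) = dist(x, ℝⁿ ∖ D). -/
def bdist (D : Set (Eu n)) (x : Eu n) : ℝ := Metric.infDist x Dᶜ

/-- First-order partial derivative ∂u/∂xᵢ. -/
def pd (i : Fin n) (u : Eu n → ℝ) (x : Eu n) : ℝ :=
  fderiv ℝ u x (EuclideanSpace.single i 1)

/-- Second-order partial derivative ∂²u/∂xᵢ∂xⱼ. -/
def pd2 (i j : Fin n) (u : Eu n → ℝ) : Eu n → ℝ :=
  fun x => pd i (fun z => pd j u z) x

/-- Iterated partial derivatives along a list of coordinate directions. -/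
def pdMulti : List (Fin n) → (Eu n → ℝ) → Eu n → ℝ
  | [], u => u
  | i :: L, u => pd i (pdMulti L u)

/-- The Laplacian Δu = Σᵢ ∂²u/∂xᵢ². -/
def lapl (u : Eu n → ℝ) (x : Eu n) : ℝ := ∑ i, pd2 i i u x

/-- A list of coordinate directions realizing the multi-index α. -/
def multiList (α : Fin n → ℕ) : List (Fin n) :=
  (List.finRange n).flatMap fun i => List.replicate (α i) i

/-- The derivative ∂^α u corresponding to a multi-index α. -/
def pdAlpha (α : Fin n → ℕ) (u : Eu n → ℝ) : Eu n → ℝ := pdMulti (multiList α) u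

/-- The monomial y^α. -/
def monom (α : Fin n → ℕ) (y : Eu n) : ℝ := ∏ i, y i ^ α i

/-- α! = ∏ᵢ (αᵢ)!. -/
def multiFact (α : Fin n → ℕ) : ℕ := ∏ i, Nat.factorial (α i)

/-- |α| = Σᵢ αᵢ. -/
def multiDeg (α : Fin n → ℕ) : ℕ := ∑ i, α i

/-- The finite set of multi-indices of degree at most k. -/
def multiIdxLE (n k : ℕ) : Finset (Fin n → ℕ) :=
  (Fintype.piFinset fun _ : Fin n => Finset.range (k + 1)).filter fun α => multiDeg α ≤ k

/-- A bounded domain: open, connected, bounded. -/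
def IsBddDomain (D : Set (Eu n)) : Prop :=
  IsOpen D ∧ IsConnected D ∧ Bornology.IsBounded D

/-- `v` is an outward unit normal vector to `D` at the boundary point `y`. -/
def IsOutwardNormalAt (D : Set (Eu n)) (y v : Eu n) : Prop :=
  ‖v‖ = 1 ∧ ∃ ε > 0, (∀ t : ℝ, 0 < t → t < ε → y + t • v ∉ closure D) ∧
    ∀ t : ℝ, 0 < t → t < ε → y - t • v ∈ D

/-- Hölder class C^s regularity of a globally defined function: it is C^⌊s⌋ and,
if s is not an integer, its ⌊s⌋-th derivative is Hölder continuous of exponent s - ⌊s⌋. -/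
def HolderSmooth (s : ℝ) (g : Eu n → ℝ) : Prop :=
  ContDiff ℝ (⌊s⌋₊ : ℕ) g ∧
    (s ≠ (⌊s⌋₊ : ℕ) → ∃ C : ℝ≥0,
      HolderWith C (s - (⌊s⌋₊ : ℕ)).toNNReal (iteratedFDeriv ℝ ⌊s⌋₊ g))

/-- C^{k,ε} regularity: C^k with ε-Hölder k-th derivatives. -/
def CkHolder (k : ℕ) (ε : ℝ) (g : Eu n → ℝ) : Prop :=
  ContDiff ℝ (k : ℕ) g ∧ ∃ C : ℝ≥0, HolderWith C ε.toNNReal (iteratedFDeriv ℝ k g)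

/-- `D` has boundary which is locally the graph of a function enjoying the regularity
property `R`: near each boundary point, after choosing a unit direction `v`, the domain
is the subgraph `{x | ⟪x,v⟫ < g x}` of a function `g` depending only on the component
orthogonal to `v`. -/
def HasGraphBoundary (D : Set (Eu n)) (R : (Eu n → ℝ) → Prop) : Prop :=
  ∀ y ∈ frontier D, ∃ v : Eu n, ‖v‖ = 1 ∧ ∃ V : Set (Eu n), IsOpen V ∧ y ∈ V ∧
    ∃ g : Eu n → ℝ, R g ∧ (∀ x : Eu n, g x = g (x - ⟪x, v⟫ • v)) ∧
      D ∩ V = {x ∈ V | ⟪x, v⟫ < g x} ∧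
      frontier D ∩ V = {x ∈ V | ⟪x, v⟫ = g x}

/-- The surface area ωₙ of the unit sphere in ℝⁿ. -/
def sphereArea (n : ℕ) : ℝ := n * (volume (Metric.ball (0 : Eu n) 1)).toReal

/-- The fundamental solution Γ of the Laplacian on ℝⁿ, n > 2. -/
def fundSol (n : ℕ) (x : Eu n) : ℝ :=
  -(((n : ℝ) - 2)⁻¹ * (sphereArea n)⁻¹ * ‖x‖ ^ (2 - (n : ℝ)))

/-- `u` is harmonic on `D`. -/
def IsHarmonicOn (u : Eu n → ℝ) (D : Set (Eu n)) : Prop :=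
  ContDiffOn ℝ 2 u D ∧ ∀ x ∈ D, lapl u x = 0

/-- `U` is the harmonic correction for the Green's function of `D`: for each `y ∈ D`,
`U(·,y)` is harmonic in `D`, continuous on `D̄`, with boundary values `Γ(y−·)`. -/
def IsGreenCorrection (D : Set (Eu n)) (U : Eu n → Eu n → ℝ) : Prop :=
  ∀ y ∈ D, IsHarmonicOn (fun x => U x y) D ∧
    ContinuousOn (fun x => U x y) (closure D) ∧
    ∀ x ∈ frontier D, U x y = fundSol n (y - x)

/-- The Green's function G(x,y) = Γ(x−y) − U(x,y). -/
def greenFn (U : Eu n → Eu n → ℝ) : Eu n → Eu n → ℝ :=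
  fun x y => fundSol n (x - y) - U x y

/-- `V` is the correction for the Neumann kernel of `D`: for each `y ∈ D`, `V(·,y)` solves
`ΔV(·,y) = Vol(D)⁻¹` in `D` with normal derivative `∂Γ(y−·)/∂ν` on `∂D`. -/
def IsNeumannCorrection (D : Set (Eu n)) (V : Eu n → Eu n → ℝ) : Prop :=
  ∀ y ∈ D, (ContDiffOn ℝ 2 (fun x => V x y) D ∧
      ∀ x ∈ D, lapl (fun x' => V x' y) x = ((volume D).toReal)⁻¹) ∧
    ∀ z ∈ frontier D, ∀ v : Eu n, IsOutwardNormalAt D z v →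
      fderiv ℝ (fun x => V x y) z v = fderiv ℝ (fun x => fundSol n (y - x)) z v

/-- `u` solves the Dirichlet problem Δu = f in D, u = 0 on ∂D. -/
def IsDirichletSol (D : Set (Eu n)) (f u : Eu n → ℝ) : Prop :=
  ContDiffOn ℝ 2 u D ∧ (∀ x ∈ D, lapl u x = f x) ∧
    ContinuousOn u (closure D) ∧ ∀ x ∈ frontier D, u x = 0

/-- `u` solves the Neumann problem Δu = f in D, ∂u/∂ν = 0 on ∂D. -/
def IsNeumannSol (D : Set (Eu n)) (f u : Eu n → ℝ) : Prop :=
  ContDiffOn ℝ 2 u D ∧ (∀ x ∈ D, lapl u x = f x) ∧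
    ∀ y ∈ frontier D, ∀ v : Eu n, IsOutwardNormalAt D y v → fderiv ℝ u y v = 0

/-- A fixed nonnegative smooth bump function supported in the unit ball with integral one. -/
structure IsBump (n : ℕ) (φ : Eu n → ℝ) : Prop where
  smooth : ContDiff ℝ (⊤ : ℕ∞) φ
  supp : ∀ x : Eu n, 1 ≤ ‖x‖ → φ x = 0
  nonneg : ∀ x, 0 ≤ φ x
  integral_one : ∫ x, φ x = 1

/-- φ_t(x) = t⁻ⁿ φ(x/t). -/
def dil (φ : Eu n → ℝ) (t : ℝ) (x : Eu n) : ℝ := t⁻¹ ^ n * φ (t⁻¹ • x)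

/-- The radial maximal function f⁺(x) = sup_{0<t<δ(x)} |∫_D φ_t(x−y) f(y) dy|. -/
def radMax (D : Set (Eu n)) (φ f : Eu n → ℝ) (x : Eu n) : ℝ :=
  ⨆ t : {t : ℝ // 0 < t ∧ t < bdist D x}, |∫ y in D, dil φ (t : ℝ) (x - y) * f y|

/-- The h^p_r(D) (quasi-)norm: the L^p(D) norm of the radial maximal function. -/
def hrNorm (D : Set (Eu n)) (φ : Eu n → ℝ) (p : ℝ) (f : Eu n → ℝ) : ℝ≥0∞ :=
  eLpNorm (radMax D φ f) (ENNReal.ofReal p) (volume.restrict D)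

/-- The local (Goldberg) maximal function sup_{0<t<1} |φ_t * g(x)|. -/
def locMax (φ g : Eu n → ℝ) (x : Eu n) : ℝ :=
  ⨆ t : {t : ℝ // 0 < t ∧ t < 1}, |∫ y, dil φ (t : ℝ) (x - y) * g y|

/-- Membership in the local Hardy space h^p(ℝⁿ). -/
def MemHp (φ : Eu n → ℝ) (p : ℝ) (g : Eu n → ℝ) : Prop :=
  Measurable g ∧ eLpNorm (locMax φ g) (ENNReal.ofReal p) volume < ⊤

/-- `g` is an extension of `f` to ℝⁿ vanishing off `D̄`. -/
def IsHpzExtension (D : Set (Eu n)) (f g : Eu n → ℝ) : Prop :=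
  (∀ x ∈ D, g x = f x) ∧ ∀ x ∉ closure D, g x = 0

/-- Membership in h^p_z(D): f has an extension in h^p(ℝⁿ) vanishing off D̄. -/
def MemHpz (D : Set (Eu n)) (φ : Eu n → ℝ) (p : ℝ) (f : Eu n → ℝ) : Prop :=
  ∃ g, IsHpzExtension D f g ∧ MemHp φ p g

/-- The h^p_z(D) (quasi-)norm: infimum of h^p(ℝⁿ) norms over all admissible extensions. -/
def hzNorm (D : Set (Eu n)) (φ : Eu n → ℝ) (p : ℝ) (f : Eu n → ℝ) : ℝ≥0∞ :=
  ⨅ g ∈ {g | IsHpzExtension D f g},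
    eLpNorm (locMax φ g) (ENNReal.ofReal p) volume

/-- An axis-parallel cube in ℝⁿ, given by its center and half side length. -/
structure Cube (n : ℕ) where
  center : Eu n
  half : ℝ
  half_pos : 0 < half

/-- The cube concentric with Q whose side length is c times that of Q. -/
def Cube.scaled (Q : Cube n) (c : ℝ) : Set (Eu n) :=
  {x | ∀ i, |x i - Q.center i| ≤ c * Q.half}

/-- The cube Q as a subset of ℝⁿ. -/
def Cube.carrier (Q : Cube n) : Set (Eu n) := Q.scaled 1

/-- |Q|, the volume of Q. -/
def Cube.vol (Q : Cube n) : ℝ := (2 * Q.half) ^ n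

/-- The side length of Q. -/
def Cube.side (Q : Cube n) : ℝ := 2 * Q.half

/-- [n(1/p−1)]. -/
def npIndex (n : ℕ) (p : ℝ) : ℕ := ⌊(n : ℝ) * (1 / p - 1)⌋₊

/-- An h^p(ℝⁿ) atom (p-atom) supported in the cube Q. -/
def IsPAtom (n : ℕ) (p : ℝ) (Q : Cube n) (a : Eu n → ℝ) : Prop :=
  Measurable a ∧ (∃ M : ℝ, ∀ x, |a x| ≤ M) ∧ (∀ x ∉ Q.carrier, a x = 0) ∧
    (∫ x, a x ^ 2) ≤ Q.vol ^ (1 - 2 / p) ∧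
    (Q.vol ≤ 1 → ∀ α : Fin n → ℕ, multiDeg α ≤ npIndex n p →
      ∫ x, monom α x * a x = 0)

/-- `g` is the weak partial derivative ∂f/∂xᵢ on `D`. -/
def IsWeakPd (D : Set (Eu n)) (i : Fin n) (f g : Eu n → ℝ) : Prop :=
  ∀ ψ : Eu n → ℝ, ContDiff ℝ (⊤ : ℕ∞) ψ → HasCompactSupport ψ → tsupport ψ ⊆ D →
    ∫ x in D, f x * pd i ψ x = -∫ x in D, g x * ψ x

/-- `g` is an iterated weak derivative of `f` on `D` along the list of directions `L`. -/
def IsWeakDerivSeq (D : Set (Eu n)) : List (Fin n) → (Eu n → ℝ) → (Eu n → ℝ) → Prop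
  | [], f, g => ∀ x ∈ D, f x = g x
  | i :: L, f, g => ∃ h, IsWeakDerivSeq D L f h ∧ IsWeakPd D i h g

/-- Membership in the Hardy–Sobolev space h^{k,p}_z(D): all weak derivatives of order ≤ k
lie in h^p_z(D). -/
def MemHkz (D : Set (Eu n)) (φ : Eu n → ℝ) (p : ℝ) (k : ℕ) (f : Eu n → ℝ) : Prop :=
  ∀ L : List (Fin n), L.length ≤ k → ∃ g, IsWeakDerivSeq D L f g ∧ MemHpz D φ p g

/-- The h^{k,p}_z(D) (quasi-)norm. -/
def hkzNorm (D : Set (Eu n)) (φ : Eu n → ℝ) (p : ℝ) (k : ℕ) (f : Eu n → ℝ) : ℝ≥0∞ :=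
  ⨆ L : {L : List (Fin n) // L.length ≤ k},
    ⨅ g ∈ {g | IsWeakDerivSeq D (L : List (Fin n)) f g}, hzNorm D φ p g

/-- The h^{k,p}_r(D) (quasi-)norm. -/
def hkrNorm (D : Set (Eu n)) (φ : Eu n → ℝ) (p : ℝ) (k : ℕ) (f : Eu n → ℝ) : ℝ≥0∞ :=
  ⨆ L : {L : List (Fin n) // L.length ≤ k},
    ⨅ g ∈ {g | IsWeakDerivSeq D (L : List (Fin n)) f g}, hrNorm D φ p g

section PartialDerivatives

theorem pd_congr {i : Fin n} {f g : Eu n → ℝ} {x : Eu n} (h : f =ᶠ[nhds x] g) :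
    pd i f x = pd i g x := by
  unfold pd; rw [h.fderiv_eq]

theorem pd_eventuallyEq {i : Fin n} {f g : Eu n → ℝ} {x : Eu n} (h : f =ᶠ[nhds x] g) :
    pd i f =ᶠ[nhds x] pd i g := by
  filter_upwards [eventually_eventually_nhds.2 h] with y hy using pd_congr hy

theorem pdMulti_eventuallyEq {f g : Eu n → ℝ} {x : Eu n} (h : f =ᶠ[nhds x] g)
    (L : List (Fin n)) : pdMulti L f =ᶠ[nhds x] pdMulti L g := by
  induction L with
  | nil => exact h
  | cons i L ih => exact pd_eventuallyEq ih

theorem pd_add {i : Fin n} {f g : Eu n → ℝ} {x : Eu n} (hf : DifferentiableAt ℝ f x)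
    (hg : DifferentiableAt ℝ g x) : pd i (fun y => f y + g y) x = pd i f x + pd i g x := by
  unfold pd; rw [fderiv_fun_add hf hg]; rfl

theorem pd_sub {i : Fin n} {f g : Eu n → ℝ} {x : Eu n} (hf : DifferentiableAt ℝ f x)
    (hg : DifferentiableAt ℝ g x) : pd i (fun y => f y - g y) x = pd i f x - pd i g x := by
  unfold pd; rw [fderiv_fun_sub hf hg]; rfl

theorem pd_mul {i : Fin n} {f g : Eu n → ℝ} {x : Eu n} (hf : DifferentiableAt ℝ f x)
    (hg : DifferentiableAt ℝ g x) :
    pd i (fun y => f y * g y) x = pd i f x * g x + f x * pd i g x := by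
  unfold pd; rw [fderiv_fun_mul hf hg]; simp; ring

theorem pd_const {i : Fin n} (c : ℝ) : pd i (fun _ : Eu n => c) = fun _ => 0 := by
  funext x; simp [pd]

theorem pd_const_mul {i : Fin n} {f : Eu n → ℝ} {x : Eu n} (c : ℝ)
    (hf : DifferentiableAt ℝ f x) : pd i (fun y => c * f y) x = c * pd i f x := by
  unfold pd; rw [fderiv_const_mul hf]; simp

theorem pd_neg {i : Fin n} {f : Eu n → ℝ} : pd i (fun y => - f y) = fun x => - pd i f x := by
  funext x; unfold pd; rw [fderiv_fun_neg]; rfl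

theorem pd_sum {ι : Type*} {i : Fin n} {s : Finset ι} {f : ι → Eu n → ℝ} {x : Eu n}
    (hf : ∀ j ∈ s, DifferentiableAt ℝ (f j) x) :
    pd i (fun y => ∑ j ∈ s, f j y) x = ∑ j ∈ s, pd i (f j) x := by
  unfold pd; rw [fderiv_fun_sum hf]; simp

theorem hasFDerivAt_coord (j : Fin n) (x : Eu n) :
    HasFDerivAt (fun y : Eu n => y j) (EuclideanSpace.proj j : Eu n →L[ℝ] ℝ) x :=
  (EuclideanSpace.proj j : Eu n →L[ℝ] ℝ).hasFDerivAt

theorem pd_coord (i j : Fin n) (x : Eu n) :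
    pd i (fun y : Eu n => y j) x = if j = i then 1 else 0 := by
  unfold pd; rw [(hasFDerivAt_coord j x).fderiv]; simp

theorem contDiff_coord (j : Fin n) {m : WithTop ℕ∞} : ContDiff ℝ m (fun y : Eu n => y j) :=
  (EuclideanSpace.proj j : Eu n →L[ℝ] ℝ).contDiff

theorem sum_single (v : Eu n) : ∑ i, v i • (EuclideanSpace.single i (1 : ℝ) : Eu n) = v := by
  have := (EuclideanSpace.basisFun (Fin n) ℝ).sum_repr v
  simpa using this

theorem fderiv_apply_eq_sum_pd (u : Eu n → ℝ) (x v : Eu n) :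
    fderiv ℝ u x v = ∑ i, v i * pd i u x := by
  conv_lhs => rw [← sum_single v]
  simp [pd]

theorem fderiv_eq_sum_pd (u : Eu n → ℝ) (x : Eu n) :
    fderiv ℝ u x = ∑ i, pd i u x • (EuclideanSpace.proj i : Eu n →L[ℝ] ℝ) := by
  ext v; rw [fderiv_apply_eq_sum_pd]; simp [mul_comm]

theorem norm_fderiv_le_sum_pd (u : Eu n → ℝ) (x : Eu n) {c : ℝ} (h : ∀ i, |pd i u x| ≤ c)
    (hc : 0 ≤ c) : ‖fderiv ℝ u x‖ ≤ n * c := by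
  refine ContinuousLinearMap.opNorm_le_bound _ (by positivity) fun v => ?_
  rw [fderiv_apply_eq_sum_pd]
  calc ‖∑ i, v i * pd i u x‖ ≤ ∑ i : Fin n, ‖v‖ * c := by
        refine (norm_sum_le _ _).trans (Finset.sum_le_sum fun i _ => ?_)
        rw [norm_mul]
        exact mul_le_mul (PiLp.norm_apply_le v i) (h i) (norm_nonneg _) (norm_nonneg _)
    _ = n * c * ‖v‖ := by simp; ring

theorem ContDiffAt.pd {u : Eu n → ℝ} {x : Eu n} {m k : WithTop ℕ∞} (h : ContDiffAt ℝ k u x)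
    (hm : m + 1 ≤ k) (i : Fin n) : ContDiffAt ℝ m (pd i u) x :=
  (h.fderiv_right hm).clm_apply contDiffAt_const

theorem ContDiff.pd {u : Eu n → ℝ} (h : ContDiff ℝ (⊤ : ℕ∞) u) (i : Fin n) :
    ContDiff ℝ (⊤ : ℕ∞) (pd i u) :=
  contDiff_iff_contDiffAt.2 fun x => h.contDiffAt.pd (by exact_mod_cast le_top) i

theorem ContDiff.pdMulti {u : Eu n → ℝ} (h : ContDiff ℝ (⊤ : ℕ∞) u) (L : List (Fin n)) :
    ContDiff ℝ (⊤ : ℕ∞) (pdMulti L u) := by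
  induction L with
  | nil => exact h
  | cons i L ih => exact ih.pd i

theorem pd2_eq_fderiv {u : Eu n → ℝ} {x : Eu n} (h : ContDiffAt ℝ 2 u x) (i j : Fin n) :
    pd2 i j u x =
      fderiv ℝ (fderiv ℝ u) x (EuclideanSpace.single i 1) (EuclideanSpace.single j 1) := by
  have h1 : DifferentiableAt ℝ (fderiv ℝ u) x :=
    (h.fderiv_right (m := 1) (by norm_num)).differentiableAt (by norm_num)
  unfold pd2
  change fderiv ℝ (fun z => fderiv ℝ u z (EuclideanSpace.single j 1)) x _ = _
  rw [fderiv_clm_apply h1 (differentiableAt_const _)]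
  simp

theorem pd2_comm {u : Eu n → ℝ} {x : Eu n} (h : ContDiffAt ℝ 2 u x) (i j : Fin n) :
    pd2 i j u x = pd2 j i u x := by
  rw [pd2_eq_fderiv h, pd2_eq_fderiv h]
  exact (h.isSymmSndFDerivAt (by simp)).eq _ _

theorem lapl_eq_laplacian {u : Eu n → ℝ} {x : Eu n} (h : ContDiffAt ℝ 2 u x) :
    lapl u x = Laplacian.laplacian u x := by
  rw [InnerProductSpace.laplacian_eq_iteratedFDeriv_orthonormalBasis u
    (EuclideanSpace.basisFun (Fin n) ℝ)]
  simp only [lapl, pd2_eq_fderiv h, iteratedFDeriv_two_apply]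
  simp

theorem lapl_congr {f g : Eu n → ℝ} {x : Eu n} (h : f =ᶠ[nhds x] g) :
    lapl f x = lapl g x :=
  Finset.sum_congr rfl fun _ _ => pd_congr (pd_eventuallyEq h)

end PartialDerivatives

/-- `u` is twice continuously differentiable near `x` and `Δu(x) = 0`. -/
def HarmAt (u : Eu n → ℝ) (x : Eu n) : Prop := ContDiffAt ℝ 2 u x ∧ lapl u x = 0

section Harm

theorem isHarmonicOn_iff {u : Eu n → ℝ} {D : Set (Eu n)} (hD : IsOpen D) :
    IsHarmonicOn u D ↔ ∀ x ∈ D, HarmAt u x :=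
  ⟨fun h x hx => ⟨(h.1 x hx).contDiffAt (hD.mem_nhds hx), h.2 x hx⟩,
    fun h => ⟨fun x hx => (h x hx).1.contDiffWithinAt, fun x hx => (h x hx).2⟩⟩

theorem HarmAt.congr {u v : Eu n → ℝ} {x : Eu n} (h : HarmAt u x) (e : u =ᶠ[nhds x] v) :
    HarmAt v x :=
  ⟨h.1.congr_of_eventuallyEq e.symm, by rw [← lapl_congr e, h.2]⟩

theorem HarmAt.add {u v : Eu n → ℝ} {x : Eu n} (hu : HarmAt u x) (hv : HarmAt v x) :
    HarmAt (fun y => u y + v y) x := by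
  have h : ContDiffAt ℝ 2 (fun y => u y + v y) x := hu.1.add hv.1
  refine ⟨h, ?_⟩
  rw [lapl_eq_laplacian h]
  have := ContDiffAt.laplacian_add hu.1 hv.1
  rw [← lapl_eq_laplacian hu.1, ← lapl_eq_laplacian hv.1, hu.2, hv.2, add_zero] at this
  exact this

theorem HarmAt.const_mul {u : Eu n → ℝ} {x : Eu n} (hu : HarmAt u x) (c : ℝ) :
    HarmAt (fun y => c * u y) x := by
  have h : ContDiffAt ℝ 2 (fun y => c * u y) x := contDiffAt_const.mul hu.1
  refine ⟨h, ?_⟩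
  rw [lapl_eq_laplacian h]
  have := InnerProductSpace.laplacian_smul c hu.1
  rw [← lapl_eq_laplacian hu.1, hu.2, smul_zero] at this
  exact this

theorem HarmAt.neg {u : Eu n → ℝ} {x : Eu n} (hu : HarmAt u x) : HarmAt (fun y => - u y) x := by
  simpa using hu.const_mul (-1)

theorem HarmAt.sub {u v : Eu n → ℝ} {x : Eu n} (hu : HarmAt u x) (hv : HarmAt v x) :
    HarmAt (fun y => u y - v y) x := by
  simpa [sub_eq_add_neg] using hu.add hv.neg

theorem harmAt_const (c : ℝ) (x : Eu n) : HarmAt (fun _ => c) x :=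
  ⟨contDiffAt_const, by simp [lapl, pd2, pd_const]⟩

theorem HarmAt.sum {ι : Type*} {s : Finset ι} {u : ι → Eu n → ℝ} {x : Eu n}
    (hu : ∀ j ∈ s, HarmAt (u j) x) : HarmAt (fun y => ∑ j ∈ s, u j y) x := by
  classical
  induction s using Finset.induction_on with
  | empty => simpa using harmAt_const 0 x
  | insert a s ha ih =>
    simp only [Finset.sum_insert ha]
    exact (hu a (by simp)).add (ih fun j hj => hu j (by simp [hj]))

theorem HarmAt.continuousAt {u : Eu n → ℝ} {x : Eu n} (hu : HarmAt u x) : ContinuousAt u x :=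
  hu.1.continuousAt

theorem HarmAt.differentiableAt {u : Eu n → ℝ} {x : Eu n} (hu : HarmAt u x) :
    DifferentiableAt ℝ u x :=
  hu.1.differentiableAt (by norm_num)

/-- Harmonicity is invariant under linear isometries. -/
theorem HarmAt.comp_isometry {u : Eu n → ℝ} {x : Eu n} (L : Eu n ≃ₗᵢ[ℝ] Eu n)
    (hu : HarmAt u (L x)) : HarmAt (fun y => u (L y)) x := by
  have hL : ContDiffAt ℝ 2 (fun y => L y) x := L.contDiff.contDiffAt
  have h : ContDiffAt ℝ 2 (fun y => u (L y)) x := hu.1.comp x hL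
  refine ⟨h, ?_⟩
  rw [lapl_eq_laplacian h]
  have h2 := hu.2
  rw [lapl_eq_laplacian hu.1, InnerProductSpace.laplacian_eq_iteratedFDeriv_orthonormalBasis u
    ((EuclideanSpace.basisFun (Fin n) ℝ).map L)] at h2
  rw [InnerProductSpace.laplacian_eq_iteratedFDeriv_orthonormalBasis _
    (EuclideanSpace.basisFun (Fin n) ℝ), ← h2]
  refine Finset.sum_congr rfl fun i _ => ?_
  have e := (L.toContinuousLinearEquiv).iteratedFDerivWithin_comp_right u (s := univ)
    uniqueDiffOn_univ (x := x) (mem_univ _) 2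
  simp only [preimage_univ, iteratedFDerivWithin_univ] at e
  have e' : (fun y => u (L y)) = u ∘ L.toContinuousLinearEquiv := rfl
  rw [e', e]
  simp only [ContinuousMultilinearMap.compContinuousLinearMap_apply]
  congr 1
  ext j : 1
  fin_cases j <;> simp

theorem fderiv_comp_affine {u : Eu n → ℝ} {a x : Eu n} {r : ℝ}
    (h : DifferentiableAt ℝ u (a + r • x)) :
    fderiv ℝ (fun y => u (a + r • y)) x = r • fderiv ℝ u (a + r • x) := by
  have h1 : HasFDerivAt (fun y : Eu n => a + r • y) (r • ContinuousLinearMap.id ℝ (Eu n)) x :=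
    ((hasFDerivAt_id x).const_smul r).const_add a
  have := (h.hasFDerivAt.comp x h1).fderiv
  simp only [Function.comp_def] at this
  rw [this]; ext v; simp

theorem pd_comp_affine {u : Eu n → ℝ} {a x : Eu n} {r : ℝ} {i : Fin n}
    (h : DifferentiableAt ℝ u (a + r • x)) :
    pd i (fun y => u (a + r • y)) x = r * pd i u (a + r • x) := by
  unfold pd; rw [fderiv_comp_affine h]; rfl

theorem continuous_affine (a : Eu n) (r : ℝ) : Continuous fun y : Eu n => a + r • y := by
  fun_prop

theorem HarmAt.comp_affine {u : Eu n → ℝ} {a x : Eu n} {r : ℝ} (hu : HarmAt u (a + r • x)) :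
    HarmAt (fun y => u (a + r • y)) x := by
  have h : ContDiffAt ℝ 2 (fun y => u (a + r • y)) x :=
    hu.1.comp x (by fun_prop)
  refine ⟨h, ?_⟩
  have e : ∀ᶠ y in nhds x, DifferentiableAt ℝ u (a + r • y) := by
    have := (hu.1.eventually (by simp)).mono
      fun y (hy : ContDiffAt ℝ 2 u y) => hy.differentiableAt (by norm_num)
    exact (continuous_affine a r).continuousAt.eventually this
  have : ∀ i, pd2 i i (fun y => u (a + r • y)) x = r * (r * pd2 i i u (a + r • x)) := by
    intro i
    have e1 : pd i (fun y => u (a + r • y)) =ᶠ[nhds x] fun y => r * pd i u (a + r • y) := by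
      filter_upwards [e] with y hy using pd_comp_affine hy
    have d : DifferentiableAt ℝ (pd i u) (a + r • x) :=
      (hu.1.pd (m := 1) (by norm_num) i).differentiableAt (by norm_num)
    unfold pd2
    rw [pd_congr e1, pd_const_mul r (f := fun y => pd i u (a + r • y))
      (d.comp x (f := fun y => a + r • y) (by fun_prop)), pd_comp_affine d]
  simp only [lapl, this, ← Finset.mul_sum]
  have h2 := hu.2
  simp only [lapl] at h2
  rw [h2]; simp

end Harm

section MaximumPrinciple

/-- The squared Euclidean norm, as a polynomial. -/
def nsq (x : Eu n) : ℝ := ∑ j, x j * x j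

theorem nsq_eq (x : Eu n) : nsq x = ‖x‖ ^ 2 := by
  rw [EuclideanSpace.real_norm_sq_eq]; simp [nsq, sq]

/-- The linear functional `x ↦ ⟪x, ν⟫`, as a polynomial. -/
def lin (ν : Eu n) (x : Eu n) : ℝ := ∑ j, x j * ν j

theorem lin_eq (ν x : Eu n) : lin ν x = ⟪x, ν⟫ := by
  simp [lin, PiLp.inner_apply, mul_comm]

theorem contDiff_nsq {m : WithTop ℕ∞} : ContDiff ℝ m (nsq : Eu n → ℝ) :=
  ContDiff.sum fun j _ => (contDiff_coord j).mul (contDiff_coord j)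

theorem contDiff_lin (ν : Eu n) {m : WithTop ℕ∞} : ContDiff ℝ m (lin ν) :=
  ContDiff.sum fun j _ => (contDiff_coord j).mul contDiff_const

theorem continuous_lin (ν : Eu n) : Continuous (lin ν) := (contDiff_lin ν (m := 0)).continuous

theorem differentiableAt_coord (j : Fin n) (x : Eu n) :
    DifferentiableAt ℝ (fun y : Eu n => y j) x := (hasFDerivAt_coord j x).differentiableAt

theorem pd_nsq (i : Fin n) : pd i (nsq : Eu n → ℝ) = fun x => 2 * x i := by
  funext x
  unfold nsq
  rw [pd_sum (f := fun j y => y j * y j) fun j _ => by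
    have := differentiableAt_coord j x; fun_prop]
  simp_rw [pd_mul (differentiableAt_coord _ x) (differentiableAt_coord _ x), pd_coord]
  simp [Finset.sum_add_distrib]; ring

theorem pd_lin (ν : Eu n) (i : Fin n) : pd i (lin ν) = fun _ => ν i := by
  funext x
  unfold lin
  rw [pd_sum (f := fun j y => y j * ν j) fun j _ => by
    have := differentiableAt_coord j x; fun_prop]
  simp_rw [pd_mul (differentiableAt_coord _ x) (differentiableAt_const _), pd_coord, pd_const]
  simp

theorem lapl_nsq (x : Eu n) : lapl nsq x = 2 * n := by
  simp only [lapl, pd2]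
  have : ∀ i : Fin n, pd i (fun z => pd i nsq z) x = 2 := fun i => by
    simp only [pd_nsq]
    rw [pd_const_mul _ (differentiableAt_coord i x), pd_coord]; simp
  simp [this]; ring

theorem pd2_nonpos_of_isLocalMax {u : Eu n → ℝ} {x : Eu n} (hu : ContDiffAt ℝ 2 u x)
    (hm : IsLocalMax u x) (i : Fin n) : pd2 i i u x ≤ 0 := by
  by_contra! hpos
  set e : Eu n := EuclideanSpace.single i 1
  set φ : ℝ → ℝ := fun s => u (x + s • e)
  have hcont : Continuous fun s : ℝ => x + s • e := by fun_prop
  have hl : ∀ s : ℝ, HasDerivAt (fun s : ℝ => x + s • e) e s := fun s => by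
    simpa using ((hasDerivAt_id s).smul_const e).const_add x
  have ev : ∀ᶠ s in nhds (0 : ℝ), DifferentiableAt ℝ u (x + s • e) := by
    have := (hu.eventually (by simp)).mono
      fun y (hy : ContDiffAt ℝ 2 u y) => hy.differentiableAt (by norm_num)
    have h0 : x = x + (0 : ℝ) • e := by simp
    rw [h0] at this
    exact hcont.continuousAt.eventually this
  have d1 : deriv φ =ᶠ[nhds 0] fun s => pd i u (x + s • e) := by
    filter_upwards [ev] with s hs
    exact (hs.hasFDerivAt.comp_hasDerivAt s (hl s)).deriv
  have d2 : deriv (deriv φ) 0 = pd2 i i u x := by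
    rw [d1.deriv_eq]
    have hd : DifferentiableAt ℝ (pd i u) (x + (0 : ℝ) • e) := by
      simpa using (hu.pd (m := 1) (by norm_num) i).differentiableAt (by norm_num)
    have := (hd.hasFDerivAt.comp_hasDerivAt (0 : ℝ) (hl 0)).deriv
    simp only [Function.comp_def] at this
    rw [this, zero_smul, add_zero]; rfl
  have hmax : IsLocalMax φ 0 := by
    have h0 : x = x + (0 : ℝ) • e := by simp
    have : ∀ᶠ y in nhds (x + (0 : ℝ) • e), u y ≤ u x := by rw [← h0]; exact hm
    have := hcont.continuousAt.eventually this
    simpa [IsLocalMax, IsMaxFilter, φ] using this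
  have hmin : IsLocalMin φ 0 := by
    refine isLocalMin_of_deriv_deriv_pos (by rw [d2]; exact hpos) hmax.deriv_eq_zero ?_
    have : ContinuousAt u (x + (0 : ℝ) • e) := by simpa using hu.continuousAt
    exact ContinuousAt.comp (f := fun s : ℝ => x + s • e) this hcont.continuousAt
  have hc : φ =ᶠ[nhds 0] fun _ => φ 0 := by
    filter_upwards [hmax, hmin] with s h1 h2 using le_antisymm h1 h2
  have : deriv (deriv φ) 0 = 0 := by
    have h1 : deriv φ =ᶠ[nhds 0] deriv fun _ => φ 0 := hc.deriv
    rw [h1.deriv_eq]; simp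
  linarith

/-- The weak maximum principle for harmonic functions. -/
theorem max_principle (hn : 0 < n) {O : Set (Eu n)} (hO : IsOpen O)
    (hb : Bornology.IsBounded O) {u : Eu n → ℝ} (hc : ContinuousOn u (closure O))
    (hu : ∀ x ∈ O, HarmAt u x) {M : ℝ} (hM : ∀ x ∈ frontier O, u x ≤ M) :
    ∀ x ∈ O, u x ≤ M := by
  intro x0 hx0
  by_contra! hlt
  obtain ⟨R, hR⟩ := hb.closure.exists_norm_le
  set s := (u x0 - M) / (R ^ 2 + 1)
  have hs : 0 < s := div_pos (by linarith) (by positivity)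
  have hsR : s * R ^ 2 < u x0 - M := by
    have : s * (R ^ 2 + 1) = u x0 - M := div_mul_cancel₀ _ (by positivity)
    nlinarith
  set v : Eu n → ℝ := fun x => u x + s * nsq x
  have hvc : ContinuousOn v (closure O) :=
    hc.add (continuous_const.mul (contDiff_nsq (m := 0)).continuous).continuousOn
  obtain ⟨x1, hx1, hmax⟩ := (hb.isCompact_closure).exists_isMaxOn ⟨x0, subset_closure hx0⟩ hvc
  have h01 : v x0 ≤ v x1 := hmax (subset_closure hx0)
  have hx1O : x1 ∈ O := by
    by_contra hx
    have hf : x1 ∈ frontier O := by rw [hO.frontier_eq]; exact ⟨hx1, hx⟩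
    have h2 : v x1 ≤ M + s * R ^ 2 := by
      have : nsq x1 ≤ R ^ 2 := by
        rw [nsq_eq]; exact pow_le_pow_left₀ (norm_nonneg _) (hR x1 hx1) 2
      exact add_le_add (hM x1 hf) (mul_le_mul_of_nonneg_left this hs.le)
    have h3 : u x0 ≤ v x0 := by
      have : 0 ≤ nsq x0 := by rw [nsq_eq]; positivity
      simp only [v]; nlinarith
    linarith
  have hloc : IsLocalMax v x1 := by
    filter_upwards [hO.mem_nhds hx1O] with y hy using hmax (subset_closure hy)
  have hq : ContDiffAt ℝ 2 (fun x : Eu n => s * nsq x) x1 :=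
    contDiffAt_const.mul contDiff_nsq.contDiffAt
  have hv2 : ContDiffAt ℝ 2 v x1 := (hu x1 hx1O).1.add hq
  have hle : lapl v x1 ≤ 0 := Finset.sum_nonpos fun i _ => pd2_nonpos_of_isLocalMax hv2 hloc i
  have h4 : lapl v x1 = s * (2 * n) := by
    rw [lapl_eq_laplacian hv2]
    have := ContDiffAt.laplacian_add (hu x1 hx1O).1 hq
    rw [← lapl_eq_laplacian (hu x1 hx1O).1, (hu x1 hx1O).2] at this
    have h5 := InnerProductSpace.laplacian_smul s (contDiff_nsq (n := n)).contDiffAt (x := x1)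
    rw [← lapl_eq_laplacian contDiff_nsq.contDiffAt, lapl_nsq] at h5
    have h6 : Laplacian.laplacian v x1 = 0 + Laplacian.laplacian (s • (nsq : Eu n → ℝ)) x1 := this
    rw [h6, h5]; simp
  have : (0 : ℝ) < n := by exact_mod_cast hn
  have : 0 < s * (2 * n) := by positivity
  linarith

theorem abs_max_principle (hn : 0 < n) {O : Set (Eu n)} (hO : IsOpen O)
    (hb : Bornology.IsBounded O) {u : Eu n → ℝ} (hc : ContinuousOn u (closure O))
    (hu : ∀ x ∈ O, HarmAt u x) {M : ℝ} (hM : ∀ x ∈ frontier O, |u x| ≤ M) :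
    ∀ x ∈ O, |u x| ≤ M := by
  intro x hx
  refine abs_le.2 ⟨?_, max_principle hn hO hb hc hu (fun y hy => (abs_le.1 (hM y hy)).2) x hx⟩
  have := max_principle hn hO hb hc.neg (fun y hy => (hu y hy).neg)
    (M := M) (fun y hy => by have := (abs_le.1 (hM y hy)).1; simp only [Pi.neg_apply]; linarith) x hx
  simp only [Pi.neg_apply] at this
  linarith

/-- The reflection in the hyperplane orthogonal to `ν`. -/
def hrefl (ν : Eu n) : Eu n ≃ₗᵢ[ℝ] Eu n := (Submodule.span ℝ {ν})ᗮ.reflection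

theorem hrefl_apply {ν : Eu n} (hν : ‖ν‖ = 1) (x : Eu n) :
    hrefl ν x = x - (2 * lin ν x) • ν := by
  rw [hrefl, Submodule.reflection_orthogonal_apply, Submodule.reflection_singleton_apply, hν,
    lin_eq, real_inner_comm]
  simp [mul_smul, two_smul]

theorem hrefl_hrefl (ν x : Eu n) : hrefl ν (hrefl ν x) = x :=
  Submodule.reflection_reflection _ _

theorem lin_self {ν : Eu n} (hν : ‖ν‖ = 1) : lin ν ν = 1 := by
  rw [lin_eq, real_inner_self_eq_norm_sq, hν]; norm_num

theorem lin_sub (ν x y : Eu n) : lin ν (x - y) = lin ν x - lin ν y := by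
  simp [lin_eq, inner_sub_left]

theorem lin_add (ν x y : Eu n) : lin ν (x + y) = lin ν x + lin ν y := by
  simp [lin_eq, inner_add_left]

theorem lin_smul (ν : Eu n) (c : ℝ) (x : Eu n) : lin ν (c • x) = c * lin ν x := by
  simp [lin_eq, inner_smul_left]

theorem lin_zero (ν : Eu n) : lin ν 0 = 0 := by simp [lin]

theorem lin_hrefl {ν : Eu n} (hν : ‖ν‖ = 1) (x : Eu n) : lin ν (hrefl ν x) = - lin ν x := by
  rw [hrefl_apply hν, lin_sub, lin_smul, lin_self hν]; ring

theorem abs_lin_le {ν : Eu n} (hν : ‖ν‖ = 1) (x : Eu n) : |lin ν x| ≤ ‖x‖ := by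
  rw [lin_eq]; simpa [hν] using abs_real_inner_le_norm x ν

theorem hrefl_eq_self {ν : Eu n} (hν : ‖ν‖ = 1) {x : Eu n} (h : lin ν x = 0) :
    hrefl ν x = x := by
  rw [hrefl_apply hν, h]; simp

/-- A harmonic polynomial which is nonnegative on a half ball. -/
theorem harmAt_barrier {ν : Eu n} (hν : ‖ν‖ = 1) (c : ℝ) (x : Eu n) :
    HarmAt (fun y => nsq y - n * (lin ν y * lin ν y) + c * lin ν y) x := by
  have dl : ∀ y, DifferentiableAt ℝ (lin ν) y := fun y =>
    (contDiff_lin ν (m := 1)).differentiable (by norm_num) y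
  have dq : ∀ y : Eu n, DifferentiableAt ℝ nsq y := fun y =>
    (contDiff_nsq (m := 1)).differentiable (by norm_num) y
  refine ⟨((contDiff_nsq.sub (contDiff_const.mul ((contDiff_lin ν).mul (contDiff_lin ν)))).add
    (contDiff_const.mul (contDiff_lin ν))).contDiffAt, ?_⟩
  have h1 : ∀ i, pd i (fun y => nsq y - n * (lin ν y * lin ν y) + c * lin ν y) =
      fun y => 2 * y i - (2 * n * ν i) * lin ν y + c * ν i := by
    intro i; funext y
    have d1 := dl y
    have d2 := dq y
    rw [pd_add (f := fun y => nsq y - n * (lin ν y * lin ν y)) (g := fun y => c * lin ν y)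
      (by fun_prop) (by fun_prop), pd_sub (f := nsq) (g := fun y => n * (lin ν y * lin ν y))
      d2 (by fun_prop), pd_const_mul (f := fun y => lin ν y * lin ν y) _ (by fun_prop),
      pd_const_mul _ d1, pd_mul d1 d1, pd_nsq, pd_lin]
    ring
  have h2 : ∀ i, pd2 i i (fun y => nsq y - n * (lin ν y * lin ν y) + c * lin ν y) x =
      2 - 2 * n * (ν i * ν i) := by
    intro i
    unfold pd2
    have d1 := dl x
    have d2 := differentiableAt_coord i x
    rw [h1, pd_add (f := fun y => 2 * y i - (2 * n * ν i) * lin ν y) (g := fun _ => c * ν i)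
      (by fun_prop) (by fun_prop), pd_sub (f := fun y => 2 * y i)
      (g := fun y => (2 * n * ν i) * lin ν y) (by fun_prop) (by fun_prop),
      pd_const_mul _ d2, pd_const_mul _ d1, pd_coord, pd_lin, pd_const]
    simp; ring
  simp only [lapl, h2, Finset.sum_sub_distrib, ← Finset.mul_sum]
  have h3 : ∑ i, ν i * ν i = 1 := by
    have := nsq_eq ν; rw [hν] at this; simpa [nsq] using this
  rw [h3]; simp; ring

theorem pd_le_of_harm (hn : 0 < n) {u : Eu n → ℝ} {a : Eu n} {r M : ℝ} (hr : 0 < r)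
    (hu : ∀ x ∈ closedBall a r, HarmAt u x) (hM : ∀ x ∈ closedBall a r, |u x| ≤ M) (i : Fin n) :
    pd i u a ≤ n / r * M := by
  set e : Eu n := EuclideanSpace.single i 1 with he
  have hν : ‖e‖ = 1 := by simp [he]
  have hM0 : 0 ≤ M := (abs_nonneg _).trans (hM a (mem_closedBall_self hr.le))
  set b : Eu n → ℝ := fun y => nsq y - n * (lin e y * lin e y) + (n * r) * lin e y with hb
  have hbh : ∀ y, HarmAt b y := fun y => harmAt_barrier hν _ y
  set w : Eu n → ℝ := fun y =>
    u (a + (1 : ℝ) • y) - u (a + (1 : ℝ) • hrefl e y) - (2 * M / r ^ 2) * b y with hw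
  set H : Set (Eu n) := ball 0 r ∩ {y | 0 < lin e y} with hH
  have hHo : IsOpen H := isOpen_ball.inter (isOpen_lt continuous_const (continuous_lin e))
  have hcl : closure H ⊆ closedBall 0 r ∩ {y | 0 ≤ lin e y} := by
    refine closure_minimal (fun y hy => ⟨ball_subset_closedBall hy.1, (show 0 < lin e y from hy.2).le⟩) ?_
    exact isClosed_closedBall.inter (isClosed_le continuous_const (continuous_lin e))
  have mem1 : ∀ y ∈ closedBall (0 : Eu n) r, a + (1 : ℝ) • y ∈ closedBall a r := by
    intro y hy; simpa [mem_closedBall, dist_eq_norm] using hy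
  have mem2 : ∀ y ∈ closedBall (0 : Eu n) r, a + (1 : ℝ) • hrefl e y ∈ closedBall a r := by
    intro y hy; simpa [mem_closedBall, dist_eq_norm] using hy
  have hwh : ∀ y ∈ closedBall (0 : Eu n) r, HarmAt w y := by
    intro y hy
    refine ((hu _ (mem1 y hy)).comp_affine.sub ?_).sub ((hbh y).const_mul _)
    exact HarmAt.comp_isometry (u := fun z => u (a + (1 : ℝ) • z)) (hrefl e)
      (hu _ (mem2 y hy)).comp_affine
  have hle : ∀ y ∈ H, w y ≤ 0 := by
    refine max_principle hn hHo (isBounded_ball.subset inter_subset_left)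
      (fun y hy => (hwh y (hcl hy).1).continuousAt.continuousWithinAt)
      (fun y hy => hwh y (ball_subset_closedBall hy.1)) ?_
    intro y hy
    rw [hHo.frontier_eq] at hy
    obtain ⟨hy1, hy2⟩ := hcl hy.1
    have hy2' : 0 ≤ lin e y := hy2
    have hyr : ‖y‖ ≤ r := by simpa using hy1
    have hly : lin e y ≤ ‖y‖ := (le_abs_self _).trans (abs_lin_le hν y)
    have hbe : b y = ‖y‖ ^ 2 + n * (lin e y * (r - lin e y)) := by
      simp only [hb, nsq_eq]; ring
    have hb0 : ‖y‖ ^ 2 ≤ b y := by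
      rw [hbe]
      have : 0 ≤ (n : ℝ) * (lin e y * (r - lin e y)) :=
        mul_nonneg (Nat.cast_nonneg n) (mul_nonneg hy2' (by linarith))
      linarith
    by_cases h0 : lin e y = 0
    · simp only [hw]
      rw [hrefl_eq_self hν h0]
      have : 0 ≤ 2 * M / r ^ 2 * b y := by
        have : 0 ≤ b y := le_trans (by positivity) hb0
        positivity
      linarith
    · have hpos : 0 < lin e y := lt_of_le_of_ne hy2' (Ne.symm h0)
      have hyr' : ‖y‖ = r := by
        refine le_antisymm hyr ?_
        by_contra! hlt
        exact hy.2 ⟨by simpa using hlt, hpos⟩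
      rw [hyr'] at hb0
      have h1 := (abs_le.1 (hM _ (mem1 y hy1))).2
      have h2 := (abs_le.1 (hM _ (mem2 y hy1))).1
      have h3 : 2 * M ≤ 2 * M / r ^ 2 * b y := by
        calc 2 * M = 2 * M / r ^ 2 * r ^ 2 := by field_simp
          _ ≤ _ := by gcongr
      simp only [hw]
      linarith
  have hde : HasDerivAt (fun s : ℝ => w (s • e))
      (2 * pd i u a - 2 * (n / r * M)) 0 := by
    have hua : HasFDerivAt u (fderiv ℝ u a) a :=
      (hu a (mem_closedBall_self hr.le)).differentiableAt.hasFDerivAt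
    have l1 : HasDerivAt (fun s : ℝ => a + s • e) e 0 := by
      simpa using ((hasDerivAt_id (0 : ℝ)).smul_const e).const_add a
    have l2 : HasDerivAt (fun s : ℝ => a + (-s) • e) (-e) 0 := by
      simpa using ((hasDerivAt_id (0 : ℝ)).neg.smul_const e).const_add a
    have d1 : HasDerivAt (fun s : ℝ => u (a + s • e)) (pd i u a) 0 :=
      HasFDerivAt.comp_hasDerivAt (0 : ℝ) (l := u) (f := fun s : ℝ => a + s • e)
        (by simpa using hua) l1
    have d2 : HasDerivAt (fun s : ℝ => u (a + (-s) • e)) (- pd i u a) 0 := by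
      have := HasFDerivAt.comp_hasDerivAt (0 : ℝ) (l := u) (f := fun s : ℝ => a + (-s) • e)
        (l' := fderiv ℝ u a) (by simpa using hua) l2
      rw [map_neg] at this
      exact this
    have d3 : HasDerivAt (fun s : ℝ => (2 * M / r ^ 2) * (s ^ 2 - n * s ^ 2 + n * r * s))
        ((2 * M / r ^ 2) * (n * r)) 0 := by
      have h2 : HasDerivAt (fun s : ℝ => s ^ 2) 0 0 := by simpa using hasDerivAt_pow 2 (0 : ℝ)
      have := ((h2.sub (h2.const_mul (n : ℝ))).add
        ((hasDerivAt_id (0 : ℝ)).const_mul (n * r))).const_mul (2 * M / r ^ 2)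
      simpa using this
    have := (d1.sub d2).sub d3
    have hfun : (fun s : ℝ => w (s • e)) = fun s : ℝ => u (a + s • e) - u (a + (-s) • e) -
        (2 * M / r ^ 2) * (s ^ 2 - n * s ^ 2 + n * r * s) := by
      funext s
      have h1 : lin e e = 1 := lin_self hν
      have h2 : lin e (s • e) = s := by rw [lin_smul, h1, mul_one]
      simp only [hw, hb, nsq_eq, hrefl_apply hν, h2, norm_smul, hν, one_smul]
      have : s • e - (2 * s) • e = (-s) • e := by module
      rw [this]
      simp only [norm_eq_abs, mul_one, sq_abs]
      ring
    rw [hfun]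
    refine this.congr_deriv ?_
    have := hr.ne'
    field_simp
    ring
  have hw0 : w ((0 : ℝ) • e) = 0 := by
    simp [hw, hb, lin, nsq]
  have hfin : 2 * pd i u a - 2 * (n / r * M) ≤ 0 := by
    have ht := hde.tendsto_slope_zero_right
    refine le_of_tendsto ht ?_
    have : ∀ᶠ s in nhdsWithin (0 : ℝ) (Ioi 0), s ∈ Ioo 0 r := Ioo_mem_nhdsGT hr
    filter_upwards [this] with s hs
    have h1 : w (s • e) ≤ 0 := by
      refine hle _ ⟨?_, ?_⟩
      · simp [norm_smul, hν, abs_of_pos hs.1, hs.2]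
      · have h1 : lin e e = 1 := lin_self hν
        change 0 < lin e (s • e); rw [lin_smul, h1, mul_one]; exact hs.1
    rw [zero_add, hw0, sub_zero, smul_eq_mul]
    exact mul_nonpos_of_nonneg_of_nonpos (inv_nonneg.2 hs.1.le) h1
  linarith

/-- The gradient estimate for harmonic functions. -/
theorem abs_pd_le_of_harm (hn : 0 < n) {u : Eu n → ℝ} {a : Eu n} {r M : ℝ} (hr : 0 < r)
    (hu : ∀ x ∈ closedBall a r, HarmAt u x) (hM : ∀ x ∈ closedBall a r, |u x| ≤ M) (i : Fin n) :
    |pd i u a| ≤ n / r * M := by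
  refine abs_le.2 ⟨?_, pd_le_of_harm hn hr hu hM i⟩
  have := pd_le_of_harm hn hr (fun x hx => (hu x hx).neg) (fun x hx => by simpa using hM x hx) i
  rw [pd_neg] at this
  linarith

end MaximumPrinciple

section SmoothCalculus

/-- Smooth functions on `ℝⁿ`. -/
abbrev Sm (f : Eu n → ℝ) : Prop := ContDiff ℝ (⊤ : ℕ∞) f

theorem Sm.diff {f : Eu n → ℝ} (h : Sm f) : Differentiable ℝ f := h.differentiable (by simp)

theorem Sm.two {f : Eu n → ℝ} (h : Sm f) (x : Eu n) : ContDiffAt ℝ 2 f x :=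
  (h.of_le (WithTop.coe_le_coe.2 (le_top : (2 : ℕ∞) ≤ ⊤))).contDiffAt

theorem pd_add_sm {f g : Eu n → ℝ} (hf : Sm f) (hg : Sm g) (i : Fin n) :
    pd i (fun y => f y + g y) = fun y => pd i f y + pd i g y := by
  funext x; exact pd_add (hf.diff x) (hg.diff x)

theorem pd_mul_sm {f g : Eu n → ℝ} (hf : Sm f) (hg : Sm g) (i : Fin n) :
    pd i (fun y => f y * g y) = fun y => pd i f y * g y + f y * pd i g y := by
  funext x; exact pd_mul (hf.diff x) (hg.diff x)

theorem pd_const_mul_sm {f : Eu n → ℝ} (hf : Sm f) (c : ℝ) (i : Fin n) :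
    pd i (fun y => c * f y) = fun y => c * pd i f y := by
  funext x; exact pd_const_mul c (hf.diff x)

theorem pd_sum_sm {ι : Type*} {s : Finset ι} {f : ι → Eu n → ℝ} (hf : ∀ j ∈ s, Sm (f j))
    (i : Fin n) : pd i (fun y => ∑ j ∈ s, f j y) = fun y => ∑ j ∈ s, pd i (f j) y := by
  funext x; exact pd_sum fun j hj => (hf j hj).diff x

theorem Sm.add {f g : Eu n → ℝ} (hf : Sm f) (hg : Sm g) : Sm fun y => f y + g y :=
  ContDiff.add hf hg

theorem Sm.sub {f g : Eu n → ℝ} (hf : Sm f) (hg : Sm g) : Sm fun y => f y - g y :=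
  ContDiff.sub hf hg

theorem Sm.mul {f g : Eu n → ℝ} (hf : Sm f) (hg : Sm g) : Sm fun y => f y * g y :=
  ContDiff.mul hf hg

theorem Sm.const_mul {f : Eu n → ℝ} (hf : Sm f) (c : ℝ) : Sm fun y => c * f y :=
  ContDiff.mul contDiff_const hf

theorem Sm.sum {ι : Type*} {s : Finset ι} {f : ι → Eu n → ℝ} (hf : ∀ j ∈ s, Sm (f j)) :
    Sm fun y => ∑ j ∈ s, f j y :=
  ContDiff.sum hf

theorem lapl_add {f g : Eu n → ℝ} (hf : Sm f) (hg : Sm g) (x : Eu n) :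
    lapl (fun y => f y + g y) x = lapl f x + lapl g x := by
  simp only [lapl, pd2, ← Finset.sum_add_distrib]
  refine Finset.sum_congr rfl fun i _ => ?_
  rw [pd_add_sm hf hg]
  exact pd_add ((hf.pd i).differentiable (by simp) x) ((hg.pd i).differentiable (by simp) x)

theorem lapl_const_mul {f : Eu n → ℝ} (hf : Sm f) (c : ℝ) (x : Eu n) :
    lapl (fun y => c * f y) x = c * lapl f x := by
  simp only [lapl, pd2, Finset.mul_sum]
  refine Finset.sum_congr rfl fun i _ => ?_
  rw [pd_const_mul_sm hf]
  exact pd_const_mul c ((hf.pd i).differentiable (by simp) x)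

theorem lapl_sub {f g : Eu n → ℝ} (hf : Sm f) (hg : Sm g) (x : Eu n) :
    lapl (fun y => f y - g y) x = lapl f x - lapl g x := by
  have := lapl_add hf (hg.const_mul (-1)) x
  rw [lapl_const_mul hg] at this
  simp only [neg_mul, one_mul, ← sub_eq_add_neg] at this
  exact this

theorem lapl_const (c : ℝ) (x : Eu n) : lapl (fun _ => c) x = 0 := by
  simp [lapl, pd2, pd_const]

theorem sm_const (c : ℝ) : Sm (fun _ : Eu n => c) := contDiff_const

theorem lapl_sum {ι : Type*} {s : Finset ι} {f : ι → Eu n → ℝ} (hf : ∀ j ∈ s, Sm (f j))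
    (x : Eu n) : lapl (fun y => ∑ j ∈ s, f j y) x = ∑ j ∈ s, lapl (f j) x := by
  simp only [lapl, pd2]
  rw [Finset.sum_comm]
  refine Finset.sum_congr rfl fun i _ => ?_
  rw [pd_sum_sm hf]
  exact pd_sum (f := fun j => pd i (f j)) fun j hj => ((hf j hj).pd i).differentiable (by simp) x

theorem lapl_mul {f g : Eu n → ℝ} (hf : Sm f) (hg : Sm g) (x : Eu n) :
    lapl (fun y => f y * g y) x =
      lapl f x * g x + f x * lapl g x + 2 * ∑ i, pd i f x * pd i g x := by
  simp only [lapl, pd2, Finset.mul_sum, Finset.sum_mul, ← Finset.sum_add_distrib]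
  refine Finset.sum_congr rfl fun i _ => ?_
  rw [pd_mul_sm hf hg, pd_add_sm (Sm.mul (hf.pd i) hg) (Sm.mul hf (hg.pd i)),
    pd_mul_sm (hf.pd i) hg, pd_mul_sm hf (hg.pd i)]
  ring

theorem Sm.lapl {f : Eu n → ℝ} (hf : Sm f) : Sm (lapl f) :=
  Sm.sum fun i _ => (hf.pd i).pd i

theorem Sm.harmAt {f : Eu n → ℝ} (hf : Sm f) (h : ∀ x, _root_.lapl f x = 0) (x : Eu n) :
    HarmAt f x := ⟨hf.two x, h x⟩

end SmoothCalculus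

section HomogeneousPolynomials

/-- Homogeneous polynomials of degree `m` whose (non-symmetric) coefficients are bounded by
`c`. -/
def HomB : ℕ → ℝ → (Eu n → ℝ) → Prop
  | 0, c, f => ∃ a : ℝ, |a| ≤ c ∧ f = fun _ => a
  | m + 1, c, f => 0 ≤ c ∧ ∃ g : Fin n → Eu n → ℝ, (∀ i, HomB m c (g i)) ∧
      f = fun x => ∑ i, x i * g i x

namespace HomB

theorem nonneg {m : ℕ} {c : ℝ} {f : Eu n → ℝ} (h : HomB m c f) : 0 ≤ c := by
  cases m with
  | zero => obtain ⟨a, ha, -⟩ := h; exact (abs_nonneg a).trans ha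
  | succ m => exact h.1

theorem sm {m : ℕ} {c : ℝ} {f : Eu n → ℝ} (h : HomB m c f) : Sm f := by
  induction m generalizing f with
  | zero => obtain ⟨a, -, rfl⟩ := h; exact contDiff_const
  | succ m ih =>
    obtain ⟨-, g, hg, rfl⟩ := h
    exact Sm.sum fun i _ => Sm.mul (contDiff_coord i) (ih (hg i))

theorem mono {m : ℕ} {c c' : ℝ} {f : Eu n → ℝ} (h : HomB m c f) (hc : c ≤ c') :
    HomB m c' f := by
  induction m generalizing f with
  | zero => obtain ⟨a, ha, rfl⟩ := h; exact ⟨a, ha.trans hc, rfl⟩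
  | succ m ih =>
    obtain ⟨h0, g, hg, rfl⟩ := h
    exact ⟨h0.trans hc, g, fun i => ih (hg i), rfl⟩

theorem zero (m : ℕ) : HomB m 0 (fun _ : Eu n => (0 : ℝ)) := by
  induction m with
  | zero => exact ⟨0, by simp, rfl⟩
  | succ m ih => exact ⟨le_rfl, fun _ _ => 0, fun _ => ih, by simp⟩

theorem const_mul {m : ℕ} {c : ℝ} {f : Eu n → ℝ} (h : HomB m c f) (a : ℝ) :
    HomB m (|a| * c) (fun x => a * f x) := by
  induction m generalizing f with
  | zero =>
    obtain ⟨b, hb, rfl⟩ := h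
    exact ⟨a * b, by rw [abs_mul]; gcongr, rfl⟩
  | succ m ih =>
    obtain ⟨h0, g, hg, rfl⟩ := h
    refine ⟨by positivity, fun i x => a * g i x, fun i => ih (hg i), ?_⟩
    funext x; rw [Finset.mul_sum]; exact Finset.sum_congr rfl fun i _ => by ring

theorem neg {m : ℕ} {c : ℝ} {f : Eu n → ℝ} (h : HomB m c f) :
    HomB m c (fun x => - f x) := by
  simpa using h.const_mul (-1)

theorem add {m : ℕ} {c c' : ℝ} {f f' : Eu n → ℝ} (h : HomB m c f) (h' : HomB m c' f') :
    HomB m (c + c') (fun x => f x + f' x) := by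
  induction m generalizing f f' with
  | zero =>
    obtain ⟨a, ha, rfl⟩ := h
    obtain ⟨a', ha', rfl⟩ := h'
    exact ⟨a + a', (abs_add_le _ _).trans (add_le_add ha ha'), rfl⟩
  | succ m ih =>
    obtain ⟨h0, g, hg, rfl⟩ := h
    obtain ⟨h0', g', hg', rfl⟩ := h'
    refine ⟨by positivity, fun i x => g i x + g' i x, fun i => ih (hg i) (hg' i), ?_⟩
    funext x; rw [← Finset.sum_add_distrib]; exact Finset.sum_congr rfl fun i _ => by ring

theorem sub {m : ℕ} {c c' : ℝ} {f f' : Eu n → ℝ} (h : HomB m c f) (h' : HomB m c' f') :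
    HomB m (c + c') (fun x => f x - f' x) := by
  simpa [sub_eq_add_neg] using h.add h'.neg

theorem sum {ι : Type*} {s : Finset ι} {m : ℕ} {c : ι → ℝ} {f : ι → Eu n → ℝ}
    (h : ∀ j ∈ s, HomB m (c j) (f j)) :
    HomB m (∑ j ∈ s, c j) (fun x => ∑ j ∈ s, f j x) := by
  classical
  induction s using Finset.induction_on with
  | empty => simpa using zero m
  | insert a s ha ih =>
    simp only [Finset.sum_insert ha]
    exact (h a (by simp)).add (ih fun j hj => h j (by simp [hj]))

theorem sum_const {m : ℕ} {c : ℝ} {f : Fin n → Eu n → ℝ}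
    (h : ∀ j, HomB m c (f j)) : HomB m (n * c) (fun x => ∑ j, f j x) := by
  simpa using sum (s := Finset.univ) (c := fun _ => c) fun j _ => h j

theorem mul {m m' : ℕ} {c c' : ℝ} {f f' : Eu n → ℝ} (h : HomB m c f) (h' : HomB m' c' f') :
    HomB (m + m') (c * c') (fun x => f x * f' x) := by
  induction m generalizing f with
  | zero =>
    obtain ⟨a, ha, rfl⟩ := h
    rw [zero_add]
    exact (h'.const_mul a).mono (mul_le_mul_of_nonneg_right ha h'.nonneg)
  | succ m ih =>
    obtain ⟨h0, g, hg, rfl⟩ := h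
    rw [Nat.succ_add]
    refine ⟨mul_nonneg h0 h'.nonneg, fun i x => g i x * f' x, fun i => ih (hg i), ?_⟩
    funext x; rw [Finset.sum_mul]; exact Finset.sum_congr rfl fun i _ => by ring

theorem one : HomB 0 1 (fun _ : Eu n => (1 : ℝ)) := ⟨1, by simp, rfl⟩

theorem pow {m : ℕ} {c : ℝ} {f : Eu n → ℝ} (h : HomB m c f) (a : ℕ) :
    HomB (a * m) (c ^ a) (fun x => f x ^ a) := by
  induction a with
  | zero => simpa using one
  | succ a ih =>
    have := ih.mul h
    simp only [← pow_succ] at this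
    rwa [Nat.succ_mul]

theorem coord (j : Fin n) : HomB 1 1 (fun x : Eu n => x j) := by
  refine ⟨zero_le_one, fun i _ => if i = j then 1 else 0, fun i => ⟨_, ?_, rfl⟩, ?_⟩
  · split_ifs <;> simp
  · funext x; simp

theorem lin {ν : Eu n} {c : ℝ} (hν : ‖ν‖ ≤ c) : HomB 1 c (lin ν) :=
  ⟨(norm_nonneg _).trans hν, fun i _ => ν i,
    fun i => ⟨ν i, (PiLp.norm_apply_le ν i).trans hν, rfl⟩, rfl⟩

theorem nsq : HomB 2 1 (nsq : Eu n → ℝ) :=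
  ⟨zero_le_one, fun i x => x i, fun i => coord i, rfl⟩

theorem abs_le {m : ℕ} {c : ℝ} {f : Eu n → ℝ} (h : HomB m c f) (x : Eu n) :
    |f x| ≤ c * (n * ‖x‖) ^ m := by
  induction m generalizing f with
  | zero => obtain ⟨a, ha, rfl⟩ := h; simpa using ha
  | succ m ih =>
    obtain ⟨h0, g, hg, rfl⟩ := h
    calc |∑ i, x i * g i x| ≤ ∑ i : Fin n, ‖x‖ * (c * (n * ‖x‖) ^ m) := by
          refine (Finset.abs_sum_le_sum_abs _ _).trans (Finset.sum_le_sum fun i _ => ?_)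
          rw [abs_mul]
          exact mul_le_mul (PiLp.norm_apply_le x i) (ih (hg i)) (abs_nonneg _) (norm_nonneg _)
      _ = _ := by simp; ring

theorem smul_apply {m : ℕ} {c : ℝ} {f : Eu n → ℝ} (h : HomB m c f) (s : ℝ) (x : Eu n) :
    f (s • x) = s ^ m * f x := by
  induction m generalizing f with
  | zero => obtain ⟨a, -, rfl⟩ := h; simp
  | succ m ih =>
    obtain ⟨h0, g, hg, rfl⟩ := h
    simp only [ih (hg _), Finset.mul_sum, PiLp.smul_apply, smul_eq_mul]
    exact Finset.sum_congr rfl fun i _ => by ring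

theorem pd_zero {c : ℝ} {f : Eu n → ℝ} (h : HomB 0 c f) (i : Fin n) : pd i f = fun _ => 0 := by
  obtain ⟨a, -, rfl⟩ := h; exact pd_const a

theorem pd_eq {m : ℕ} {c : ℝ} {g : Fin n → Eu n → ℝ} (hg : ∀ i, HomB m c (g i)) (i : Fin n) :
    pd i (fun x => ∑ j, x j * g j x) = fun x => g i x + ∑ j, x j * pd i (g j) x := by
  rw [pd_sum_sm (f := fun j x => x j * g j x) fun j _ => Sm.mul (contDiff_coord j) (hg j).sm]
  simp_rw [fun j => pd_mul_sm (contDiff_coord j) (hg j).sm i, pd_coord]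
  funext x
  simp [Finset.sum_add_distrib]

theorem pd {m : ℕ} {c : ℝ} {f : Eu n → ℝ} (h : HomB (m + 1) c f) (i : Fin n) :
    HomB m ((m + 1) * c) (pd i f) := by
  induction m generalizing f with
  | zero =>
    obtain ⟨h0, g, hg, rfl⟩ := h
    rw [pd_eq hg]
    simp only [fun j => (hg j).pd_zero i]
    simpa using hg i
  | succ m ih =>
    obtain ⟨h0, g, hg, rfl⟩ := h
    rw [pd_eq hg]
    have h2 : HomB (m + 1) ((m + 1) * c) fun x => ∑ j, x j * _root_.pd i (g j) x :=
      ⟨by positivity, fun j => _root_.pd i (g j), fun j => ih (hg j), rfl⟩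
    exact ((hg i).add h2).mono (by push_cast; linarith)

theorem euler {m : ℕ} {c : ℝ} {f : Eu n → ℝ} (h : HomB m c f) (x : Eu n) :
    ∑ i, x i * _root_.pd i f x = m * f x := by
  induction m generalizing f with
  | zero => simp [h.pd_zero]
  | succ m ih =>
    obtain ⟨h0, g, hg, rfl⟩ := h
    simp only [pd_eq hg, mul_add, Finset.sum_add_distrib, Finset.mul_sum]
    rw [Finset.sum_comm]
    have : ∀ j, ∑ i, x i * (x j * _root_.pd i (g j) x) = m * (x j * g j x) := fun j => by
      rw [show (m : ℝ) * (x j * g j x) = x j * (m * g j x) by ring, ← ih (hg j), Finset.mul_sum]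
      exact Finset.sum_congr rfl fun i _ => by ring
    simp only [this, ← Finset.mul_sum]
    push_cast; ring

theorem lapl_low {m : ℕ} (hm : m < 2) {c : ℝ} {f : Eu n → ℝ} (h : HomB m c f) :
    lapl f = fun _ => 0 := by
  funext x
  interval_cases m
  · obtain ⟨a, -, rfl⟩ := h; exact lapl_const a x
  · simp only [_root_.lapl, pd2, fun i => (h.pd i).pd_zero]; simp

theorem lapl {m : ℕ} {c : ℝ} {f : Eu n → ℝ} (h : HomB (m + 2) c f) :
    HomB m (n * ((m + 1) * ((m + 2) * c))) (lapl f) := by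
  refine sum_const (f := fun i => pd2 i i f) fun i => ?_
  have := (h.pd i).pd i
  push_cast at this
  rw [show (m : ℝ) + 1 + 1 = m + 2 by ring] at this
  exact this

theorem comp {m : ℕ} {b c : ℝ} {f : Eu n → ℝ} (h : HomB m c f) {T : Eu n → Eu n}
    (hT : ∀ i, HomB 1 b (fun x => T x i)) : HomB m ((n * b) ^ m * c) (fun x => f (T x)) := by
  induction m generalizing f with
  | zero => obtain ⟨a, ha, rfl⟩ := h; simpa using ⟨a, ha, rfl⟩
  | succ m ih =>
    obtain ⟨h0, g, hg, rfl⟩ := h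
    have := sum_const fun i => (hT i).mul (ih (hg i))
    rw [add_comm 1 m] at this
    refine this.mono (le_of_eq ?_)
    ring

/-- Division of a homogeneous polynomial by a linear form. -/
theorem div (m : ℕ) : ∃ K : ℝ, 0 ≤ K ∧ ∀ (ν : Eu n) (c : ℝ) (f : Eu n → ℝ), ‖ν‖ = 1 →
    HomB (m + 1) c f → ∃ f₁, HomB m (K * c) f₁ ∧
      ∀ x, f x = f (x - _root_.lin ν x • ν) + _root_.lin ν x * f₁ x := by
  induction m with
  | zero =>
    refine ⟨n, by positivity, ?_⟩
    rintro ν c f hν ⟨h0, g, hg, rfl⟩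
    refine ⟨fun x => ∑ i, ν i * g i x, sum_const fun i => ?_, fun x => ?_⟩
    · refine ((hg i).const_mul (ν i)).mono ?_
      exact mul_le_of_le_one_left h0 ((PiLp.norm_apply_le ν i).trans hν.le)
    · rw [Finset.mul_sum, ← Finset.sum_add_distrib]
      refine Finset.sum_congr rfl fun i _ => ?_
      obtain ⟨a, -, ha⟩ := hg i
      simp [ha]; ring
  | succ m ih =>
    obtain ⟨K, hK, H⟩ := ih
    refine ⟨n + n * (2 * K), by positivity, ?_⟩
    rintro ν c f hν ⟨h0, g, hg, rfl⟩
    choose g₁ hg₁ e using fun i => H ν c (g i) hν (hg i)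
    refine ⟨fun x => ∑ i, ν i * g i x + ∑ i, (x i - _root_.lin ν x * ν i) * g₁ i x, ?_,
      fun x => ?_⟩
    · rw [add_mul]
      have hνi : ∀ i, |ν i| ≤ 1 := fun i => (PiLp.norm_apply_le ν i).trans hν.le
      refine (sum_const fun i => ?_).add ?_
      · exact ((hg i).const_mul (ν i)).mono (mul_le_of_le_one_left h0 (hνi i))
      · have h1 : ∀ i, HomB 1 2 fun x : Eu n => x i - _root_.lin ν x * ν i := by
          intro i
          have h2 := ((lin (ν := ν) (c := 1) hν.le).const_mul (ν i)).mono
            (show |ν i| * 1 ≤ 1 by simpa using hνi i)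
          have := (coord i).sub h2
          simp only [mul_comm (ν i)] at this
          exact this.mono (by norm_num)
        have := sum_const fun i => (h1 i).mul (hg₁ i)
        rw [add_comm 1 m] at this
        exact this.mono (le_of_eq (by ring))
    · rw [mul_add, Finset.mul_sum, Finset.mul_sum, ← Finset.sum_add_distrib,
        ← Finset.sum_add_distrib]
      refine Finset.sum_congr rfl fun i _ => ?_
      rw [e i x]
      simp; ring

theorem dvd_of_vanish {m : ℕ} : ∃ K : ℝ, 0 ≤ K ∧ ∀ (ν : Eu n) (c : ℝ) (f : Eu n → ℝ), ‖ν‖ = 1 →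
    HomB (m + 1) c f → (∀ x, _root_.lin ν x = 0 → f x = 0) →
    ∃ f₁, HomB m (K * c) f₁ ∧ ∀ x, f x = _root_.lin ν x * f₁ x := by
  obtain ⟨K, hK, H⟩ := div (n := n) m
  refine ⟨K, hK, fun ν c f hν h hz => ?_⟩
  obtain ⟨f₁, h1, e⟩ := H ν c f hν h
  refine ⟨f₁, h1, fun x => ?_⟩
  rw [e x, hz, zero_add]
  rw [lin_sub, lin_smul, lin_self hν]; ring

theorem of_pdMulti {m : ℕ} {c c' : ℝ} {f : Eu n → ℝ} (h : HomB m c f) (hc : 0 ≤ c')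
    (hL : ∀ L : List (Fin n), L.length = m → |pdMulti L f 0| ≤ c') : HomB m c' f := by
  induction m generalizing f c with
  | zero =>
    obtain ⟨a, -, rfl⟩ := h
    exact ⟨a, hL [] rfl, rfl⟩
  | succ m ih =>
    have key : ∀ i, HomB m c' (_root_.pd i f) := fun i => by
      refine ih (h.pd i) fun L hlen => ?_
      have e : ∀ L : List (Fin n), pdMulti L (_root_.pd i f) = pdMulti (L ++ [i]) f := by
        intro L
        induction L with
        | nil => rfl
        | cons j L ih => simp only [pdMulti, List.cons_append, ih]
      rw [e]; exact hL _ (by simp [hlen])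
    refine ⟨hc, fun i x => ((m : ℝ) + 1)⁻¹ * _root_.pd i f x, fun i => ?_, ?_⟩
    · refine ((key i).const_mul _).mono (mul_le_of_le_one_left hc ?_)
      rw [abs_of_pos (by positivity)]
      exact inv_le_one_of_one_le₀ (by linarith [(Nat.cast_nonneg m : (0 : ℝ) ≤ m)])
    · funext x
      have := h.euler x
      push_cast at this
      calc f x = ((m : ℝ) + 1)⁻¹ * (((m : ℝ) + 1) * f x) := by
            rw [inv_mul_cancel_left₀ (by positivity)]
        _ = _ := by rw [← this, Finset.mul_sum]; exact Finset.sum_congr rfl fun i _ => by ring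

theorem pdMulti_of_le {m : ℕ} {c : ℝ} {f : Eu n → ℝ} (h : HomB m c f) {L : List (Fin n)}
    (hL : L.length ≤ m) : ∃ c', HomB (m - L.length) c' (pdMulti L f) := by
  induction L with
  | nil => exact ⟨c, h⟩
  | cons i L ih =>
    simp only [List.length_cons] at hL ⊢
    obtain ⟨c', h'⟩ := ih (by omega)
    have e : m - L.length = m - (L.length + 1) + 1 := by omega
    rw [e] at h'
    exact ⟨_, h'.pd i⟩

theorem pdMulti_eq_zero {m : ℕ} {c : ℝ} {f : Eu n → ℝ} (h : HomB m c f) {L : List (Fin n)}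
    (hL : m < L.length) : pdMulti L f = fun _ => 0 := by
  induction L with
  | nil => simp at hL
  | cons i L ih =>
    simp only [List.length_cons] at hL
    rcases Nat.lt_or_ge m L.length with h1 | h1
    · simp only [pdMulti, ih h1, pd_const]
    · obtain ⟨c', h'⟩ := h.pdMulti_of_le h1
      rw [show m - L.length = 0 by omega] at h'
      exact h'.pd_zero i

theorem apply_zero {m : ℕ} {c : ℝ} {f : Eu n → ℝ} (h : HomB (m + 1) c f) : f 0 = 0 := by
  have := h.smul_apply 0 0
  simpa using this

theorem pdMulti_zero_of_lt {m : ℕ} {c : ℝ} {f : Eu n → ℝ} (h : HomB m c f) {L : List (Fin n)}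
    (hL : L.length < m) : pdMulti L f 0 = 0 := by
  obtain ⟨c', h'⟩ := h.pdMulti_of_le hL.le
  rw [show m - L.length = m - L.length - 1 + 1 by omega] at h'
  exact h'.apply_zero

end HomB

end HomogeneousPolynomials

section HarmonicPolynomials

theorem Sm.pow {f : Eu n → ℝ} (hf : Sm f) (m : ℕ) : Sm fun y => f y ^ m := ContDiff.pow hf m

theorem pd_pow_sm {f : Eu n → ℝ} (hf : Sm f) (m : ℕ) (i : Fin n) :
    pd i (fun y => f y ^ (m + 1)) = fun y => (m + 1) * f y ^ m * pd i f y := by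
  induction m with
  | zero => funext x; simp
  | succ m ih =>
    have : (fun y => f y ^ (m + 1 + 1)) = fun y => f y ^ (m + 1) * f y := by
      funext y; rw [pow_succ]
    rw [this, pd_mul_sm (hf.pow _) hf, ih]
    funext x; push_cast; ring

theorem sm_lin (ν : Eu n) : Sm (lin ν) := contDiff_lin ν

theorem sm_nsq : Sm (nsq : Eu n → ℝ) := contDiff_nsq

theorem sum_sq_eq_one {ν : Eu n} (hν : ‖ν‖ = 1) : ∑ i, ν i * ν i = 1 := by
  have := nsq_eq ν; rw [hν] at this; simpa [nsq] using this

theorem lapl_lin_pow {ν : Eu n} (hν : ‖ν‖ = 1) (a : ℕ) (x : Eu n) :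
    lapl (fun y => lin ν y ^ (a + 2)) x = (a + 2) * (a + 1) * lin ν x ^ a := by
  simp only [lapl, pd2]
  have h : ∀ i, pd i (fun z => pd i (fun y => lin ν y ^ (a + 2)) z) x =
      ((a + 2) * (a + 1) * lin ν x ^ a) * (ν i * ν i) := by
    intro i
    have e : (fun z => pd i (fun y => lin ν y ^ (a + 2)) z) =
        fun y => ((a + 2) * ν i) * lin ν y ^ (a + 1) := by
      funext z
      rw [pd_pow_sm (sm_lin ν) (a + 1), pd_lin]; push_cast; ring
    rw [e, pd_const_mul_sm ((sm_lin ν).pow _), pd_pow_sm (sm_lin ν), pd_lin]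
    ring
  simp only [h, ← Finset.mul_sum, sum_sq_eq_one hν, mul_one]

theorem lapl_nsq_pow (a : ℕ) (x : Eu n) :
    lapl (fun y => nsq y ^ (a + 1)) x = 2 * (a + 1) * (n + 2 * a) * nsq x ^ a := by
  have e : ∀ i, pd i (fun y : Eu n => nsq y ^ (a + 1)) =
      fun y => (2 * (a + 1)) * (nsq y ^ a * y i) := by
    intro i; rw [pd_pow_sm sm_nsq, pd_nsq]; funext z; ring
  have h : ∀ i, pd2 i i (fun y => nsq y ^ (a + 1)) x =
      2 * (a + 1) * (pd i (fun y => nsq y ^ a) x * x i + nsq x ^ a) := by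
    intro i
    unfold pd2
    rw [show (fun z => pd i (fun y : Eu n => nsq y ^ (a + 1)) z) =
      fun y => (2 * (a + 1)) * (nsq y ^ a * y i) from e i,
      pd_const_mul_sm (Sm.mul (sm_nsq.pow a) (contDiff_coord i)),
      pd_mul_sm (sm_nsq.pow a) (contDiff_coord i)]
    simp [pd_coord]
  simp only [lapl, h, ← Finset.mul_sum, Finset.sum_add_distrib]
  have h2 := (HomB.nsq (n := n)).pow a
  have h3 := h2.euler x
  simp only [mul_comm (x _)] at h3
  rw [h3]
  simp; ring

theorem HomB.dirDeriv {d : ℕ} {c : ℝ} {f : Eu n → ℝ} {ν : Eu n} (hν : ‖ν‖ = 1)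
    (h : HomB (d + 1) c f) : HomB d (n * ((d + 1) * c)) (fun x => ∑ i, ν i * _root_.pd i f x) := by
  refine sum_const fun i => ((h.pd i).const_mul (ν i)).mono ?_
  exact mul_le_of_le_one_left (h.pd i).nonneg ((PiLp.norm_apply_le ν i).trans hν.le)

/-- Solvability of `Δ(tR) = t^a f` in polynomials, where `t = ⟪·, ν⟫`. -/
theorem exists_lapl_lin_mul (d : ℕ) : ∀ a : ℕ, ∃ K : ℝ, 0 ≤ K ∧
    ∀ (ν : Eu n) (c : ℝ) (f : Eu n → ℝ), ‖ν‖ = 1 → HomB d c f →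
    ∃ R, HomB (a + d + 1) (K * c) R ∧
      ∀ x, lapl (fun y => lin ν y * R y) x = lin ν x ^ a * f x := by
  induction d using Nat.strong_induction_on with
  | _ d ih =>
  intro a
  have h1 : ∃ K : ℝ, 0 ≤ K ∧ ∀ (ν : Eu n) (c : ℝ) (f : Eu n → ℝ), ‖ν‖ = 1 → HomB d c f →
      ∃ R, HomB (a + d + 1) (K * c) R ∧ ∀ x, lapl (fun y => lin ν y * R y) x =
        lin ν x ^ (a + 1) * ∑ i, ν i * pd i f x := by
    rcases d with _ | d
    · refine ⟨0, le_rfl, fun ν c f hν hf => ⟨fun _ => 0, by simpa using HomB.zero _, fun x => ?_⟩⟩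
      simp [hf.pd_zero, lapl_const]
    · obtain ⟨K, hK, H⟩ := ih d (by omega) (a + 1)
      refine ⟨K * (n * (d + 1)), by positivity, fun ν c f hν hf => ?_⟩
      obtain ⟨R, hR, e⟩ := H ν _ _ hν (hf.dirDeriv hν)
      refine ⟨R, ?_, e⟩
      rw [show a + 1 + d + 1 = a + (d + 1) + 1 by omega] at hR
      exact hR.mono (le_of_eq (by ring))
  have h2 : ∃ K : ℝ, 0 ≤ K ∧ ∀ (ν : Eu n) (c : ℝ) (f : Eu n → ℝ), ‖ν‖ = 1 → HomB d c f →
      ∃ R, HomB (a + d + 1) (K * c) R ∧ ∀ x, lapl (fun y => lin ν y * R y) x =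
        lin ν x ^ (a + 2) * lapl f x := by
    rcases Nat.lt_or_ge d 2 with hd | hd
    · refine ⟨0, le_rfl, fun ν c f hν hf => ⟨fun _ => 0, by simpa using HomB.zero _, fun x => ?_⟩⟩
      simp [hf.lapl_low hd, lapl_const]
    · obtain ⟨d, rfl⟩ := Nat.exists_eq_add_of_le' hd
      obtain ⟨K, hK, H⟩ := ih d (by omega) (a + 2)
      refine ⟨K * (n * ((d + 1) * (d + 2))), by positivity, fun ν c f hν hf => ?_⟩
      obtain ⟨R, hR, e⟩ := H ν _ _ hν hf.lapl
      refine ⟨R, ?_, e⟩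
      rw [show a + 2 + d + 1 = a + (d + 2) + 1 by omega] at hR
      exact hR.mono (le_of_eq (by ring))
  obtain ⟨K₁, hK₁, H₁⟩ := h1
  obtain ⟨K₂, hK₂, H₂⟩ := h2
  set B : ℝ := (((a : ℝ) + 2) * (a + 1))⁻¹ with hB
  have hB0 : 0 ≤ B := by positivity
  have hBe : B * (((a : ℝ) + 2) * (a + 1)) = 1 := inv_mul_cancel₀ (by positivity)
  refine ⟨B * (1 + 2 * (a + 2) * K₁ + K₂), by positivity, fun ν c f hν hf => ?_⟩
  obtain ⟨R₁, hR₁, e₁⟩ := H₁ ν c f hν hf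
  obtain ⟨R₂, hR₂, e₂⟩ := H₂ ν c f hν hf
  refine ⟨fun x => B * (lin ν x ^ (a + 1) * f x - 2 * (a + 2) * R₁ x - R₂ x), ?_, fun x => ?_⟩
  · have hp := ((HomB.lin (ν := ν) (c := 1) hν.le).pow (a + 1)).mul hf
    rw [show (a + 1) * 1 + d = a + d + 1 by omega] at hp
    refine (((hp.sub (hR₁.const_mul (2 * (a + 2)))).sub hR₂).const_mul B).mono (le_of_eq ?_)
    rw [abs_of_nonneg hB0, abs_of_nonneg (show (0 : ℝ) ≤ 2 * (a + 2) by positivity)]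
    ring
  · have sl := sm_lin ν
    have s1 : Sm fun y => lin ν y ^ (a + 2) * f y := Sm.mul (sl.pow _) hf.sm
    have s2 : Sm fun y => lin ν y * R₁ y := Sm.mul sl hR₁.sm
    have s3 : Sm fun y => lin ν y * R₂ y := Sm.mul sl hR₂.sm
    have e0 : (fun y => lin ν y * (B * (lin ν y ^ (a + 1) * f y - 2 * (a + 2) * R₁ y - R₂ y))) =
        fun y => B * (lin ν y ^ (a + 2) * f y - (2 * (a + 2)) * (lin ν y * R₁ y) -
          lin ν y * R₂ y) := by
      funext y; ring
    rw [e0, lapl_const_mul (Sm.sub (Sm.sub s1 (s2.const_mul _)) s3),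
      lapl_sub (Sm.sub s1 (s2.const_mul _)) s3, lapl_sub s1 (s2.const_mul _),
      lapl_const_mul s2, e₁, e₂, lapl_mul (sl.pow _) hf.sm, lapl_lin_pow hν]
    have e3 : ∑ i, pd i (fun y => lin ν y ^ (a + 2)) x * pd i f x =
        (a + 2) * lin ν x ^ (a + 1) * ∑ i, ν i * pd i f x := by
      rw [Finset.mul_sum]
      refine Finset.sum_congr rfl fun i _ => ?_
      rw [pd_pow_sm sl (a + 1), pd_lin]; push_cast; ring
    rw [e3]
    linear_combination (lin ν x ^ a * f x) * hBe

/-- Every homogeneous polynomial agrees on a hyperplane with a harmonic one. -/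
theorem exists_harm_add_lin_mul (m : ℕ) : ∃ K : ℝ, 0 ≤ K ∧
    ∀ (ν : Eu n) (c : ℝ) (q : Eu n → ℝ), ‖ν‖ = 1 → HomB (m + 1) c q →
    ∃ q₁, HomB m (K * c) q₁ ∧ HomB (m + 1) ((1 + K) * c) (fun x => q x + lin ν x * q₁ x) ∧
      ∀ x, lapl (fun y => q y + lin ν y * q₁ y) x = 0 := by
  rcases m with _ | m
  · refine ⟨0, le_rfl, fun ν c q hν hq => ⟨fun _ => 0, by simpa using HomB.zero _, ?_, ?_⟩⟩
    · simpa using hq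
    · simp [hq.lapl_low (by norm_num)]
  · obtain ⟨K, hK, H⟩ := exists_lapl_lin_mul (n := n) m 0
    refine ⟨K * (n * ((m + 1) * (m + 2))), by positivity, fun ν c q hν hq => ?_⟩
    obtain ⟨R, hR, e⟩ := H ν _ _ hν hq.lapl
    rw [zero_add] at hR
    have hR' : HomB (m + 1) (K * (n * ((m + 1) * (m + 2))) * c) fun x => - R x :=
      hR.neg.mono (le_of_eq (by ring))
    refine ⟨fun x => - R x, hR', ?_, fun x => ?_⟩
    · have := (HomB.lin (ν := ν) (c := 1) hν.le).mul hR'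
      rw [add_comm 1 (m + 1)] at this
      exact (hq.add this).mono (le_of_eq (by ring))
    · have : (fun y => q y + lin ν y * -R y) = fun y => q y - lin ν y * R y := by
        funext y; ring
      rw [this, lapl_sub hq.sm (Sm.mul (sm_lin ν) hR.sm), e]; simp

/-- Solvability of `Δ(|x|²R) = |x|^{2a} f` in polynomials. -/
theorem exists_lapl_nsq_mul (hn : 0 < n) (d : ℕ) : ∀ (a : ℕ) (c : ℝ) (f : Eu n → ℝ), HomB d c f →
    ∃ (K : ℝ) (R : Eu n → ℝ), HomB (2 * a + d) K R ∧
      ∀ x, lapl (fun y => nsq y * R y) x = nsq x ^ a * f x := by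
  induction d using Nat.strong_induction_on with
  | _ d ih =>
  intro a c f hf
  have h2 : ∃ (K : ℝ) (R : Eu n → ℝ), HomB (2 * a + d) K R ∧
      ∀ x, lapl (fun y => nsq y * R y) x = nsq x ^ (a + 1) * lapl f x := by
    rcases Nat.lt_or_ge d 2 with hd | hd
    · refine ⟨0, fun _ => 0, HomB.zero _, fun x => ?_⟩
      simp [hf.lapl_low hd, lapl_const]
    · obtain ⟨d, rfl⟩ := Nat.exists_eq_add_of_le' hd
      obtain ⟨K, R, hR, e⟩ := ih d (by omega) (a + 1) _ _ hf.lapl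
      refine ⟨K, R, ?_, e⟩
      rwa [show 2 * (a + 1) + d = 2 * a + (d + 2) by omega] at hR
  obtain ⟨K, R₂, hR₂, e₂⟩ := h2
  have hn' : (0 : ℝ) < n := by exact_mod_cast hn
  set A : ℝ := 2 * (a + 1) * (n + 2 * a + 2 * d) with hA
  have hA0 : 0 < A := by positivity
  have hp := (HomB.nsq (n := n)).pow a |>.mul hf
  rw [show a * 2 + d = 2 * a + d by omega] at hp
  refine ⟨_, fun x => A⁻¹ * (nsq x ^ a * f x - R₂ x), (hp.sub hR₂).const_mul _, fun x => ?_⟩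
  have s1 : Sm fun y => nsq y ^ (a + 1) * f y := Sm.mul (sm_nsq.pow _) hf.sm
  have s3 : Sm fun y => nsq y * R₂ y := Sm.mul sm_nsq hR₂.sm
  have e0 : (fun y => nsq y * (A⁻¹ * (nsq y ^ a * f y - R₂ y))) =
      fun y => A⁻¹ * (nsq y ^ (a + 1) * f y - nsq y * R₂ y) := by
    funext y; ring
  rw [e0, lapl_const_mul (Sm.sub s1 s3), lapl_sub s1 s3, e₂, lapl_mul (sm_nsq.pow _) hf.sm,
    lapl_nsq_pow]
  have e3 : ∑ i, pd i (fun y => nsq y ^ (a + 1)) x * pd i f x =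
      2 * (a + 1) * nsq x ^ a * (d * f x) := by
    rw [← hf.euler x, Finset.mul_sum]
    refine Finset.sum_congr rfl fun i _ => ?_
    rw [pd_pow_sm sm_nsq, pd_nsq]; ring
  rw [e3]
  have hBe : A⁻¹ * A = 1 := inv_mul_cancel₀ hA0.ne'
  rw [hA] at hBe
  linear_combination (nsq x ^ a * f x) * hBe

/-- Polynomial functions, given by their homogeneous components. -/
def IsPolyFn (h : Eu n → ℝ) : Prop :=
  ∃ (N : ℕ) (p : ℕ → Eu n → ℝ), (∀ m, ∃ c, HomB m c (p m)) ∧ (∀ m, N ≤ m → p m = fun _ => 0) ∧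
    ∀ x, h x = ∑ m ∈ Finset.range N, p m x

theorem sum_range_extend {p : ℕ → Eu n → ℝ} {N M : ℕ} (hp : ∀ m, N ≤ m → p m = fun _ => 0)
    (hNM : N ≤ M) (x : Eu n) :
    ∑ m ∈ Finset.range N, p m x = ∑ m ∈ Finset.range M, p m x := by
  refine Finset.sum_subset (by simpa using hNM) fun m _ hm => ?_
  rw [hp m (by simpa using hm)]

theorem IsPolyFn.add {f g : Eu n → ℝ} (hf : IsPolyFn f) (hg : IsPolyFn g) :
    IsPolyFn fun x => f x + g x := by
  obtain ⟨N, p, hp, h0, e⟩ := hf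
  obtain ⟨M, q, hq, h0', e'⟩ := hg
  refine ⟨max N M, fun m x => p m x + q m x, fun m => ?_, fun m hm => ?_, fun x => ?_⟩
  · obtain ⟨c, hc⟩ := hp m
    obtain ⟨c', hc'⟩ := hq m
    exact ⟨_, hc.add hc'⟩
  · simp only [h0 m (le_trans (le_max_left _ _) hm), h0' m (le_trans (le_max_right _ _) hm), add_zero]
  · dsimp only
    rw [e, e', Finset.sum_add_distrib, sum_range_extend h0 (le_max_left N M),
      sum_range_extend h0' (le_max_right N M)]

theorem IsPolyFn.const_mul {f : Eu n → ℝ} (hf : IsPolyFn f) (a : ℝ) : IsPolyFn fun x => a * f x := by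
  obtain ⟨N, p, hp, h0, e⟩ := hf
  refine ⟨N, fun m x => a * p m x, fun m => ?_, fun m hm => ?_, fun x => ?_⟩
  · obtain ⟨c, hc⟩ := hp m
    exact ⟨_, hc.const_mul a⟩
  · simp only [h0 m hm, mul_zero]
  · dsimp only
    rw [e, Finset.mul_sum]

theorem HomB.isPolyFn {m : ℕ} {c : ℝ} {f : Eu n → ℝ} (hf : HomB m c f) : IsPolyFn f := by
  classical
  refine ⟨m + 1, fun j => if j = m then f else fun _ => 0, fun j => ?_, fun j hj => ?_,
    fun x => ?_⟩
  · by_cases h : j = m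
    · subst h; exact ⟨c, by simpa using hf⟩
    · exact ⟨0, by simpa [h] using HomB.zero j⟩
  · dsimp only
    rw [if_neg (by omega)]
  · rw [Finset.sum_eq_single m (fun j _ hj => by simp [hj]) (by simp)]; simp

theorem IsPolyFn.sm {f : Eu n → ℝ} (hf : IsPolyFn f) : Sm f := by
  obtain ⟨N, p, hp, -, e⟩ := hf
  have : f = fun x => ∑ m ∈ Finset.range N, p m x := funext e
  rw [this]
  exact Sm.sum fun m _ => (hp m).choose_spec.sm

/-- Polynomials agree on spheres with harmonic polynomials. -/
theorem exists_harm_eq_on_sphere (hn : 0 < n) {R₀ : ℝ} (m : ℕ) :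
    ∀ {c : ℝ} {p : Eu n → ℝ}, HomB m c p →
    ∃ h, IsPolyFn h ∧ (∀ x, lapl h x = 0) ∧ ∀ x, ‖x‖ = R₀ → h x = p x := by
  induction m using Nat.strong_induction_on with
  | _ m ih =>
  intro c p hp
  rcases Nat.lt_or_ge m 2 with hd | hd
  · exact ⟨p, hp.isPolyFn, fun x => by rw [hp.lapl_low hd], fun _ _ => rfl⟩
  · obtain ⟨d, rfl⟩ := Nat.exists_eq_add_of_le' hd
    obtain ⟨K, R, hR, e⟩ := exists_lapl_nsq_mul hn d 0 _ _ hp.lapl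
    rw [show 2 * 0 + d = d by omega] at hR
    obtain ⟨h', h1, h2, h3⟩ := ih d (by omega) hR
    have hq := HomB.nsq.mul hR
    rw [add_comm 2 d] at hq
    have hpq := hp.sub hq
    refine ⟨fun x => (p x - nsq x * R x) + R₀ ^ 2 * h' x, hpq.isPolyFn.add (h1.const_mul _),
      fun x => ?_, fun x hx => ?_⟩
    · rw [lapl_add hpq.sm (h1.sm.const_mul _), lapl_const_mul h1.sm, h2, lapl_sub hp.sm hq.sm, e]
      simp
    · dsimp only
      rw [h3 x hx, nsq_eq, hx]; ring

theorem HomB.prod {ι : Type*} {s : Finset ι} {m : ι → ℕ} {f : ι → Eu n → ℝ}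
    (h : ∀ j ∈ s, HomB (m j) 1 (f j)) : HomB (∑ j ∈ s, m j) 1 (fun x => ∏ j ∈ s, f j x) := by
  classical
  induction s using Finset.induction_on with
  | empty => simpa using HomB.one
  | insert a s ha ih =>
    simp only [Finset.prod_insert ha, Finset.sum_insert ha]
    simpa using (h a (by simp)).mul (ih fun j hj => h j (by simp [hj]))

/-- Continuous functions on a sphere are uniform limits of harmonic polynomials. -/
theorem exists_harm_near_on_sphere (hn : 0 < n) {R₀ : ℝ} {φ : Eu n → ℝ}
    (hφ : ContinuousOn φ (sphere 0 R₀)) {η : ℝ} (hη : 0 < η) :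
    ∃ h, IsPolyFn h ∧ (∀ x, lapl h x = 0) ∧ ∀ x ∈ sphere (0 : Eu n) R₀, |φ x - h x| ≤ η := by
  set K := sphere (0 : Eu n) R₀
  have : CompactSpace K := isCompact_iff_compactSpace.1 (isCompact_sphere 0 R₀)
  let X : Fin n → C(K, ℝ) := fun i =>
    ⟨fun x => (x : Eu n) i, ((contDiff_coord (m := 0) i).continuous).comp continuous_subtype_val⟩
  let A : Subalgebra ℝ C(K, ℝ) := (MvPolynomial.aeval (R := ℝ) X).range
  have hsep : A.SeparatesPoints := by
    intro x y hxy
    have : ∃ i, (x : Eu n) i ≠ (y : Eu n) i := by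
      by_contra! hc
      exact hxy (Subtype.ext (PiLp.ext hc))
    obtain ⟨i, hi⟩ := this
    exact ⟨X i, ⟨X i, ⟨MvPolynomial.X i, by simp⟩, rfl⟩, hi⟩
  obtain ⟨⟨g, p, hp⟩, hg⟩ := ContinuousMap.exists_mem_subalgebra_near_continuous_of_separatesPoints
    A hsep (fun x : K => φ x) (continuousOn_iff_continuous_domRestrict.1 hφ) η hη
  have key : ∀ p : MvPolynomial (Fin n) ℝ, ∃ h, IsPolyFn h ∧ (∀ x, lapl h x = 0) ∧
      ∀ x : K, h (x : Eu n) = (MvPolynomial.aeval (R := ℝ) X p) x := by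
    intro p
    induction p using MvPolynomial.induction_on' with
    | monomial u a =>
      have h1 : HomB (∑ i, u i * 1) 1 (fun x : Eu n => ∏ i, x i ^ u i) :=
        HomB.prod fun i _ => by simpa using (HomB.coord i).pow (u i)
      obtain ⟨h, hh1, hh2, hh3⟩ := exists_harm_eq_on_sphere hn (R₀ := R₀) _ (h1.const_mul a)
      refine ⟨h, hh1, hh2, fun x => ?_⟩
      rw [hh3 x (by simpa [K] using x.2), MvPolynomial.aeval_monomial,
        Finsupp.prod_fintype _ _ (by simp)]
      simp [X, ContinuousMap.coe_prod]
    | add p q ihp ihq =>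
      obtain ⟨h, h1, h2, h3⟩ := ihp
      obtain ⟨h', h1', h2', h3'⟩ := ihq
      refine ⟨fun x => h x + h' x, h1.add h1', fun x => ?_, fun x => ?_⟩
      · rw [lapl_add h1.sm h1'.sm, h2, h2', add_zero]
      · dsimp only
        rw [h3, h3', map_add]; rfl
  obtain ⟨h, h1, h2, h3⟩ := key p
  refine ⟨h, h1, h2, fun x hx => ?_⟩
  have e := hg ⟨x, hx⟩
  have e2 : (⟨x, hx⟩ : K).1 = x := rfl
  rw [abs_sub_comm]
  rw [show h x = g ⟨x, hx⟩ by rw [← hp]; exact h3 ⟨x, hx⟩]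
  simpa using e.le

theorem coeff_eq_zero {N : ℕ} {a : ℕ → ℝ} (h : ∀ s : ℝ, ∑ m ∈ Finset.range N, s ^ m * a m = 0) :
    ∀ m < N, a m = 0 := by
  intro m hm
  have hz : (∑ m ∈ Finset.range N, Polynomial.monomial m (a m) : Polynomial ℝ) = 0 := by
    refine Polynomial.funext fun s => ?_
    rw [Polynomial.eval_finsetSum]
    simpa [mul_comm] using h s
  have := congrArg (fun q : Polynomial ℝ => q.coeff m) hz
  simpa [Polynomial.finsetSum_coeff, Polynomial.coeff_monomial, hm] using this

theorem lapl_component {N : ℕ} {p : ℕ → Eu n → ℝ} (hp : ∀ m, ∃ c, HomB m c (p m))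
    (h : ∀ x, lapl (fun y => ∑ m ∈ Finset.range N, p m y) x = 0) :
    ∀ m < N, ∀ x, lapl (p m) x = 0 := by
  intro m hm x
  refine coeff_eq_zero (a := fun m => lapl (p m) x) (N := N) (fun s => ?_) m hm
  have h1 : ∀ m, s ^ 2 * lapl (p m) (s • x) = s ^ m * lapl (p m) x := by
    intro m
    obtain ⟨c, hc⟩ := hp m
    rcases Nat.lt_or_ge m 2 with hd | hd
    · simp [hc.lapl_low hd]
    · obtain ⟨d, rfl⟩ := Nat.exists_eq_add_of_le' hd
      rw [hc.lapl.smul_apply]; ring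
  have h2 := h (s • x)
  rw [lapl_sum fun m _ => (hp m).choose_spec.sm] at h2
  simp only [← h1, ← Finset.mul_sum, h2, mul_zero]

theorem component_odd {ν : Eu n} {N : ℕ} {p : ℕ → Eu n → ℝ}
    (hp : ∀ m, ∃ c, HomB m c (p m))
    (h : ∀ x, ∑ m ∈ Finset.range N, p m (hrefl ν x) = - ∑ m ∈ Finset.range N, p m x) :
    ∀ m < N, ∀ x, p m (hrefl ν x) = - p m x := by
  intro m hm x
  have := coeff_eq_zero (a := fun m => p m (hrefl ν x) + p m x) (N := N) (fun s => ?_) m hm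
  · linarith
  have h1 := h (s • x)
  have h2 : ∀ m y, p m (s • y) = s ^ m * p m y := fun m y => (hp m).choose_spec.smul_apply s y
  simp only [map_smul, h2] at h1
  simp only [mul_add, Finset.sum_add_distrib]
  linarith

theorem HomB.comp_hrefl {ν : Eu n} (hν : ‖ν‖ = 1) {m : ℕ} {c : ℝ} {f : Eu n → ℝ}
    (h : HomB m c f) : HomB m ((n * 3) ^ m * c) (fun x => f (hrefl ν x)) := by
  refine h.comp fun i => ?_
  have h2 := ((HomB.lin (ν := ν) (c := 1) hν.le).const_mul (2 * ν i)).mono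
    (show |2 * ν i| * 1 ≤ 2 by
      have : |ν i| ≤ 1 := (PiLp.norm_apply_le ν i).trans hν.le
      rw [abs_mul, abs_two]; linarith)
  have h3 := ((HomB.coord i).sub h2).mono (show (1 : ℝ) + 2 ≤ 3 by norm_num)
  have : (fun x : Eu n => hrefl ν x i) = fun x => x i - 2 * ν i * _root_.lin ν x := by
    funext x; rw [hrefl_apply hν]; simp; ring
  rw [this]; exact h3

theorem IsPolyFn.comp_hrefl {ν : Eu n} (hν : ‖ν‖ = 1) {f : Eu n → ℝ} (h : IsPolyFn f) :
    IsPolyFn fun x => f (hrefl ν x) := by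
  obtain ⟨N, p, hp, h0, e⟩ := h
  refine ⟨N, fun m x => p m (hrefl ν x), fun m => ?_, fun m hm => by simp [h0 m hm], fun x => e _⟩
  obtain ⟨c, hc⟩ := hp m
  exact ⟨_, hc.comp_hrefl hν⟩

end HarmonicPolynomials

section InteriorRegularity

/-- An entire smooth harmonic function. -/
def EntHarm (h : Eu n → ℝ) : Prop := Sm h ∧ ∀ x, lapl h x = 0

theorem EntHarm.harmAt {h : Eu n → ℝ} (H : EntHarm h) (x : Eu n) : HarmAt h x := H.1.harmAt H.2 x

theorem EntHarm.pd {h : Eu n → ℝ} (H : EntHarm h) (i : Fin n) : EntHarm (pd i h) := by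
  refine ⟨H.1.pd i, fun x => ?_⟩
  have c : ∀ {f : Eu n → ℝ}, Sm f → ∀ j k, _root_.pd j (_root_.pd k f) = _root_.pd k (_root_.pd j f) :=
    fun hf j k => funext fun x => pd2_comm (hf.two x) j k
  have e : ∀ j, pd2 j j (_root_.pd i h) = _root_.pd i (pd2 j j h) := fun j => by
    change _root_.pd j (_root_.pd j (_root_.pd i h)) = _root_.pd i (_root_.pd j (_root_.pd j h))
    rw [c H.1 j i, c (H.1.pd j) j i]
  simp only [lapl, e]
  rw [← pd_sum fun j _ => (Sm.diff ((H.1.pd j).pd j) : Differentiable ℝ (pd2 j j h)) x]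
  have : (fun y => ∑ j, pd2 j j h y) = fun _ => 0 := funext H.2
  rw [this, pd_const]

theorem EntHarm.pdMulti {h : Eu n → ℝ} (H : EntHarm h) (L : List (Fin n)) :
    EntHarm (pdMulti L h) := by
  induction L with
  | nil => exact H
  | cons i L ih => exact ih.pd i

theorem EntHarm.sub {h g : Eu n → ℝ} (H : EntHarm h) (G : EntHarm g) :
    EntHarm fun x => h x - g x :=
  ⟨H.1.sub G.1, fun x => by rw [lapl_sub H.1 G.1, H.2, G.2, sub_zero]⟩

theorem EntHarm.add {h g : Eu n → ℝ} (H : EntHarm h) (G : EntHarm g) :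
    EntHarm fun x => h x + g x :=
  ⟨H.1.add G.1, fun x => by rw [lapl_add H.1 G.1, H.2, G.2, add_zero]⟩

theorem EntHarm.const_mul {h : Eu n → ℝ} (H : EntHarm h) (c : ℝ) :
    EntHarm fun x => c * h x :=
  ⟨H.1.const_mul c, fun x => by rw [lapl_const_mul H.1, H.2, mul_zero]⟩

theorem entHarm_zero : EntHarm (fun _ : Eu n => (0 : ℝ)) := ⟨sm_const 0, lapl_const 0⟩

theorem EntHarm.comp_affine {h : Eu n → ℝ} (H : EntHarm h) (a : Eu n) (r : ℝ) :
    EntHarm fun x => h (a + r • x) :=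
  ⟨H.1.comp (show ContDiff ℝ (⊤ : ℕ∞) (fun x : Eu n => a + r • x) by fun_prop), fun x =>
    ((H.harmAt _).comp_affine (a := a) (r := r)).2⟩

theorem closure_ball_sub_sphere {r : ℝ} (hr : r ≠ 0) (x : Eu n)
    (hx : x ∈ frontier (ball (0 : Eu n) r)) : x ∈ sphere (0 : Eu n) r := by
  rwa [frontier_ball _ hr] at hx

/-- Harmonic functions are locally uniform limits of entire harmonic functions. -/
theorem exists_entHarm_near (hn : 0 < n) {u : Eu n → ℝ} {a : Eu n} {r η : ℝ} (hr : 0 < r)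
    (hη : 0 < η) (hu : ∀ x ∈ closedBall a r, HarmAt u x) :
    ∃ h, EntHarm h ∧ ∀ x ∈ ball a r, |u x - h x| ≤ η := by
  set v : Eu n → ℝ := fun x => u (a + (1 : ℝ) • x)
  have hv : ∀ x ∈ closedBall (0 : Eu n) r, HarmAt v x := fun x hx =>
    (hu _ (by simpa [dist_eq_norm] using hx)).comp_affine
  have hvc : ContinuousOn v (closedBall 0 r) := fun x hx =>
    (hv x hx).continuousAt.continuousWithinAt
  obtain ⟨h, h1, h2, h3⟩ := exists_harm_near_on_sphere hn (hvc.mono sphere_subset_closedBall) hη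
  have H : EntHarm h := ⟨h1.sm, h2⟩
  refine ⟨fun x => h (-a + (1 : ℝ) • x), H.comp_affine _ _, fun x hx => ?_⟩
  have := abs_max_principle hn (O := ball (0 : Eu n) r) isOpen_ball isBounded_ball
    (u := fun x => v x - h x) (M := η) ?_ (fun y hy => (hv y (ball_subset_closedBall hy)).sub
      (H.harmAt y)) (fun y hy => h3 y (closure_ball_sub_sphere hr.ne' y hy)) (-a + (1 : ℝ) • x) ?_
  · simpa [v] using this
  · rw [closure_ball _ hr.ne']
    exact hvc.sub H.1.continuous.continuousOn
  · simpa [dist_eq_norm, neg_add_eq_sub] using hx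

theorem pd_apply_eq (i : Fin n) (u : Eu n → ℝ) (x : Eu n) :
    pd i u x = fderiv ℝ u x (EuclideanSpace.single i 1) := rfl

/-- Derivatives of uniformly convergent sequences of harmonic functions converge. -/
theorem tendsto_pd_of_entHarm (hn : 0 < n) {h : ℕ → Eu n → ℝ} (H : ∀ j, EntHarm (h j))
    {f : Eu n → ℝ} {a : Eu n} {r r' : ℝ} (hr : r' < r)
    (hlim : TendstoUniformlyOn h f Filter.atTop (ball a r)) :
    (∀ x ∈ ball a r', DifferentiableAt ℝ f x) ∧
      ∀ i, TendstoUniformlyOn (fun j => pd i (h j)) (pd i f) Filter.atTop (ball a r') := by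
  set s := (r - r') / 2 with hs
  have hs0 : 0 < s := by rw [hs]; linarith
  have hn' : (0 : ℝ) < n := by exact_mod_cast hn
  have hcau : UniformCauchySeqOn (fun j => fderiv ℝ (h j)) Filter.atTop (ball a r') := by
    rw [Metric.uniformCauchySeqOn_iff]
    intro ε hε
    set η := ε / (2 * (n * (n / s))) with hη
    have hη0 : 0 < η := by positivity
    obtain ⟨N, hN⟩ := (Metric.uniformCauchySeqOn_iff.1 hlim.uniformCauchySeqOn) η hη0
    refine ⟨N, fun j hj k hk x hx => ?_⟩
    have hG := (H j).sub (H k)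
    have hb : ∀ i, |pd i (fun y => h j y - h k y) x| ≤ n / s * η := fun i =>
      abs_pd_le_of_harm hn hs0 (fun y _ => hG.harmAt y) (fun y hy => by
        have : y ∈ ball a r := by
          rw [mem_ball] at hx ⊢
          rw [mem_closedBall] at hy
          have := dist_triangle y x a
          linarith
        have := (hN j hj k hk y this).le
        rwa [Real.dist_eq] at this) i
    have := norm_fderiv_le_sum_pd _ x hb (by positivity)
    rw [fderiv_fun_sub ((H j).1.diff x) ((H k).1.diff x)] at this
    rw [dist_eq_norm]
    refine this.trans_lt ?_
    have e : n * (n / s * η) = ε / 2 := by rw [hη]; field_simp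
    rw [e]; linarith
  have hpt : ∀ x ∈ ball a r', ∃ g, Filter.Tendsto (fun j => fderiv ℝ (h j) x) Filter.atTop
      (nhds g) := fun x hx => cauchySeq_tendsto_of_complete (hcau.cauchySeq hx)
  classical
  set g' : Eu n → (Eu n →L[ℝ] ℝ) := fun x =>
    if hx : x ∈ ball a r' then (hpt x hx).choose else 0 with hg'
  have hg : TendstoUniformlyOn (fun j => fderiv ℝ (h j)) g' Filter.atTop (ball a r') := by
    refine hcau.tendstoUniformlyOn_of_tendsto fun x hx => ?_
    simp only [hg', hx, dif_pos]
    exact (hpt x hx).choose_spec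
  have hd : ∀ x ∈ ball a r', HasFDerivAt f (g' x) x := fun x hx =>
    hasFDerivAt_of_tendstoUniformlyOn isOpen_ball hg
      (fun j y _ => ((H j).1.diff y).hasFDerivAt)
      (fun y hy => hlim.tendsto_at (ball_subset_ball hr.le hy)) hx
  refine ⟨fun x hx => (hd x hx).differentiableAt, fun i => ?_⟩
  rw [Metric.tendstoUniformlyOn_iff] at hg ⊢
  intro ε hε
  filter_upwards [hg ε hε] with j hj x hx
  rw [pd_apply_eq, pd_apply_eq, (hd x hx).fderiv, dist_eq_norm, ← sub_apply]
  have h1 := hj x hx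
  rw [dist_eq_norm] at h1
  refine lt_of_le_of_lt ?_ h1
  simpa using (g' x - fderiv ℝ (h j) x).le_opNorm (EuclideanSpace.single i (1 : ℝ))

theorem tendsto_pdMulti_of_entHarm (hn : 0 < n) {h : ℕ → Eu n → ℝ} (H : ∀ j, EntHarm (h j))
    {f : Eu n → ℝ} {a : Eu n} {r : ℝ}
    (hlim : TendstoUniformlyOn h f Filter.atTop (ball a r)) (L : List (Fin n)) :
    ∀ r' < r, TendstoUniformlyOn (fun j => pdMulti L (h j)) (pdMulti L f) Filter.atTop
      (ball a r') := by
  induction L with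
  | nil => exact fun r' hr => hlim.mono (ball_subset_ball hr.le)
  | cons i L ih =>
    intro r' hr
    obtain ⟨s, hs1, hs2⟩ := exists_between hr
    exact (tendsto_pd_of_entHarm hn (fun j => (H j).pdMulti L) hs1 (ih s hs2)).2 i

theorem contDiffOn_of_entHarm_tendsto (hn : 0 < n) (k : ℕ) : ∀ {h : ℕ → Eu n → ℝ},
    (∀ j, EntHarm (h j)) → ∀ {f : Eu n → ℝ} {a : Eu n} {r r' : ℝ}, r' < r →
    TendstoUniformlyOn h f Filter.atTop (ball a r) → ContDiffOn ℝ k f (ball a r') := by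
  induction k with
  | zero =>
    intro h H f a r r' hr hlim
    exact contDiffOn_zero.2 ((hlim.mono (ball_subset_ball hr.le)).continuousOn
      (Filter.Eventually.frequently (Filter.Eventually.of_forall fun j =>
        (H j).1.continuous.continuousOn)))
  | succ k ih =>
    intro h H f a r r' hr hlim
    obtain ⟨s, hs1, hs2⟩ := exists_between hr
    obtain ⟨h1, h2⟩ := tendsto_pd_of_entHarm hn H hs2 hlim
    have := (contDiffOn_succ_iff_fderiv_of_isOpen (𝕜 := ℝ) (n := k) (f := f)
      (isOpen_ball (x := a) (ε := r'))).2 ⟨fun x hx =>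
        (h1 x (ball_subset_ball hs1.le hx)).differentiableWithinAt, by simp, ?_⟩
    · exact_mod_cast this
    · have e : fderiv ℝ f = fun x => ∑ i, pd i f x • (EuclideanSpace.proj i : Eu n →L[ℝ] ℝ) :=
        funext fun x => fderiv_eq_sum_pd f x
      rw [e]
      exact ContDiffOn.sum fun i _ => (ih (fun j => (H j).pd i) hs1 (h2 i)).smul contDiffOn_const

theorem harmAt_of_entHarm_tendsto (hn : 0 < n) {h : ℕ → Eu n → ℝ} (H : ∀ j, EntHarm (h j))
    {f : Eu n → ℝ} {a : Eu n} {r : ℝ} (hr : 0 < r)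
    (hlim : TendstoUniformlyOn h f Filter.atTop (ball a r)) : HarmAt f a := by
  have ha : a ∈ ball a (r / 2) := mem_ball_self (by linarith)
  refine ⟨(contDiffOn_of_entHarm_tendsto hn 2 H (show r / 2 < r by linarith) hlim).contDiffAt
    (isOpen_ball.mem_nhds ha), ?_⟩
  have h1 : Filter.Tendsto (fun j => lapl (h j) a) Filter.atTop (nhds (lapl f a)) :=
    tendsto_finsetSum _ fun i _ =>
      (tendsto_pdMulti_of_entHarm hn H hlim [i, i] (r / 2) (by linarith)).tendsto_at ha
  simp only [fun j => (H j).2 a] at h1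
  exact tendsto_nhds_unique h1 tendsto_const_nhds

theorem exists_entHarm_tendsto (hn : 0 < n) {u : Eu n → ℝ} {a : Eu n} {r : ℝ} (hr : 0 < r)
    (hu : ∀ x ∈ closedBall a r, HarmAt u x) :
    ∃ h : ℕ → Eu n → ℝ, (∀ j, EntHarm (h j)) ∧
      TendstoUniformlyOn h u Filter.atTop (ball a r) := by
  choose h H e using fun j : ℕ =>
    exists_entHarm_near hn hr (show (0 : ℝ) < 1 / ((j : ℝ) + 1) by positivity) hu
  refine ⟨h, H, ?_⟩
  rw [Metric.tendstoUniformlyOn_iff]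
  intro ε hε
  have := (tendsto_one_div_add_atTop_nhds_zero_nat (𝕜 := ℝ)).eventually_lt_const hε
  filter_upwards [this] with j hj x hx
  rw [Real.dist_eq]
  exact (e j x hx).trans_lt hj

/-- Uniform limits of harmonic functions are harmonic. -/
theorem harmAt_of_approx (hn : 0 < n) {f : Eu n → ℝ} {O : Set (Eu n)} (hO : IsOpen O)
    (hf : ∀ η > 0, ∃ g, (∀ x ∈ O, HarmAt g x) ∧ ∀ x ∈ O, |f x - g x| ≤ η) :
    ∀ x ∈ O, HarmAt f x := by
  intro x hx
  obtain ⟨r, hr, hball⟩ := Metric.nhds_basis_closedBall.mem_iff.1 (hO.mem_nhds hx)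
  have : ∀ j : ℕ, ∃ h, EntHarm h ∧ ∀ y ∈ ball x r, |f y - h y| ≤ 1 / ((j : ℝ) + 1) := by
    intro j
    have hj : (0 : ℝ) < 1 / ((j : ℝ) + 1) / 2 := by positivity
    obtain ⟨g, hg1, hg2⟩ := hf _ hj
    obtain ⟨h, H, e⟩ := exists_entHarm_near hn hr hj fun y hy => hg1 y (hball hy)
    refine ⟨h, H, fun y hy => ?_⟩
    have h1 := hg2 y (hball (ball_subset_closedBall hy))
    have h2 := e y hy
    have := abs_sub_le (f y) (g y) (h y)
    linarith
  choose h H e using this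
  refine harmAt_of_entHarm_tendsto hn H hr ?_
  rw [Metric.tendstoUniformlyOn_iff]
  intro ε hε
  have := (tendsto_one_div_add_atTop_nhds_zero_nat (𝕜 := ℝ)).eventually_lt_const hε
  filter_upwards [this] with j hj y hy
  rw [Real.dist_eq]
  exact (e j y hy).trans_lt hj

/-- Derivatives of harmonic functions are harmonic. -/
theorem harmAt_pdMulti (hn : 0 < n) {u : Eu n → ℝ} {O : Set (Eu n)} (hO : IsOpen O)
    (hu : ∀ x ∈ O, HarmAt u x) (L : List (Fin n)) : ∀ x ∈ O, HarmAt (pdMulti L u) x := by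
  intro x hx
  obtain ⟨r, hr, hball⟩ := Metric.nhds_basis_closedBall.mem_iff.1 (hO.mem_nhds hx)
  obtain ⟨h, H, e⟩ := exists_entHarm_tendsto hn hr fun y hy => hu y (hball hy)
  exact harmAt_of_entHarm_tendsto hn (fun j => (H j).pdMulti L) (half_pos hr)
    (tendsto_pdMulti_of_entHarm hn H e L (r / 2) (by linarith))

/-- Interior estimates for all derivatives of harmonic functions. -/
theorem interior_estimate (hn : 0 < n) (m : ℕ) : ∃ C : ℝ, 0 < C ∧ ∀ (u : Eu n → ℝ) (a : Eu n)
    (r M : ℝ), 0 < r → (∀ x ∈ ball a r, HarmAt u x) → (∀ x ∈ ball a r, |u x| ≤ M) →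
    ∀ L : List (Fin n), L.length = m → |pdMulti L u a| ≤ C / r ^ m * M := by
  have hn' : (0 : ℝ) < n := by exact_mod_cast hn
  induction m with
  | zero =>
    refine ⟨1, one_pos, fun u a r M hr hu hM L hL => ?_⟩
    rw [List.length_eq_zero_iff] at hL
    subst hL
    simpa [pdMulti] using hM a (mem_ball_self hr)
  | succ m ih =>
    obtain ⟨C, hC, H⟩ := ih
    refine ⟨n * 2 * (C * 2 ^ m) , by positivity, fun u a r M hr hu hM L hL => ?_⟩
    obtain ⟨i, L, rfl⟩ := List.exists_cons_of_length_eq_add_one hL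
    have hL' : L.length = m := by simpa using hL
    have sub : ∀ x ∈ closedBall a (r / 2), ball x (r / 2) ⊆ ball a r := fun x hx =>
      ball_subset_ball' (by rw [mem_closedBall] at hx; linarith)
    have h1 := abs_pd_le_of_harm hn (u := pdMulti L u) (a := a) (half_pos hr)
      (fun x hx => harmAt_pdMulti hn isOpen_ball hu L x
        (sub x hx (mem_ball_self (half_pos hr))))
      (fun x hx => H u x (r / 2) M (half_pos hr) (fun y hy => hu y (sub x hx hy))
        (fun y hy => hM y (sub x hx hy)) L hL') i
    refine h1.trans (le_of_eq ?_)
    have := hr.ne'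
    rw [div_pow]
    field_simp
    ring

end InteriorRegularity

section Flat

theorem abs_le_of_frontier (hn : 0 < n) {O : Set (Eu n)} (hO : IsOpen O)
    (hb : Bornology.IsBounded O) {u w : Eu n → ℝ} (hc : ContinuousOn u (closure O))
    (hu : ∀ x ∈ O, HarmAt u x) (hcw : ContinuousOn w (closure O))
    (hw : ∀ x ∈ O, HarmAt w x) (hM : ∀ x ∈ frontier O, |u x| ≤ w x) :
    ∀ x ∈ O, |u x| ≤ w x := by
  intro x hx
  refine abs_le.2 ⟨?_, ?_⟩
  · have := max_principle hn hO hb (u := fun x => - u x - w x) (hc.neg.sub hcw)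
      (fun y hy => (hu y hy).neg.sub (hw y hy)) (M := 0)
      (fun y hy => by have := (abs_le.1 (hM y hy)).1; linarith) x hx
    linarith
  · have := max_principle hn hO hb (u := fun x => u x - w x) (hc.sub hcw)
      (fun y hy => (hu y hy).sub (hw y hy)) (M := 0)
      (fun y hy => by have := (abs_le.1 (hM y hy)).2; linarith) x hx
    linarith

theorem frontier_inter_ball_subset {O : Set (Eu n)} {a : Eu n} {r : ℝ} (hr : 0 < r) {x : Eu n}
    (hx : x ∈ frontier (O ∩ ball a r)) :
    (x ∈ frontier O ∧ x ∈ closedBall a r) ∨ (x ∈ closure O ∧ x ∈ sphere a r) := by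
  rcases frontier_inter_subset _ _ hx with ⟨h1, h2⟩ | ⟨h1, h2⟩
  · exact Or.inl ⟨h1, closure_ball_subset_closedBall h2⟩
  · rw [frontier_ball _ hr.ne'] at h2
    exact Or.inr ⟨h1, h2⟩

theorem closure_inter_ball_subset {O : Set (Eu n)} {a : Eu n} {r : ℝ} :
    closure (O ∩ ball a r) ⊆ closure O ∩ closedBall a r := fun _ hx =>
  ⟨closure_mono inter_subset_left hx,
    closure_ball_subset_closedBall (closure_mono inter_subset_right hx)⟩

/-- A harmonic function which is small on the boundary of a domain lying in a half space grows at
most linearly away from the bounding hyperplane. -/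
theorem abs_le_of_flat (hn : 0 < n) {ν : Eu n} (hν : ‖ν‖ = 1) {O : Set (Eu n)} (hO : IsOpen O)
    {x₀ : Eu n} (hx₀ : x₀ ∈ O) {r s m M : ℝ} (hr : 0 < r) (hm : 0 ≤ m) (hM : 0 ≤ M)
    {u : Eu n → ℝ}
    (hflat : ∀ x ∈ closure O ∩ closedBall x₀ (2 * r), lin ν x ≤ s)
    (hu : ∀ x ∈ O ∩ closedBall x₀ (2 * r), HarmAt u x)
    (hc : ContinuousOn u (closure O ∩ closedBall x₀ (2 * r)))
    (hbM : ∀ x ∈ closure O ∩ closedBall x₀ (2 * r), |u x| ≤ M)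
    (hbm : ∀ x ∈ frontier O ∩ closedBall x₀ (2 * r), |u x| ≤ m) :
    |u x₀| ≤ m + M * (n + 1) / r * (s - lin ν x₀) := by
  have hn' : (0 : ℝ) < n := by exact_mod_cast hn
  have hx₁ : x₀ ∈ closure O ∩ closedBall x₀ (2 * r) :=
    ⟨subset_closure hx₀, mem_closedBall_self (by positivity)⟩
  set T := s - lin ν x₀ with hT
  have hT0 : 0 ≤ T := by have := hflat _ hx₁; linarith
  rcases le_or_gt r T with h | h
  · refine (hbM _ hx₁).trans ?_
    have : 1 ≤ T / r := by rwa [le_div_iff₀ hr, one_mul]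
    have h2 : M * 1 ≤ M * ((n + 1) * (T / r)) := by gcongr; nlinarith
    have e : M * (n + 1) / r * T = M * ((n + 1) * (T / r)) := by ring
    linarith
  set b := x₀ + T • ν with hb
  have hbd : ‖x₀ - b‖ = T := by
    rw [hb]; simp [norm_smul, hν, abs_of_nonneg hT0]
  have hlb : lin ν b = s := by rw [hb, lin_add, lin_smul, lin_self hν]; simp [hT]
  have hsub : closedBall b r ⊆ closedBall x₀ (2 * r) := by
    refine closedBall_subset_closedBall' ?_
    rw [dist_eq_norm, norm_sub_rev, hbd]; linarith
  set w : Eu n → ℝ := fun x => m + M / r ^ 2 *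
    (nsq ((-b) + (1 : ℝ) • x) - n * (lin ν ((-b) + (1 : ℝ) • x) * lin ν ((-b) + (1 : ℝ) • x))
      + (-(n * r)) * lin ν ((-b) + (1 : ℝ) • x)) with hw
  have hwh : ∀ x, HarmAt w x := fun x =>
    (harmAt_const m x).add (((harmAt_barrier hν (-(n * r)) _).comp_affine).const_mul _)
  have hwv : ∀ x, w x = m + M / r ^ 2 *
      (‖x - b‖ ^ 2 + n * (s - lin ν x) * (r - (s - lin ν x))) := by
    intro x
    have e : -b + (1 : ℝ) • x = x - b := by rw [one_smul]; abel
    simp only [hw, e, lin_sub, nsq_eq, hlb]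
    ring
  have hinb : ∀ x ∈ closure O ∩ closedBall b r, 0 ≤ n * (s - lin ν x) * (r - (s - lin ν x)) := by
    intro x hx
    have h1 := hflat x ⟨hx.1, hsub hx.2⟩
    have h2 := abs_lin_le hν (x - b)
    have h3 : ‖x - b‖ ≤ r := by simpa [dist_eq_norm] using hx.2
    rw [lin_sub, hlb] at h2
    have h4 := (abs_le.1 (h2.trans h3)).1
    have : 0 ≤ s - lin ν x := by linarith
    have : 0 ≤ r - (s - lin ν x) := by linarith
    positivity
  have hsub2 : closure (O ∩ ball b r) ⊆ closure O ∩ closedBall x₀ (2 * r) :=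
    closure_inter_ball_subset.trans (inter_subset_inter_right _ hsub)
  have key := abs_le_of_frontier hn (hO.inter isOpen_ball)
    (isBounded_ball.subset inter_subset_right) (u := u) (w := w) (hc.mono hsub2)
    (fun x hx => hu x ⟨hx.1, hsub (ball_subset_closedBall hx.2)⟩)
    (fun x _ => (hwh x).continuousAt.continuousWithinAt) (fun x _ => hwh x)
    (fun x hx => by
      rw [hwv]
      rcases frontier_inter_ball_subset hr hx with ⟨h1, h2⟩ | ⟨h1, h2⟩
      · have := hinb x ⟨frontier_subset_closure h1, h2⟩
        have h3 := hbm x ⟨h1, hsub h2⟩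
        have : 0 ≤ M / r ^ 2 *
          (‖x - b‖ ^ 2 + n * (s - lin ν x) * (r - (s - lin ν x))) := by positivity
        linarith
      · have h3 := hinb x ⟨h1, sphere_subset_closedBall h2⟩
        have h4 := hbM x ⟨h1, hsub (sphere_subset_closedBall h2)⟩
        have h5 : ‖x - b‖ = r := by simpa [dist_eq_norm] using h2
        rw [h5]
        have : M / r ^ 2 * (r ^ 2 + 0) ≤ M / r ^ 2 *
          (r ^ 2 + n * (s - lin ν x) * (r - (s - lin ν x))) := by gcongr
        have e : M / r ^ 2 * (r ^ 2 + 0) = M := by field_simp; ring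
        linarith) x₀ ⟨hx₀, by rw [mem_ball, dist_eq_norm, hbd]; exact h⟩
  rw [hwv, hbd, ← hT] at key
  refine key.trans ?_
  have : T ^ 2 + n * T * (r - T) ≤ (n + 1) * (T * r) := by
    have : T * T ≤ T * r := by gcongr
    nlinarith [mul_nonneg hn'.le (mul_nonneg hT0 hT0)]
  have h2 : M / r ^ 2 * (T ^ 2 + n * T * (r - T)) ≤ M / r ^ 2 * ((n + 1) * (T * r)) := by gcongr
  have e : M / r ^ 2 * ((n + 1) * (T * r)) = M * (n + 1) / r * T := by field_simp
  linarith

/-- A harmonic function on an almost flat domain, almost vanishing on the boundary, is close to a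
harmonic polynomial which is odd with respect to the hyperplane. -/
theorem exists_odd_harm_near (hn : 0 < n) {ν : Eu n} (hν : ‖ν‖ = 1) {η : ℝ} (hη : 0 < η)
    (hη1 : η ≤ 1) {O : Set (Eu n)} (hO : IsOpen O)
    (hflat : ∀ x ∈ closure O ∩ ball (0 : Eu n) 1, lin ν x ≤ η)
    (hin : ∀ x ∈ ball (0 : Eu n) 1, lin ν x ≤ -η → x ∈ O) {u : Eu n → ℝ}
    (hu : ∀ x ∈ O ∩ ball (0 : Eu n) 1, HarmAt u x)
    (hc : ContinuousOn u (closure O ∩ ball (0 : Eu n) 1))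
    (hb1 : ∀ x ∈ closure O ∩ ball (0 : Eu n) 1, |u x| ≤ 1)
    (hbη : ∀ x ∈ frontier O ∩ ball (0 : Eu n) 1, |u x| ≤ η) :
    ∃ h, IsPolyFn h ∧ (∀ x, lapl h x = 0) ∧ (∀ x, h (hrefl ν x) = - h x) ∧
      (∀ x ∈ closedBall (0 : Eu n) (1 / 2), |h x| ≤ 3) ∧
      ∀ x ∈ O ∩ ball (0 : Eu n) (1 / 2), |u x - h x| ≤ (24 * n + 30) * η := by
  have hn' : (0 : ℝ) < n := by exact_mod_cast hn
  have hfr : ∀ x ∈ frontier O ∩ ball (0 : Eu n) 1, |lin ν x| ≤ η := fun x hx => by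
    refine abs_le.2 ⟨?_, hflat x ⟨frontier_subset_closure hx.1, hx.2⟩⟩
    by_contra hcon
    push Not at hcon
    exact (hO.frontier_eq ▸ hx.1).2 (hin x hx.2 hcon.le)
  have hhalf : closedBall (0 : Eu n) (1 / 2) ⊆ ball 0 1 :=
    closedBall_subset_ball (by norm_num)
  have hsub : ∀ x ∈ closedBall (0 : Eu n) (1 / 2), closedBall x (2 * (1 / 8)) ⊆ ball 0 1 := by
    intro x hx
    refine (closedBall_subset_closedBall' (ε₂ := 3 / 4) ?_).trans
      (closedBall_subset_ball (by norm_num))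
    rw [mem_closedBall] at hx; linarith
  have hlin : ∀ x ∈ O ∩ closedBall (0 : Eu n) (1 / 2),
      |u x| ≤ η + 8 * (n + 1) * (η - lin ν x) := by
    intro x hx
    have := abs_le_of_flat hn hν hO hx.1 (r := 1 / 8) (s := η) (m := η) (M := 1) (u := u)
      (by norm_num) hη.le zero_le_one
      (fun y hy => hflat y ⟨hy.1, hsub x hx.2 hy.2⟩)
      (fun y hy => hu y ⟨hy.1, hsub x hx.2 hy.2⟩)
      (hc.mono (inter_subset_inter_right _ (hsub x hx.2)))
      (fun y hy => hb1 y ⟨hy.1, hsub x hx.2 hy.2⟩)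
      (fun y hy => hbη y ⟨hy.1, hsub x hx.2 hy.2⟩)
    refine this.trans (le_of_eq (by ring))
  set χ : Eu n → ℝ := fun x => max 0 (min 1 ((-lin ν x - η) / η)) with hχ
  have hχc : Continuous χ := by
    have := continuous_lin ν
    fun_prop
  have hχ0 : ∀ x, 0 ≤ χ x := fun x => le_max_left _ _
  have hχ1 : ∀ x, χ x ≤ 1 := fun x => max_le zero_le_one (min_le_left _ _)
  have hχz : ∀ x, -η ≤ lin ν x → χ x = 0 := fun x hx => by
    refine max_eq_left ((min_le_right _ _).trans ?_)
    exact div_nonpos_of_nonpos_of_nonneg (by linarith) hη.le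
  have hχo : ∀ x, lin ν x ≤ -(2 * η) → χ x = 1 := fun x hx => by
    have : 1 ≤ (-lin ν x - η) / η := by rw [le_div_iff₀ hη]; linarith
    simp [hχ, min_eq_left this]
  set φ₁ : Eu n → ℝ := fun x => u x * χ x with hφ₁
  have hφz : ∀ x, -η ≤ lin ν x → φ₁ x = 0 := fun x hx => by simp [hφ₁, hχz x hx]
  have hφc : ContinuousOn φ₁ (closedBall 0 (1 / 2)) := by
    have h1 : ContinuousOn φ₁ (closedBall 0 (1 / 2) ∩ {x | lin ν x ≤ -η}) :=
      (hc.mono fun x hx => ⟨subset_closure (hin x (hhalf hx.1) hx.2), hhalf hx.1⟩).mul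
        hχc.continuousOn
    have h2 : ContinuousOn φ₁ (closedBall 0 (1 / 2) ∩ {x | -η ≤ lin ν x}) :=
      (continuousOn_const (c := (0 : ℝ))).congr fun x hx => hφz x hx.2
    refine (h1.union_of_isClosed h2
      (isClosed_closedBall.inter (isClosed_le (continuous_lin ν) continuous_const))
      (isClosed_closedBall.inter (isClosed_le continuous_const (continuous_lin ν)))).mono ?_
    intro x hx
    rcases le_total (lin ν x) (-η) with h | h
    · exact Or.inl ⟨hx, h⟩
    · exact Or.inr ⟨hx, h⟩
  have hσ : ∀ {x : Eu n} {s : ℝ}, x ∈ closedBall (0 : Eu n) s → hrefl ν x ∈ closedBall 0 s := by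
    intro x s hx
    simpa using hx
  have hσ' : ∀ {x : Eu n} {s : ℝ}, x ∈ sphere (0 : Eu n) s → hrefl ν x ∈ sphere 0 s := by
    intro x s hx
    simpa using hx
  set φ : Eu n → ℝ := fun x => φ₁ x - φ₁ (hrefl ν x) with hφ
  have hφo : ∀ x, φ (hrefl ν x) = - φ x := fun x => by simp only [hφ, hrefl_hrefl]; ring
  have hφe : ∀ x, lin ν x ≤ η → φ x = φ₁ x := fun x hx => by
    have : φ₁ (hrefl ν x) = 0 := hφz _ (by rw [lin_hrefl hν]; linarith)
    simp only [hφ, this, sub_zero]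
  have hφC : ContinuousOn φ (sphere 0 (1 / 2)) := by
    refine (hφc.mono sphere_subset_closedBall).sub
      ((hφc.mono sphere_subset_closedBall).comp (hrefl ν).continuous.continuousOn fun x hx =>
        hσ' hx)
  have hφb : ∀ x ∈ closedBall (0 : Eu n) (1 / 2), lin ν x ≤ 0 →
      |φ x| ≤ 1 ∧ |φ x| ≤ η + 8 * (n + 1) * (η - lin ν x) := by
    intro x hx hx0
    have hpos : 0 ≤ η + 8 * (n + 1) * (η - lin ν x) := by
      have : 0 ≤ η - lin ν x := by linarith
      positivity
    rw [hφe x (by linarith)]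
    rcases le_total (lin ν x) (-η) with h | h
    · have h1 := hin x (hhalf hx) h
      have h2 : |φ₁ x| ≤ |u x| := by
        rw [hφ₁]; dsimp only; rw [abs_mul, abs_of_nonneg (hχ0 x)]
        exact mul_le_of_le_one_right (abs_nonneg _) (hχ1 x)
      exact ⟨h2.trans (hb1 x ⟨subset_closure h1, hhalf hx⟩), h2.trans (hlin x ⟨h1, hx⟩)⟩
    · rw [hφz x h, abs_zero]
      exact ⟨zero_le_one, hpos⟩
  obtain ⟨h₀, hp₀, hl₀, hn₀⟩ := exists_harm_near_on_sphere hn hφC hη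
  set h : Eu n → ℝ := fun x => 1 / 2 * (h₀ x + (-1) * h₀ (hrefl ν x)) with hh
  have hpoly : IsPolyFn h := (hp₀.add ((hp₀.comp_hrefl hν).const_mul _)).const_mul _
  have hharm₀ : ∀ x, HarmAt h₀ x := fun x => hp₀.sm.harmAt hl₀ x
  have hharm : ∀ x, HarmAt h x := fun x =>
    ((hharm₀ x).add (((hharm₀ _).comp_isometry (hrefl ν)).const_mul _)).const_mul _
  have hodd : ∀ x, h (hrefl ν x) = - h x := fun x => by
    simp only [hh, hrefl_hrefl]; ring
  have hnear : ∀ x ∈ sphere (0 : Eu n) (1 / 2), |φ x - h x| ≤ η := by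
    intro x hx
    have h1 := abs_le.1 (hn₀ x hx)
    have h2 := abs_le.1 (hn₀ _ (hσ' hx))
    rw [hφo] at h2
    simp only [hh]
    rw [abs_le]
    constructor <;> linarith
  have hhc : Continuous h := continuous_iff_continuousAt.2 fun x => (hharm x).continuousAt
  have hh3 : ∀ x ∈ closedBall (0 : Eu n) (1 / 2), |h x| ≤ 3 := by
    have hs : ∀ x ∈ sphere (0 : Eu n) (1 / 2), |h x| ≤ 3 := by
      have aux : ∀ x ∈ sphere (0 : Eu n) (1 / 2), lin ν x ≤ 0 → |h x| ≤ 3 := by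
        intro x hx hx0
        have h1 := (hφb x (sphere_subset_closedBall hx) hx0).1
        have h2 := hnear x hx
        rw [abs_le] at *
        constructor <;> linarith
      intro x hx
      rcases le_total (lin ν x) 0 with h | h
      · exact aux x hx h
      · rw [← abs_neg, ← hodd]
        exact aux _ (hσ' hx) (by rw [lin_hrefl hν]; linarith)
    intro x hx
    rcases (mem_closedBall.1 hx).lt_or_eq with h | h
    · refine abs_max_principle hn isOpen_ball isBounded_ball hhc.continuousOn
        (fun y _ => hharm y) (fun y hy => hs y ?_) x (mem_ball.2 h)
      rwa [frontier_ball _ (by norm_num)] at hy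
    · exact hs x h
  have hhl : ∀ x ∈ closedBall (0 : Eu n) (1 / 2), lin ν x ≤ 0 →
      |h x| ≤ 2 * η + 8 * (n + 1) * (η - lin ν x) := by
    have hs : ∀ x ∈ sphere (0 : Eu n) (1 / 2), lin ν x ≤ 0 →
        |h x| ≤ 2 * η + 8 * (n + 1) * (η - lin ν x) := by
      intro x hx hx0
      have h1 := (hφb x (sphere_subset_closedBall hx) hx0).2
      have h2 := hnear x hx
      rw [abs_le] at *
      constructor <;> linarith
    have hz : ∀ x, lin ν x = 0 → h x = 0 := fun x hx => by
      have := hodd x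
      rw [hrefl_eq_self hν hx] at this
      linarith
    have hw : ∀ x, HarmAt (fun x : Eu n => 2 * η + 8 * (n + 1) * (η - lin ν x)) x := fun x => by
      have hl : HarmAt (lin ν) x := ⟨(contDiff_lin ν).contDiffAt, by
        simp [lapl, pd2, pd_lin, pd_const]⟩
      exact (harmAt_const _ x).add (((harmAt_const η x).sub hl).const_mul _)
    have hH : IsOpen {x : Eu n | lin ν x < 0} := isOpen_lt (continuous_lin ν) continuous_const
    have hfront : ∀ x ∈ closedBall (0 : Eu n) (1 / 2), lin ν x = 0 →
        |h x| ≤ 2 * η + 8 * (n + 1) * (η - lin ν x) := fun x _ hx0 => by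
      rw [hz x hx0, hx0, abs_zero]; positivity
    intro x hx hx0
    rcases (mem_closedBall.1 hx).lt_or_eq with hlt | heq
    · rcases hx0.lt_or_eq with hx1 | hx1
      · refine abs_le_of_frontier hn (hH.inter isOpen_ball)
          (isBounded_ball.subset inter_subset_right) hhc.continuousOn (fun y _ => hharm y)
          (fun y _ => (hw y).continuousAt.continuousWithinAt) (fun y _ => hw y)
          (fun y hy => ?_) x ⟨hx1, mem_ball.2 hlt⟩
        rcases frontier_inter_ball_subset (by norm_num) hy with ⟨h1, h2⟩ | ⟨h1, h2⟩
        · exact hfront y h2 (frontier_lt_subset_eq (continuous_lin ν) continuous_const h1)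
        · exact hs y h2 (closure_lt_subset_le (continuous_lin ν) continuous_const h1)
      · exact hfront x hx hx1
    · exact hs x heq hx0
  refine ⟨h, hpoly, fun x => (hharm x).2, hodd, hh3, ?_⟩
  refine abs_max_principle hn (hO.inter isOpen_ball) (isBounded_ball.subset inter_subset_right)
    (u := fun x => u x - h x) (M := (24 * n + 30) * η)
    ((hc.mono (closure_inter_ball_subset.trans (inter_subset_inter_right _ hhalf))).sub
      hhc.continuousOn)
    (fun x hx => (hu x ⟨hx.1, hhalf (ball_subset_closedBall hx.2)⟩).sub (hharm x)) ?_
  have hfb : ∀ x ∈ frontier O ∩ closedBall (0 : Eu n) (1 / 2),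
      |u x - h x| ≤ (24 * n + 30) * η := by
    have hl2 : ∀ x ∈ closedBall (0 : Eu n) (1 / 2),
        |h x| ≤ 2 * η + 8 * (n + 1) * (η + |lin ν x|) := by
      intro x hx
      rcases le_total (lin ν x) 0 with h | h
      · rw [abs_of_nonpos h]
        exact hhl x hx h
      · rw [← abs_neg, ← hodd, abs_of_nonneg h]
        have := hhl _ (hσ hx) (by rw [lin_hrefl hν]; linarith)
        rwa [lin_hrefl hν, sub_neg_eq_add] at this
    intro x hx
    have h1 := hbη x ⟨hx.1, hhalf hx.2⟩
    have h2 := hl2 x hx.2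
    have h3 := hfr x ⟨hx.1, hhalf hx.2⟩
    have h4 : 8 * ((n : ℝ) + 1) * (η + |lin ν x|) ≤ 8 * (n + 1) * (η + η) := by gcongr
    have h5 := abs_sub (u x) (h x)
    nlinarith
  intro x hx
  rcases frontier_inter_ball_subset (by norm_num) hx with ⟨h1, h2⟩ | ⟨h1, h2⟩
  · exact hfb x ⟨h1, h2⟩
  have h2' := sphere_subset_closedBall h2
  by_cases hxO : x ∈ O
  · have hx1 := hflat x ⟨h1, hhalf h2'⟩
    have h3 := hnear x h2
    rw [hφe x hx1] at h3
    have h4 : |u x - φ₁ x| ≤ η + 24 * (n + 1) * η := by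
      have e : u x - φ₁ x = u x * (1 - χ x) := by simp only [hφ₁]; ring
      rcases le_total (lin ν x) (-(2 * η)) with h | h
      · rw [e, hχo x h]; simp; positivity
      · have h5 := hlin x ⟨hxO, h2'⟩
        have h6 : |u x - φ₁ x| ≤ |u x| := by
          rw [e, abs_mul, abs_of_nonneg (by linarith [hχ1 x] : 0 ≤ 1 - χ x)]
          exact mul_le_of_le_one_right (abs_nonneg _) (by linarith [hχ0 x])
        have h7 : 8 * ((n : ℝ) + 1) * (η - lin ν x) ≤ 8 * (n + 1) * (3 * η) := by
          gcongr; linarith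
        linarith
    have h5 := abs_sub_le (u x) (φ₁ x) (h x)
    nlinarith
  · exact hfb x ⟨hO.frontier_eq ▸ ⟨h1, hxO⟩, h2'⟩

end Flat

section Truncation

theorem interior_estimate_le (hn : 0 < n) (k : ℕ) : ∃ C : ℝ, 0 < C ∧ ∀ (u : Eu n → ℝ) (a : Eu n)
    (r M : ℝ), 0 < r → (∀ x ∈ ball a r, HarmAt u x) → (∀ x ∈ ball a r, |u x| ≤ M) →
    ∀ L : List (Fin n), L.length ≤ k → |pdMulti L u a| ≤ C / r ^ L.length * M := by
  choose C hC H using interior_estimate (n := n) hn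
  refine ⟨∑ m ∈ Finset.range (k + 1), C m,
    Finset.sum_pos (fun m _ => hC m) ⟨0, by simp⟩, fun u a r M hr hu hM L hL => ?_⟩
  refine (H _ u a r M hr hu hM L rfl).trans ?_
  have : 0 ≤ M := (abs_nonneg _).trans (hM a (mem_ball_self hr))
  gcongr
  exact Finset.single_le_sum (f := C) (fun m _ => (hC m).le)
    (Finset.mem_range.2 (Nat.lt_succ_of_le hL))

theorem Sm.pdMulti {f : Eu n → ℝ} (hf : Sm f) (L : List (Fin n)) : Sm (pdMulti L f) :=
  ContDiff.pdMulti hf L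

theorem pdMulti_sum_sm {ι : Type*} {s : Finset ι} {f : ι → Eu n → ℝ}
    (hf : ∀ j ∈ s, Sm (f j)) (L : List (Fin n)) :
    pdMulti L (fun x => ∑ j ∈ s, f j x) = fun x => ∑ j ∈ s, pdMulti L (f j) x := by
  induction L with
  | nil => rfl
  | cons i L ih =>
    change pd i (pdMulti L _) = _
    rw [ih, pd_sum_sm fun j hj => (hf j hj).pdMulti L]
    rfl

theorem pdMulti_sub_sm {f g : Eu n → ℝ} (hf : Sm f) (hg : Sm g) (L : List (Fin n)) :
    pdMulti L (fun x => f x - g x) = fun x => pdMulti L f x - pdMulti L g x := by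
  induction L with
  | nil => rfl
  | cons i L ih =>
    change pd i (pdMulti L _) = _
    rw [ih]
    funext x
    exact pd_sub ((hf.pdMulti L).diff x) ((hg.pdMulti L).diff x)

/-- A function vanishing to order `k` at the origin with bounded derivatives of order `k + 1`. -/
theorem abs_le_of_vanishing {k : ℕ} {f : Eu n → ℝ} (hf : Sm f) {r M : ℝ} (hM : 0 ≤ M)
    (h0 : ∀ L : List (Fin n), L.length ≤ k → pdMulti L f 0 = 0)
    (hb : ∀ L : List (Fin n), L.length = k + 1 → ∀ x ∈ ball (0 : Eu n) r, |pdMulti L f x| ≤ M) :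
    ∀ x ∈ ball (0 : Eu n) r, |f x| ≤ M * (n * ‖x‖) ^ (k + 1) := by
  suffices H : ∀ j, ∀ L : List (Fin n), L.length + j = k + 1 → ∀ x ∈ ball (0 : Eu n) r,
      |pdMulti L f x| ≤ M * (n * ‖x‖) ^ j from fun x hx => H (k + 1) [] (by simp) x hx
  intro j
  induction j with
  | zero => intro L hL x hx; simpa using hb L hL x hx
  | succ j ih =>
    intro L hL x hx
    have hd : ∀ y ∈ closedBall (0 : Eu n) ‖x‖, ‖fderiv ℝ (pdMulti L f) y‖ ≤
        n * (M * (n * ‖x‖) ^ j) := by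
      intro y hy
      have hy' : ‖y‖ ≤ ‖x‖ := by simpa using hy
      refine norm_fderiv_le_sum_pd _ _ (fun i => ?_) (by positivity)
      refine (ih (i :: L) (by simp; omega) y ?_).trans (by gcongr)
      rw [mem_ball_zero_iff] at hx ⊢
      exact hy'.trans_lt hx
    have := (convex_closedBall (0 : Eu n) ‖x‖).norm_image_sub_le_of_norm_fderiv_le
      (fun y _ => (hf.pdMulti L).diff y) hd (mem_closedBall_self (norm_nonneg _))
      (by simp : x ∈ closedBall (0 : Eu n) ‖x‖)
    rw [h0 L (by omega), sub_zero, sub_zero, Real.norm_eq_abs] at this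
    refine this.trans (le_of_eq ?_)
    ring

/-- Taylor polynomials of odd harmonic functions. -/
theorem exists_odd_truncation (hn : 0 < n) (k : ℕ) : ∃ C : ℝ, 0 < C ∧ ∀ ν : Eu n, ‖ν‖ = 1 →
    ∀ h : Eu n → ℝ, IsPolyFn h → (∀ x, lapl h x = 0) → (∀ x, h (hrefl ν x) = - h x) →
    (∀ x ∈ closedBall (0 : Eu n) (1 / 2), |h x| ≤ 3) →
    ∃ q : ℕ → Eu n → ℝ, (∀ m < k, HomB m C (q m)) ∧
      (∀ m < k, ∀ x, lapl (fun y => lin ν y * q m y) x = 0) ∧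
      ∀ x ∈ ball (0 : Eu n) (1 / 4),
        |h x - ∑ m ∈ Finset.range k, lin ν x * q m x| ≤ C * ‖x‖ ^ (k + 1) := by
  obtain ⟨C, hC, HC⟩ := interior_estimate_le hn (k + 1)
  choose K hK HK using fun m => HomB.dvd_of_vanish (n := n) (m := m)
  set C₁ := C * 4 ^ (k + 1) * 3 with hC₁
  have hC₁0 : 0 ≤ C₁ := by positivity
  have hKs : 0 ≤ ∑ m ∈ Finset.range k, K m := Finset.sum_nonneg fun m _ => hK m
  refine ⟨C₁ * n ^ (k + 1) + (∑ m ∈ Finset.range k, K m) * C₁, by positivity,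
    fun ν hν h hp hl ho hb => ?_⟩
  have hharm := fun x => hp.sm.harmAt hl x
  have hbound : ∀ L : List (Fin n), L.length ≤ k + 1 → ∀ x ∈ ball (0 : Eu n) (1 / 4),
      |pdMulti L h x| ≤ C₁ := by
    intro L hL x hx
    refine (HC h x (1 / 4) 3 (by norm_num) (fun y _ => hharm y) (fun y hy => hb y ?_) L hL).trans ?_
    · rw [mem_ball, dist_zero_right] at hx
      rw [mem_ball, dist_eq_norm] at hy
      rw [mem_closedBall, dist_zero_right]
      have := norm_add_le (y - x) x
      rw [sub_add_cancel] at this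
      linarith
    · rw [hC₁, one_div, inv_pow, div_inv_eq_mul]
      gcongr
      norm_num
  obtain ⟨N, p, hpH, hpz, hps⟩ := hp
  set N' := N + k + 1 with hN'
  have hps' : ∀ x, h x = ∑ m ∈ Finset.range N', p m x := fun x => by
    rw [hps, sum_range_extend hpz (show N ≤ N' by omega)]
  have hh : h = fun x => ∑ m ∈ Finset.range N', p m x := funext hps'
  have hsm : ∀ m, Sm (p m) := fun m => (hpH m).choose_spec.sm
  have hlc := lapl_component hpH (N := N') (by rw [← hh]; exact hl)
  have hoc := component_odd hpH (N := N') (ν := ν) fun x => by rw [← hps', ← hps', ho]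
  have hpd : ∀ L : List (Fin n), pdMulti L h = fun x => ∑ m ∈ Finset.range N', pdMulti L (p m) x := by
    intro L
    rw [hh]
    exact pdMulti_sum_sm (fun m _ => hsm m) L
  have hpd0 : ∀ L : List (Fin n), ∀ m, m ≠ L.length → pdMulti L (p m) 0 = 0 := by
    intro L m hm
    obtain ⟨c, hc⟩ := hpH m
    rcases hm.lt_or_gt with h | h
    · rw [hc.pdMulti_eq_zero h]
    · exact hc.pdMulti_zero_of_lt h
  have hcomp : ∀ m < N', m ≤ k + 1 → HomB m C₁ (p m) := by
    intro m hm hmk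
    obtain ⟨c, hc⟩ := hpH m
    refine hc.of_pdMulti hC₁0 fun L hL => ?_
    have h1 := hbound L (by omega) 0 (by simp)
    rw [hpd] at h1
    dsimp only at h1
    rwa [Finset.sum_eq_single m (fun j _ hj => hpd0 L j (by omega))
      (fun hj => absurd (Finset.mem_range.2 hm) hj)] at h1
  have hvan : ∀ m < N', ∀ x, lin ν x = 0 → p m x = 0 := fun m hm x hx => by
    have := hoc m hm x
    rw [hrefl_eq_self hν hx] at this
    linarith
  have hdiv : ∀ m, ∃ q, m < k → HomB m (K m * C₁) q ∧ ∀ x, p (m + 1) x = lin ν x * q x := by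
    intro m
    by_cases hm : m < k
    · obtain ⟨q, hq⟩ := HK m ν C₁ (p (m + 1)) hν (hcomp _ (by omega) (by omega))
        (hvan _ (by omega))
      exact ⟨q, fun _ => hq⟩
    · exact ⟨fun _ => 0, fun h => absurd h hm⟩
  choose q hq using hdiv
  have hp0 : ∀ x, p 0 x = 0 := by
    obtain ⟨c, a, -, e⟩ := hpH 0
    have := hvan 0 (by omega) 0 (lin_zero ν)
    rw [e] at this ⊢
    exact fun _ => this
  refine ⟨q, fun m hm => ((hq m hm).1).mono ?_, fun m hm x => ?_, fun x hx => ?_⟩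
  · have := Finset.single_le_sum (f := K) (fun m _ => hK m) (Finset.mem_range.2 hm)
    have h2 : K m * C₁ ≤ (∑ m ∈ Finset.range k, K m) * C₁ := by gcongr
    have : 0 ≤ C₁ * n ^ (k + 1) := by positivity
    linarith
  · rw [← funext (hq m hm).2]
    exact hlc _ (by omega) x
  · have e : ∀ x, ∑ m ∈ Finset.range k, lin ν x * q m x = ∑ m ∈ Finset.range (k + 1), p m x := by
      intro x
      rw [Finset.sum_range_succ', hp0, add_zero]
      exact Finset.sum_congr rfl fun m hm => ((hq m (Finset.mem_range.1 hm)).2 x).symm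
    rw [e]
    have hs2 : Sm fun x => ∑ m ∈ Finset.range (k + 1), p m x := Sm.sum fun m _ => hsm m
    have hs1 : Sm h := by rw [hh]; exact Sm.sum fun m _ => hsm m
    have hpd2 : ∀ L : List (Fin n), pdMulti L (fun x => h x - ∑ m ∈ Finset.range (k + 1), p m x) =
        fun x => pdMulti L h x - ∑ m ∈ Finset.range (k + 1), pdMulti L (p m) x := by
      intro L
      rw [pdMulti_sub_sm hs1 hs2, pdMulti_sum_sm fun m _ => hsm m]
    have := abs_le_of_vanishing (k := k) (r := 1 / 4) (hs1.sub hs2) hC₁0 (fun L hL => ?_)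
      (fun L hL x hx => ?_) x hx
    · refine this.trans ?_
      rw [mul_pow, ← mul_assoc]
      gcongr
      have : 0 ≤ (∑ m ∈ Finset.range k, K m) * C₁ := by positivity
      linarith
    · rw [hpd2, hpd]
      dsimp only
      rw [Finset.sum_eq_single L.length (fun j _ hj => hpd0 L j hj)
          (fun hj => absurd (Finset.mem_range.2 (by omega)) hj),
        Finset.sum_eq_single L.length (fun j _ hj => hpd0 L j hj)
          (fun hj => absurd (Finset.mem_range.2 (by omega)) hj), sub_self]
    · rw [hpd2]
      dsimp only
      rw [Finset.sum_eq_zero fun m hm => ?_, sub_zero]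
      · exact hbound L hL.le x hx
      · obtain ⟨c, hc⟩ := hpH m
        rw [hc.pdMulti_eq_zero (by have := Finset.mem_range.1 hm; omega)]

end Truncation

section Correctors

/-- Near the origin, `Ω` is a subgraph over a hyperplane, tangent to it at the origin, with a
Taylor expansion of order `d + 1 + ε`. -/
structure IsGraphNear (d : ℕ) (ε κ : ℝ) (ν : Eu n) (Ψ : Eu n → ℝ) (ψ : ℕ → Eu n → ℝ)
    (Ω : Set (Eu n)) : Prop where
  norm_eq : ‖ν‖ = 1
  isOpen : IsOpen Ω
  nonneg : 0 ≤ κ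
  mem_iff : ∀ x ∈ ball (0 : Eu n) 1, (x ∈ Ω ↔ lin ν x < Ψ x)
  eq_of_mem_frontier : ∀ x ∈ ball (0 : Eu n) 1, x ∈ frontier Ω → lin ν x = Ψ x
  homB : ∀ j < d, HomB (j + 2) κ (ψ j)
  abs_le : ∀ x ∈ ball (0 : Eu n) 1, |Ψ x| ≤ κ * ‖x‖ ^ 2
  near : ∀ x ∈ ball (0 : Eu n) 1,
    |Ψ x - ∑ j ∈ Finset.range d, ψ j x| ≤ κ * ‖x‖ ^ ((d : ℝ) + 1 + ε)

theorem entHarm_sum {ι : Type*} {s : Finset ι} {f : ι → Eu n → ℝ}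
    (hf : ∀ j ∈ s, EntHarm (f j)) : EntHarm fun x => ∑ j ∈ s, f j x :=
  ⟨Sm.sum fun j hj => (hf j hj).1, fun x => (HarmAt.sum fun j hj => (hf j hj).harmAt x).2⟩

theorem HomB.abs_le_one_add {m k : ℕ} {c : ℝ} {f : Eu n → ℝ} (h : HomB m c f) (hmk : m ≤ k)
    (hn : 0 < n) (x : Eu n) : |f x| ≤ n ^ k * c * (1 + ‖x‖) ^ k := by
  have hn' : (1 : ℝ) ≤ n := by exact_mod_cast hn
  have hc := h.nonneg
  have h0 := norm_nonneg x
  calc |f x| ≤ c * (n * ‖x‖) ^ m := h.abs_le x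
    _ ≤ c * (n * (1 + ‖x‖)) ^ m := by gcongr; linarith
    _ ≤ c * (n * (1 + ‖x‖)) ^ k := by
        gcongr
        nlinarith
    _ = n ^ k * c * (1 + ‖x‖) ^ k := by rw [mul_pow]; ring

theorem HomB.abs_le_pow {m : ℕ} {c : ℝ} {f : Eu n → ℝ} (h : HomB m c f)
    {x : Eu n} (hx : x ∈ ball (0 : Eu n) 1) : |f x| ≤ n ^ m * c := by
  have hc := h.nonneg
  have h1 : ‖x‖ ≤ 1 := (mem_ball_zero_iff.1 hx).le
  calc |f x| ≤ c * (n * ‖x‖) ^ m := h.abs_le x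
    _ ≤ c * (n * 1) ^ m := by gcongr
    _ = n ^ m * c := by rw [mul_one]; ring

/-- A homogeneous polynomial agrees on the boundary of `Ω` with a harmonic polynomial up to an
error of order `d + 1 + ε`. -/
theorem exists_corrector (hn : 0 < n) (d : ℕ) {ε : ℝ} (hε1 : ε ≤ 1) (e : ℕ) :
    ∀ m : ℕ, 1 ≤ m → d + 2 ≤ m + e → ∃ K : ℝ, 0 ≤ K ∧
    ∀ {κ : ℝ} {ν : Eu n} {Ψ : Eu n → ℝ} {ψ : ℕ → Eu n → ℝ} {Ω : Set (Eu n)},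
    IsGraphNear d ε κ ν Ψ ψ Ω → κ ≤ 1 → ∀ {c : ℝ} {q : Eu n → ℝ}, HomB m c q →
    ∃ P, EntHarm P ∧ (∀ x, |P x| ≤ K * c * (1 + ‖x‖) ^ (d + 1)) ∧
      ∀ x ∈ frontier Ω ∩ ball (0 : Eu n) 1,
        |P x - q x| ≤ K * c * ‖x‖ ^ ((d : ℝ) + 1 + ε) := by
  induction e with
  | zero =>
    intro m _ hm
    refine ⟨n ^ m, by positivity, fun {κ ν Ψ ψ Ω} _ _ {c q} hq => ⟨fun _ => 0, entHarm_zero, fun x => ?_,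
      fun x hx => ?_⟩⟩
    · have := hq.nonneg
      rw [abs_zero]; positivity
    · have hc := hq.nonneg
      have h1 : ‖x‖ ≤ 1 := (mem_ball_zero_iff.1 hx.2).le
      rw [zero_sub, abs_neg]
      refine (hq.abs_le x).trans ?_
      have h2 : ‖x‖ ^ m ≤ ‖x‖ ^ ((d : ℝ) + 1 + ε) := by
        rcases (norm_nonneg x).eq_or_lt with h | h
        · rw [← h, zero_pow (by omega)]
          exact Real.rpow_nonneg le_rfl _
        · rw [← Real.rpow_natCast]
          refine Real.rpow_le_rpow_of_exponent_ge h h1 ?_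
          have : ((d + 2 : ℕ) : ℝ) ≤ m := by exact_mod_cast hm
          push_cast at this
          linarith
      calc c * (n * ‖x‖) ^ m = n ^ m * c * ‖x‖ ^ m := by rw [mul_pow]; ring
        _ ≤ _ := by gcongr
  | succ e ih =>
    intro m hm1 hm
    rcases Nat.lt_or_ge (d + 1) m with h | h
    · exact ih m hm1 (by omega)
    obtain ⟨m, rfl⟩ := Nat.exists_eq_add_of_le' hm1
    obtain ⟨K, hK, HK⟩ := exists_harm_add_lin_mul (n := n) m
    choose K' hK' HK' using fun j : ℕ => ih (j + 2 + m) (by omega) (by omega)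
    refine ⟨n ^ (d + 1) * (1 + K) + ∑ j ∈ Finset.range d, K' j * K + n ^ m * K,
      add_nonneg (add_nonneg (by positivity)
        (Finset.sum_nonneg fun j _ => mul_nonneg (hK' j) hK)) (by positivity),
      fun {κ ν Ψ ψ Ω} G hκ {c q} hq => ?_⟩
    obtain ⟨q₁, hq₁, hQ, hQl⟩ := HK ν c q G.norm_eq hq
    have hc := hq.nonneg
    have hκ0 := G.nonneg
    have hex : ∀ j, ∃ P, j < d → EntHarm P ∧ (∀ x, |P x| ≤ K' j * K * c * (1 + ‖x‖) ^ (d + 1)) ∧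
        ∀ x ∈ frontier Ω ∩ ball (0 : Eu n) 1,
          |P x - ψ j x * q₁ x| ≤ K' j * K * c * ‖x‖ ^ ((d : ℝ) + 1 + ε) := by
      intro j
      by_cases hj : j < d
      · have h1 : HomB (j + 2 + m) (1 * (K * c)) (fun x => ψ j x * q₁ x) :=
          ((G.homB j hj).mono hκ).mul hq₁
        obtain ⟨P, h2, h3, h4⟩ := HK' j G hκ h1
        refine ⟨P, fun _ => ⟨h2, fun x => (h3 x).trans (le_of_eq (by ring)),
          fun x hx => (h4 x hx).trans (le_of_eq (by ring))⟩⟩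
      · exact ⟨fun _ => 0, fun h => absurd h hj⟩
    choose P hP using hex
    have hQe : EntHarm fun x => q x + lin ν x * q₁ x := ⟨hQ.sm, hQl⟩
    refine ⟨fun x => (q x + lin ν x * q₁ x) - ∑ j ∈ Finset.range d, P j x,
      hQe.sub (entHarm_sum fun j hj => (hP j (Finset.mem_range.1 hj)).1), fun x => ?_,
      fun x hx => ?_⟩
    · have h1 := hQ.abs_le_one_add h hn x
      have h2 : |∑ j ∈ Finset.range d, P j x| ≤
          ∑ j ∈ Finset.range d, K' j * K * c * (1 + ‖x‖) ^ (d + 1) :=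
        (Finset.abs_sum_le_sum_abs _ _).trans
          (Finset.sum_le_sum fun j hj => (hP j (Finset.mem_range.1 hj)).2.1 x)
      rw [← Finset.sum_mul, ← Finset.sum_mul] at h2
      have h3 : 0 ≤ n ^ m * K * c * (1 + ‖x‖) ^ (d + 1) := by positivity
      have h4 := abs_sub (q x + lin ν x * q₁ x) (∑ j ∈ Finset.range d, P j x)
      nlinarith
    · have ht := G.eq_of_mem_frontier x hx.2 hx.1
      have hnear := G.near x hx.2
      have e1 : q x + lin ν x * q₁ x - ∑ j ∈ Finset.range d, P j x - q x =
          (Ψ x - ∑ j ∈ Finset.range d, ψ j x) * q₁ x -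
            ∑ j ∈ Finset.range d, (P j x - ψ j x * q₁ x) := by
        rw [ht, Finset.sum_sub_distrib, ← Finset.sum_mul]; ring
      have hr : 0 ≤ ‖x‖ ^ ((d : ℝ) + 1 + ε) := Real.rpow_nonneg (norm_nonneg _) _
      rw [e1]
      have h1 : |(Ψ x - ∑ j ∈ Finset.range d, ψ j x) * q₁ x| ≤
          1 * ‖x‖ ^ ((d : ℝ) + 1 + ε) * (n ^ m * (K * c)) := by
        rw [abs_mul]
        refine mul_le_mul (hnear.trans ?_) (hq₁.abs_le_pow hx.2) (abs_nonneg _) (by positivity)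
        gcongr
      have h2 : |∑ j ∈ Finset.range d, (P j x - ψ j x * q₁ x)| ≤
          ∑ j ∈ Finset.range d, K' j * K * c * ‖x‖ ^ ((d : ℝ) + 1 + ε) :=
        (Finset.abs_sum_le_sum_abs _ _).trans
          (Finset.sum_le_sum fun j hj => (hP j (Finset.mem_range.1 hj)).2.2 x hx)
      rw [← Finset.sum_mul, ← Finset.sum_mul] at h2
      have h3 : 0 ≤ n ^ (d + 1) * (1 + K) * c * ‖x‖ ^ ((d : ℝ) + 1 + ε) := by positivity
      have h4 := abs_sub ((Ψ x - ∑ j ∈ Finset.range d, ψ j x) * q₁ x)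
        (∑ j ∈ Finset.range d, (P j x - ψ j x * q₁ x))
      nlinarith

/-- Correction of a linear function times a polynomial so as to almost vanish on the boundary. -/
theorem exists_lin_mul_corrector (hn : 0 < n) (d : ℕ) {ε : ℝ} (hε1 : ε ≤ 1) (m : ℕ) :
    ∃ K : ℝ, 0 ≤ K ∧
    ∀ {κ : ℝ} {ν : Eu n} {Ψ : Eu n → ℝ} {ψ : ℕ → Eu n → ℝ} {Ω : Set (Eu n)},
    IsGraphNear d ε κ ν Ψ ψ Ω → κ ≤ 1 → ∀ {c : ℝ} {q : Eu n → ℝ}, HomB m c q →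
    (∀ x, lapl (fun y => lin ν y * q y) x = 0) →
    ∃ P, EntHarm P ∧ (∀ x, |P x - lin ν x * q x| ≤ K * c * κ * (1 + ‖x‖) ^ (d + 1)) ∧
      ∀ x ∈ frontier Ω ∩ ball (0 : Eu n) 1, |P x| ≤ K * c * κ * ‖x‖ ^ ((d : ℝ) + 1 + ε) := by
  choose K' hK' HK' using fun j : ℕ =>
    exists_corrector hn d hε1 (d + 2) (j + 2 + m) (by omega) (by omega)
  refine ⟨∑ j ∈ Finset.range d, K' j + n ^ m,
      add_nonneg (Finset.sum_nonneg fun j _ => hK' j) (by positivity),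
      fun {κ ν Ψ ψ Ω} G hκ {c q} hq hl => ?_⟩
  have hc := hq.nonneg
  have hκ0 := G.nonneg
  have hex : ∀ j, ∃ P, j < d → EntHarm P ∧ (∀ x, |P x| ≤ K' j * c * κ * (1 + ‖x‖) ^ (d + 1)) ∧
      ∀ x ∈ frontier Ω ∩ ball (0 : Eu n) 1,
        |P x - ψ j x * q x| ≤ K' j * c * κ * ‖x‖ ^ ((d : ℝ) + 1 + ε) := by
    intro j
    by_cases hj : j < d
    · obtain ⟨P, h2, h3, h4⟩ := HK' j G hκ ((G.homB j hj).mul hq)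
      refine ⟨P, fun _ => ⟨h2, fun x => (h3 x).trans (le_of_eq (by ring)),
        fun x hx => (h4 x hx).trans (le_of_eq (by ring))⟩⟩
    · exact ⟨fun _ => 0, fun h => absurd h hj⟩
  choose P hP using hex
  have hE : EntHarm fun x => lin ν x * q x := ⟨(sm_lin ν).mul hq.sm, hl⟩
  refine ⟨fun x => lin ν x * q x - ∑ j ∈ Finset.range d, P j x,
    hE.sub (entHarm_sum fun j hj => (hP j (Finset.mem_range.1 hj)).1), fun x => ?_,
    fun x hx => ?_⟩
  · rw [sub_sub_cancel_left, abs_neg]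
    have h2 : |∑ j ∈ Finset.range d, P j x| ≤
        ∑ j ∈ Finset.range d, K' j * c * κ * (1 + ‖x‖) ^ (d + 1) :=
      (Finset.abs_sum_le_sum_abs _ _).trans
        (Finset.sum_le_sum fun j hj => (hP j (Finset.mem_range.1 hj)).2.1 x)
    rw [← Finset.sum_mul, ← Finset.sum_mul, ← Finset.sum_mul] at h2
    have h3 : 0 ≤ n ^ m * c * κ * (1 + ‖x‖) ^ (d + 1) := by positivity
    nlinarith
  · have ht := G.eq_of_mem_frontier x hx.2 hx.1
    have e1 : lin ν x * q x - ∑ j ∈ Finset.range d, P j x =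
        (Ψ x - ∑ j ∈ Finset.range d, ψ j x) * q x -
          ∑ j ∈ Finset.range d, (P j x - ψ j x * q x) := by
      rw [ht, Finset.sum_sub_distrib, ← Finset.sum_mul]; ring
    have hr : 0 ≤ ‖x‖ ^ ((d : ℝ) + 1 + ε) := Real.rpow_nonneg (norm_nonneg _) _
    dsimp only
    rw [e1]
    have h1 : |(Ψ x - ∑ j ∈ Finset.range d, ψ j x) * q x| ≤
        κ * ‖x‖ ^ ((d : ℝ) + 1 + ε) * (n ^ m * c) := by
      rw [abs_mul]
      exact mul_le_mul (G.near x hx.2) (hq.abs_le_pow hx.2) (abs_nonneg _) (by positivity)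
    have h2 : |∑ j ∈ Finset.range d, (P j x - ψ j x * q x)| ≤
        ∑ j ∈ Finset.range d, K' j * c * κ * ‖x‖ ^ ((d : ℝ) + 1 + ε) :=
      (Finset.abs_sum_le_sum_abs _ _).trans
        (Finset.sum_le_sum fun j hj => (hP j (Finset.mem_range.1 hj)).2.2 x hx)
    rw [← Finset.sum_mul, ← Finset.sum_mul, ← Finset.sum_mul] at h2
    have h4 := abs_sub ((Ψ x - ∑ j ∈ Finset.range d, ψ j x) * q x)
      (∑ j ∈ Finset.range d, (P j x - ψ j x * q x))
    nlinarith

end Correctors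

section Iteration

theorem IsGraphNear.mono {d : ℕ} {ε κ κ' : ℝ} {ν : Eu n} {Ψ : Eu n → ℝ} {ψ : ℕ → Eu n → ℝ}
    {Ω : Set (Eu n)} (G : IsGraphNear d ε κ ν Ψ ψ Ω) (h : κ ≤ κ') :
    IsGraphNear d ε κ' ν Ψ ψ Ω where
  norm_eq := G.norm_eq
  isOpen := G.isOpen
  nonneg := G.nonneg.trans h
  mem_iff := G.mem_iff
  eq_of_mem_frontier := G.eq_of_mem_frontier
  homB j hj := (G.homB j hj).mono h
  abs_le x hx := (G.abs_le x hx).trans (by gcongr)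
  near x hx := (G.near x hx).trans (by gcongr)

theorem smul_mem_ball {s : ℝ} (hs : 0 < s) {r : ℝ} {x : Eu n} :
    s • x ∈ ball (0 : Eu n) (s * r) ↔ x ∈ ball (0 : Eu n) r := by
  rw [mem_ball_zero_iff, mem_ball_zero_iff, norm_smul, Real.norm_of_nonneg hs.le,
    mul_lt_mul_iff_right₀ hs]

theorem frontier_smul_preimage {s : ℝ} (hs : s ≠ 0) (Ω : Set (Eu n)) :
    frontier ((fun x => s • x) ⁻¹' Ω) = (fun x => s • x) ⁻¹' frontier Ω :=
  ((Homeomorph.smulOfNeZero s hs).preimage_frontier Ω).symm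

theorem closure_smul_preimage {s : ℝ} (hs : s ≠ 0) (Ω : Set (Eu n)) :
    closure ((fun x => s • x) ⁻¹' Ω) = (fun x => s • x) ⁻¹' closure Ω :=
  ((Homeomorph.smulOfNeZero s hs).preimage_closure Ω).symm

theorem IsGraphNear.scale {d : ℕ} (hd : 1 ≤ d) {ε κ : ℝ} (hε : 0 < ε) {ν : Eu n} {Ψ : Eu n → ℝ}
    {ψ : ℕ → Eu n → ℝ} {Ω : Set (Eu n)} (G : IsGraphNear d ε κ ν Ψ ψ Ω) {s : ℝ} (hs : 0 < s)
    (hs1 : s ≤ 1) : IsGraphNear d ε (s * κ) ν (fun x => s⁻¹ * Ψ (s • x))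
      (fun j x => s ^ (j + 1) * ψ j x) ((fun x => s • x) ⁻¹' Ω) := by
  have hκ := G.nonneg
  have hb : ∀ x ∈ ball (0 : Eu n) 1, s • x ∈ ball (0 : Eu n) 1 := fun x hx =>
    ball_subset_ball (by simpa using hs1) ((smul_mem_ball hs).2 hx)
  refine ⟨G.norm_eq, G.isOpen.preimage (continuous_const_smul s), by positivity, fun x hx => ?_,
    fun x hx hf => ?_, fun j hj => ?_, fun x hx => ?_, fun x hx => ?_⟩
  · change s • x ∈ Ω ↔ _
    rw [G.mem_iff _ (hb x hx), lin_smul, lt_inv_mul_iff₀ hs]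
  · rw [frontier_smul_preimage hs.ne'] at hf
    have := G.eq_of_mem_frontier _ (hb x hx) hf
    rw [lin_smul] at this
    rw [← this, inv_mul_cancel_left₀ hs.ne']
  · refine ((G.homB j hj).const_mul _).mono ?_
    rw [abs_of_pos (by positivity)]
    gcongr
    calc s ^ (j + 1) ≤ s ^ 1 := pow_le_pow_of_le_one hs.le hs1 (by omega)
      _ = s := pow_one s
  · have := G.abs_le _ (hb x hx)
    rw [norm_smul, Real.norm_of_nonneg hs.le] at this
    rw [abs_mul, abs_of_pos (by positivity : 0 < s⁻¹)]
    calc s⁻¹ * |Ψ (s • x)| ≤ s⁻¹ * (κ * (s * ‖x‖) ^ 2) := by gcongr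
      _ = s * κ * ‖x‖ ^ 2 := by field_simp
  · have := G.near _ (hb x hx)
    have e : s⁻¹ * Ψ (s • x) - ∑ j ∈ Finset.range d, s ^ (j + 1) * ψ j x =
        s⁻¹ * (Ψ (s • x) - ∑ j ∈ Finset.range d, ψ j (s • x)) := by
      rw [mul_sub, Finset.mul_sum]
      congr 1
      refine Finset.sum_congr rfl fun j hj => ?_
      rw [(G.homB j (Finset.mem_range.1 hj)).smul_apply, pow_succ s (j + 1)]
      field_simp
    rw [e, abs_mul, abs_of_pos (by positivity : 0 < s⁻¹)]
    rw [norm_smul, Real.norm_of_nonneg hs.le, Real.mul_rpow hs.le (norm_nonneg _)] at this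
    have h2 : s ^ ((d : ℝ) + 1 + ε) ≤ s ^ 2 := by
      rw [← Real.rpow_natCast]
      refine Real.rpow_le_rpow_of_exponent_ge hs hs1 ?_
      have : (1 : ℝ) ≤ d := by exact_mod_cast hd
      push_cast; linarith
    have h3 : 0 ≤ ‖x‖ ^ ((d : ℝ) + 1 + ε) := Real.rpow_nonneg (norm_nonneg _) _
    calc _ ≤ s⁻¹ * (κ * (s ^ ((d : ℝ) + 1 + ε) * ‖x‖ ^ ((d : ℝ) + 1 + ε))) := by gcongr
      _ ≤ s⁻¹ * (κ * (s ^ 2 * ‖x‖ ^ ((d : ℝ) + 1 + ε))) := by gcongr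
      _ = s * κ * ‖x‖ ^ ((d : ℝ) + 1 + ε) := by field_simp

/-- One step of the approximation by harmonic polynomials at a boundary point. -/
theorem exists_approx_step (hn : 0 < n) (d : ℕ) {ε : ℝ} (hε1 : ε < 1) :
    ∃ ρ κ₀ C₀ : ℝ, 0 < ρ ∧ ρ < 1 ∧ 0 < κ₀ ∧ κ₀ ≤ 1 ∧ 0 < C₀ ∧
    ∀ {κ : ℝ} {ν : Eu n} {Ψ : Eu n → ℝ} {ψ : ℕ → Eu n → ℝ} {Ω : Set (Eu n)},
    IsGraphNear d ε κ ν Ψ ψ Ω → κ ≤ κ₀ → ∀ {u : Eu n → ℝ},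
    (∀ x ∈ Ω ∩ ball (0 : Eu n) 1, HarmAt u x) →
    ContinuousOn u (closure Ω ∩ ball (0 : Eu n) 1) →
    (∀ x ∈ Ω ∩ ball (0 : Eu n) 1, |u x| ≤ 1) →
    (∀ x ∈ frontier Ω ∩ ball (0 : Eu n) 1, |u x| ≤ κ₀) →
    ∃ P, EntHarm P ∧ (∀ x, |P x| ≤ C₀ * (1 + ‖x‖) ^ (d + 1)) ∧
      (∀ x ∈ frontier Ω ∩ ball (0 : Eu n) 1, |P x| ≤ C₀ * κ * ‖x‖ ^ ((d : ℝ) + 1 + ε)) ∧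
      ∀ x ∈ Ω ∩ ball (0 : Eu n) ρ, |u x - P x| ≤ ρ ^ ((d : ℝ) + 1 + ε) := by
  have hn' : (0 : ℝ) < n := by exact_mod_cast hn
  obtain ⟨C, hC, HC⟩ := exists_odd_truncation hn (d + 1)
  choose K hK HK using exists_lin_mul_corrector hn d hε1.le
  set S := ∑ m ∈ Finset.range (d + 1), K m * C with hS
  have hS0 : 0 ≤ S := Finset.sum_nonneg fun m _ => mul_nonneg (hK m) hC.le
  obtain ⟨ρ, hρ0, hρ4, hρ⟩ : ∃ ρ : ℝ, 0 < ρ ∧ ρ ≤ 1 / 4 ∧ C * ρ ^ (1 - ε) ≤ 1 / 2 := by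
    have h1 : Filter.Tendsto (fun ρ : ℝ => C * ρ ^ (1 - ε)) (nhds 0) (nhds (C * 0 ^ (1 - ε))) :=
      ((Real.continuous_rpow_const (by linarith)).const_mul C).tendsto 0 |>.congr fun _ => rfl
    rw [Real.zero_rpow (by linarith), mul_zero] at h1
    have h2 := h1.mono_left (nhdsWithin_le_nhds (s := Ioi (0:ℝ)))
    have h3 := (h2.eventually_le_const (show (0 : ℝ) < 1 / 2 by norm_num)).and
      (Ioc_mem_nhdsGT (show (0 : ℝ) < 1 / 4 by norm_num))
    obtain ⟨ρ, h4, h5⟩ := h3.exists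
    exact ⟨ρ, h5.1, h5.2, h4⟩
  set σ := (d : ℝ) + 1 + ε with hσ
  have hρσ : 0 < ρ ^ σ := Real.rpow_pos_of_pos hρ0 _
  set A := 24 * (n : ℝ) + 30 + S * 2 ^ (d + 1) with hA
  have hA0 : 0 < A := by positivity
  refine ⟨ρ, min 1 (ρ ^ σ / (2 * A)), S + (d + 1) * (n ^ (d + 1) * C), hρ0, by linarith,
    lt_min one_pos (by positivity), min_le_left _ _, by positivity,
    fun {κ ν Ψ ψ Ω} G hκ {u} hu hc hu1 hu0 => ?_⟩
  set κ₀ := min 1 (ρ ^ σ / (2 * A)) with hκ₀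
  have hκ₀0 : 0 < κ₀ := lt_min one_pos (by positivity)
  have hκ₀1 : κ₀ ≤ 1 := min_le_left _ _
  have hκ0 := G.nonneg
  have hsq : ∀ x ∈ ball (0 : Eu n) 1, |Ψ x| < κ₀ := by
    intro x hx
    have h1 : ‖x‖ < 1 := mem_ball_zero_iff.1 hx
    calc |Ψ x| ≤ κ * ‖x‖ ^ 2 := G.abs_le x hx
      _ ≤ κ₀ * ‖x‖ ^ 2 := by gcongr
      _ < κ₀ * 1 := by
        gcongr
        nlinarith [norm_nonneg x]
      _ = κ₀ := mul_one _
  have hcl : ∀ x, x ∈ closure Ω → x ∈ Ω ∨ x ∈ frontier Ω := fun x hx => by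
    by_cases h : x ∈ Ω
    · exact Or.inl h
    · exact Or.inr (G.isOpen.frontier_eq ▸ ⟨hx, h⟩)
  obtain ⟨h, hp, hl, ho, hb3, hnear⟩ := exists_odd_harm_near hn G.norm_eq hκ₀0 hκ₀1 G.isOpen
    (fun x hx => by
      have h1 := (abs_lt.1 (hsq x hx.2)).2
      rcases hcl x hx.1 with h | h
      · have := (G.mem_iff x hx.2).1 h; linarith
      · have := G.eq_of_mem_frontier x hx.2 h; linarith)
    (fun x hx h => (G.mem_iff x hx).2 (by have := (abs_lt.1 (hsq x hx)).1; linarith))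
    hu hc
    (fun x hx => (hcl x hx.1).elim (fun h => hu1 x ⟨h, hx.2⟩)
      fun h => (hu0 x ⟨h, hx.2⟩).trans hκ₀1) hu0
  obtain ⟨q, hq, hql, hqn⟩ := HC ν G.norm_eq h hp hl ho hb3
  have hex : ∀ m, ∃ P, m < d + 1 → EntHarm P ∧
      (∀ x, |P x - lin ν x * q m x| ≤ K m * C * κ * (1 + ‖x‖) ^ (d + 1)) ∧
      ∀ x ∈ frontier Ω ∩ ball (0 : Eu n) 1, |P x| ≤ K m * C * κ * ‖x‖ ^ σ := by
    intro m
    by_cases hm : m < d + 1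
    · obtain ⟨P, hP⟩ := HK m G (hκ.trans hκ₀1) (hq m hm) (hql m hm)
      exact ⟨P, fun _ => hP⟩
    · exact ⟨fun _ => 0, fun h => absurd h hm⟩
  choose P hP using hex
  have hd : ∀ x, |∑ m ∈ Finset.range (d + 1), P m x -
      ∑ m ∈ Finset.range (d + 1), lin ν x * q m x| ≤ S * κ * (1 + ‖x‖) ^ (d + 1) := by
    intro x
    rw [← Finset.sum_sub_distrib, hS, Finset.sum_mul, Finset.sum_mul]
    exact (Finset.abs_sum_le_sum_abs _ _).trans
      (Finset.sum_le_sum fun m hm => (hP m (Finset.mem_range.1 hm)).2.1 x)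
  refine ⟨fun x => ∑ m ∈ Finset.range (d + 1), P m x,
    entHarm_sum fun m hm => (hP m (Finset.mem_range.1 hm)).1, fun x => ?_, fun x hx => ?_,
    fun x hx => ?_⟩
  · have h1 : |∑ m ∈ Finset.range (d + 1), lin ν x * q m x| ≤
        ∑ m ∈ Finset.range (d + 1), n ^ (d + 1) * C * (1 + ‖x‖) ^ (d + 1) := by
      refine (Finset.abs_sum_le_sum_abs _ _).trans (Finset.sum_le_sum fun m hm => ?_)
      have h2 : HomB (1 + m) (1 * C) (fun x => lin ν x * q m x) :=
        (HomB.lin G.norm_eq.le).mul (hq m (Finset.mem_range.1 hm))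
      rw [one_mul] at h2
      exact h2.abs_le_one_add (by have := Finset.mem_range.1 hm; omega) hn x
    rw [Finset.sum_const, Finset.card_range, nsmul_eq_mul] at h1
    push_cast at h1
    have h2 := hd x
    have h3 : S * κ * (1 + ‖x‖) ^ (d + 1) ≤ S * 1 * (1 + ‖x‖) ^ (d + 1) := by
      gcongr; exact hκ.trans hκ₀1
    have h4 := abs_sub_abs_le_abs_sub (∑ m ∈ Finset.range (d + 1), P m x)
      (∑ m ∈ Finset.range (d + 1), lin ν x * q m x)
    nlinarith
  · have h1 : |∑ m ∈ Finset.range (d + 1), P m x| ≤ S * κ * ‖x‖ ^ σ := by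
      rw [hS, Finset.sum_mul, Finset.sum_mul]
      exact (Finset.abs_sum_le_sum_abs _ _).trans
        (Finset.sum_le_sum fun m hm => (hP m (Finset.mem_range.1 hm)).2.2 x hx)
    refine h1.trans ?_
    have : 0 ≤ ‖x‖ ^ σ := Real.rpow_nonneg (norm_nonneg _) _
    gcongr
    have : 0 ≤ ((d : ℝ) + 1) * (n ^ (d + 1) * C) := by positivity
    linarith
  · have hxρ : ‖x‖ < ρ := mem_ball_zero_iff.1 hx.2
    have h1 := hnear x ⟨hx.1, ball_subset_ball (by linarith) hx.2⟩
    have h2 := hqn x (ball_subset_ball hρ4 hx.2)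
    have h3 : S * κ * (1 + ‖x‖) ^ (d + 1) ≤ S * κ₀ * 2 ^ (d + 1) := by
      gcongr; linarith
    have h4 := hd x
    have h5 : C * ‖x‖ ^ (d + 1 + 1) ≤ ρ ^ σ / 2 := by
      have e : ρ ^ (d + 1 + 1) = ρ ^ (1 - ε) * ρ ^ σ := by
        rw [← Real.rpow_add hρ0, ← Real.rpow_natCast]
        congr 1
        push_cast; rw [hσ]; ring
      calc C * ‖x‖ ^ (d + 1 + 1) ≤ C * ρ ^ (d + 1 + 1) := by gcongr
        _ = C * ρ ^ (1 - ε) * ρ ^ σ := by rw [e]; ring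
        _ ≤ 1 / 2 * ρ ^ σ := by gcongr
        _ = ρ ^ σ / 2 := by ring
    have h6 : A * κ₀ ≤ ρ ^ σ / 2 := by
      calc A * κ₀ ≤ A * (ρ ^ σ / (2 * A)) := by gcongr; exact min_le_right _ _
        _ = ρ ^ σ / 2 := by field_simp
    have h7 : A * κ₀ = (24 * n + 30) * κ₀ + S * κ₀ * 2 ^ (d + 1) := by rw [hA]; ring
    rw [abs_le] at *
    constructor <;> linarith

end Iteration

section BoundaryEstimate

theorem pdMulti_add_harm (hn : 0 < n) {u v : Eu n → ℝ} {O : Set (Eu n)} (hO : IsOpen O)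
    (hu : ∀ x ∈ O, HarmAt u x) (hv : ∀ x ∈ O, HarmAt v x) (L : List (Fin n)) :
    ∀ x ∈ O, pdMulti L (fun y => u y + v y) x = pdMulti L u x + pdMulti L v x := by
  induction L with
  | nil => exact fun x _ => rfl
  | cons i L ih =>
    intro x hx
    have h : pdMulti L (fun y => u y + v y) =ᶠ[nhds x] fun y => pdMulti L u y + pdMulti L v y := by
      filter_upwards [hO.mem_nhds hx] with y hy using ih y hy
    exact (pd_congr h).trans (pd_add (harmAt_pdMulti hn hO hu L x hx).differentiableAt
      (harmAt_pdMulti hn hO hv L x hx).differentiableAt)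

theorem pdMulti_const_mul_harm (hn : 0 < n) {u : Eu n → ℝ} {O : Set (Eu n)} (hO : IsOpen O)
    (hu : ∀ x ∈ O, HarmAt u x) (c : ℝ) (L : List (Fin n)) :
    ∀ x ∈ O, pdMulti L (fun y => c * u y) x = c * pdMulti L u x := by
  induction L with
  | nil => exact fun x _ => rfl
  | cons i L ih =>
    intro x hx
    have h : pdMulti L (fun y => c * u y) =ᶠ[nhds x] fun y => c * pdMulti L u y := by
      filter_upwards [hO.mem_nhds hx] with y hy using ih y hy
    exact (pd_congr h).trans (pd_const_mul c (harmAt_pdMulti hn hO hu L x hx).differentiableAt)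

theorem pdMulti_sub_harm (hn : 0 < n) {u v : Eu n → ℝ} {O : Set (Eu n)} (hO : IsOpen O)
    (hu : ∀ x ∈ O, HarmAt u x) (hv : ∀ x ∈ O, HarmAt v x) (L : List (Fin n)) :
    ∀ x ∈ O, pdMulti L (fun y => u y - v y) x = pdMulti L u x - pdMulti L v x := by
  intro x hx
  have h := pdMulti_add_harm hn hO hu (fun y hy => (hv y hy).const_mul (-1)) L x hx
  rw [pdMulti_const_mul_harm hn hO hv (-1) L x hx] at h
  simpa [sub_eq_add_neg] using h

theorem pdMulti_comp_affine_harm (hn : 0 < n) {u : Eu n → ℝ} {O : Set (Eu n)} (hO : IsOpen O)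
    (hu : ∀ x ∈ O, HarmAt u x) (a : Eu n) (r : ℝ) (L : List (Fin n)) :
    ∀ x, a + r • x ∈ O →
      pdMulti L (fun y => u (a + r • y)) x = r ^ L.length * pdMulti L u (a + r • x) := by
  have hO' : IsOpen ((fun y : Eu n => a + r • y) ⁻¹' O) := hO.preimage (continuous_affine a r)
  induction L with
  | nil => intro x _; simp [pdMulti]
  | cons i L ih =>
    intro x hx
    have hd := (harmAt_pdMulti hn hO hu L _ hx)
    have h : pdMulti L (fun y => u (a + r • y)) =ᶠ[nhds x]
        fun y => r ^ L.length * pdMulti L u (a + r • y) := by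
      filter_upwards [hO'.mem_nhds hx] with y hy using ih y hy
    refine (pd_congr h).trans ?_
    rw [pd_const_mul _ hd.comp_affine.differentiableAt, pd_comp_affine hd.differentiableAt]
    simp only [pdMulti, List.length_cons]
    ring

/-- Harmonic polynomials approximating, at all scales, a harmonic function which vanishes on a
piece of the boundary. -/
theorem exists_approx_iter {d : ℕ} {ε : ℝ} (hd : 1 ≤ d) (hε0 : 0 < ε) {ρ κ₀ C₀ : ℝ} (hρ0 : 0 < ρ)
    (hρ1 : ρ < 1) (hC₀ : 0 < C₀)
    (step : ∀ {κ : ℝ} {ν : Eu n} {Ψ : Eu n → ℝ} {ψ : ℕ → Eu n → ℝ} {Ω : Set (Eu n)},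
      IsGraphNear d ε κ ν Ψ ψ Ω → κ ≤ κ₀ → ∀ {u : Eu n → ℝ},
      (∀ x ∈ Ω ∩ ball (0 : Eu n) 1, HarmAt u x) →
      ContinuousOn u (closure Ω ∩ ball (0 : Eu n) 1) →
      (∀ x ∈ Ω ∩ ball (0 : Eu n) 1, |u x| ≤ 1) →
      (∀ x ∈ frontier Ω ∩ ball (0 : Eu n) 1, |u x| ≤ κ₀) →
      ∃ P, EntHarm P ∧ (∀ x, |P x| ≤ C₀ * (1 + ‖x‖) ^ (d + 1)) ∧
        (∀ x ∈ frontier Ω ∩ ball (0 : Eu n) 1, |P x| ≤ C₀ * κ * ‖x‖ ^ ((d : ℝ) + 1 + ε)) ∧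
        ∀ x ∈ Ω ∩ ball (0 : Eu n) ρ, |u x - P x| ≤ ρ ^ ((d : ℝ) + 1 + ε))
    {κ : ℝ} (hκ : κ ≤ κ₀) (hκ' : C₀ * κ * (1 - ρ)⁻¹ ≤ κ₀)
    {ν : Eu n} {Ψ : Eu n → ℝ} {ψ : ℕ → Eu n → ℝ} {Ω : Set (Eu n)}
    (G : IsGraphNear d ε κ ν Ψ ψ Ω) {u : Eu n → ℝ}
    (hu : ∀ x ∈ Ω ∩ ball (0 : Eu n) 1, HarmAt u x)
    (hc : ContinuousOn u (closure Ω ∩ ball (0 : Eu n) 1))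
    (hu1 : ∀ x ∈ Ω ∩ ball (0 : Eu n) 1, |u x| ≤ 1)
    (hu0 : ∀ x ∈ frontier Ω ∩ ball (0 : Eu n) 1, u x = 0) (j : ℕ) :
    ∃ P, EntHarm P ∧
      (∀ x, |P x| ≤ C₀ * (∑ i ∈ Finset.range j, (ρ ^ ε) ^ i) * (1 + ‖x‖) ^ (d + 1)) ∧
      (∀ x ∈ frontier Ω ∩ ball (0 : Eu n) (ρ ^ j),
        |P x| ≤ C₀ * κ * (∑ i ∈ Finset.range j, ρ ^ i) * ‖x‖ ^ ((d : ℝ) + 1 + ε)) ∧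
      ∀ x ∈ Ω ∩ ball (0 : Eu n) (ρ ^ j), |u x - P x| ≤ (ρ ^ j) ^ ((d : ℝ) + 1 + ε) := by
  have hκ0 := G.nonneg
  have hσ0 : 0 ≤ (d : ℝ) + 1 + ε := by positivity
  induction j with
  | zero =>
    refine ⟨fun _ => 0, entHarm_zero, fun x => by simp, fun x _ => by simp, fun x hx => ?_⟩
    simpa using hu1 x (by simpa using hx)
  | succ j ih =>
    obtain ⟨P, hP, hP1, hP2, hP3⟩ := ih
    set s := ρ ^ j with hs
    have hs0 : 0 < s := pow_pos hρ0 j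
    have hs1 : s ≤ 1 := pow_le_one₀ hρ0.le hρ1.le
    set σ := (d : ℝ) + 1 + ε with hσ
    have hsσ : 0 < s ^ σ := Real.rpow_pos_of_pos hs0 _
    have hmem : ∀ x ∈ ball (0 : Eu n) 1, s • x ∈ ball (0 : Eu n) s := fun x hx => by
      simpa using (smul_mem_ball hs0).2 hx
    have hmem' : ∀ {r : ℝ}, ∀ x ∈ ball (0 : Eu n) (s * r), s⁻¹ • x ∈ ball (0 : Eu n) r :=
      fun {r} x hx => by
        have : s • (s⁻¹ • x) ∈ ball (0 : Eu n) (s * r) := by rwa [smul_inv_smul₀ hs0.ne']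
        exact (smul_mem_ball hs0).1 this
    have hss : ball (0 : Eu n) s ⊆ ball 0 1 := ball_subset_ball hs1
    have hgeom : ∑ i ∈ Finset.range j, ρ ^ i ≤ (1 - ρ)⁻¹ := by
      rw [← tsum_geometric_of_lt_one hρ0.le hρ1]
      exact (summable_geometric_of_lt_one hρ0.le hρ1).sum_le_tsum _ fun i _ => by positivity
    have hG := G.scale hd hε0 hs0 hs1
    obtain ⟨p, hp, hp1, hp2, hp3⟩ := step hG
      ((mul_le_of_le_one_left hκ0 hs1).trans hκ)
      (u := fun x => (s ^ σ)⁻¹ * (u (s • x) - P (s • x)))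
      (fun x hx => by
        have h1 : HarmAt (fun y => u (0 + s • y)) x := HarmAt.comp_affine (by
          rw [zero_add]; exact hu _ ⟨hx.1, hss (hmem x hx.2)⟩)
        have h2 : HarmAt (fun y => P (0 + s • y)) x := (hP.comp_affine 0 s).harmAt x
        simpa only [zero_add] using (h1.sub h2).const_mul (s ^ σ)⁻¹)
      (by
        refine continuousOn_const.mul (ContinuousOn.sub ?_ ?_)
        · refine hc.comp (continuous_const_smul s).continuousOn fun x hx => ?_
          rw [closure_smul_preimage hs0.ne'] at hx
          exact ⟨hx.1, hss (hmem x hx.2)⟩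
        · exact (hP.1.continuous.comp (continuous_const_smul s)).continuousOn)
      (fun x hx => by
        rw [abs_mul, abs_of_pos (inv_pos.2 hsσ), inv_mul_le_one₀ hsσ]
        exact hP3 _ ⟨hx.1, hmem x hx.2⟩)
      (fun x hx => by
        rw [frontier_smul_preimage hs0.ne'] at hx
        have h1 := hP2 (s • x) ⟨hx.1, hmem x hx.2⟩
        have hx1 : ‖x‖ ≤ 1 := (mem_ball_zero_iff.1 hx.2).le
        rw [hu0 _ ⟨hx.1, hss (hmem x hx.2)⟩, zero_sub, abs_mul, abs_neg,
          abs_of_pos (inv_pos.2 hsσ), inv_mul_le_iff₀ hsσ]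
        rw [norm_smul, Real.norm_of_nonneg hs0.le, Real.mul_rpow hs0.le (norm_nonneg _)] at h1
        have h2 : ‖x‖ ^ σ ≤ 1 := Real.rpow_le_one (norm_nonneg _) hx1 hσ0
        calc _ ≤ C₀ * κ * (∑ i ∈ Finset.range j, ρ ^ i) * (s ^ σ * ‖x‖ ^ σ) := h1
          _ ≤ C₀ * κ * (1 - ρ)⁻¹ * (s ^ σ * 1) := by gcongr
          _ ≤ κ₀ * (s ^ σ * 1) := by gcongr
          _ = s ^ σ * κ₀ := by ring)
    refine ⟨fun x => P x + s ^ σ * p (s⁻¹ • x), hP.add (EntHarm.const_mul ?_ _),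
      fun x => ?_, fun x hx => ?_, fun x hx => ?_⟩
    · simpa using hp.comp_affine 0 s⁻¹
    · have h1 : |s ^ σ * p (s⁻¹ • x)| ≤ C₀ * (ρ ^ ε) ^ j * (1 + ‖x‖) ^ (d + 1) := by
        rw [abs_mul, abs_of_pos hsσ]
        have h2 := hp1 (s⁻¹ • x)
        rw [norm_smul, Real.norm_of_nonneg (inv_pos.2 hs0).le] at h2
        have e : s ^ σ = s ^ (d + 1) * (ρ ^ ε) ^ j := by
          have e1 : s ^ ((d : ℝ) + 1) = s ^ (d + 1) := by
            rw [← Real.rpow_natCast]; push_cast; rfl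
          have e2 : s ^ ε = (ρ ^ ε) ^ j := by
            rw [hs, ← Real.rpow_natCast ρ, ← Real.rpow_natCast (ρ ^ ε), ← Real.rpow_mul hρ0.le,
              ← Real.rpow_mul hρ0.le, mul_comm]
          rw [hσ, Real.rpow_add hs0, e1, e2]
        have h3 : 1 ≤ s⁻¹ := (one_le_inv₀ hs0).2 hs1
        calc s ^ σ * |p (s⁻¹ • x)| ≤ s ^ σ * (C₀ * (1 + s⁻¹ * ‖x‖) ^ (d + 1)) := by gcongr
          _ ≤ s ^ σ * (C₀ * (s⁻¹ * 1 + s⁻¹ * ‖x‖) ^ (d + 1)) := by gcongr; linarith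
          _ = (s * s⁻¹) ^ (d + 1) * (C₀ * (ρ ^ ε) ^ j * (1 + ‖x‖) ^ (d + 1)) := by
            rw [e, ← mul_add, mul_pow, mul_pow]; ring
          _ = _ := by rw [mul_inv_cancel₀ hs0.ne', one_pow, one_mul]
      rw [Finset.sum_range_succ]
      calc _ ≤ |P x| + |s ^ σ * p (s⁻¹ • x)| := abs_add_le _ _
        _ ≤ _ := add_le_add (hP1 x) h1
        _ = _ := by ring
    · have hxs : x ∈ ball (0 : Eu n) (s * 1) := by
        refine ball_subset_ball ?_ hx.2
        rw [pow_succ]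
        gcongr
      have h1 : |s ^ σ * p (s⁻¹ • x)| ≤ C₀ * κ * ρ ^ j * ‖x‖ ^ σ := by
        have h2 := hp2 (s⁻¹ • x) ⟨by
          rw [frontier_smul_preimage hs0.ne']
          rw [mem_preimage, smul_inv_smul₀ hs0.ne']; exact hx.1, hmem' x hxs⟩
        rw [norm_smul, Real.norm_of_nonneg (inv_pos.2 hs0).le,
          Real.mul_rpow (inv_pos.2 hs0).le (norm_nonneg _), Real.inv_rpow hs0.le] at h2
        rw [abs_mul, abs_of_pos hsσ]
        calc s ^ σ * |p (s⁻¹ • x)| ≤ s ^ σ * (C₀ * (s * κ) * ((s ^ σ)⁻¹ * ‖x‖ ^ σ)) := by gcongr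
          _ = _ := by rw [← hs]; field_simp
      rw [Finset.sum_range_succ]
      calc _ ≤ |P x| + |s ^ σ * p (s⁻¹ • x)| := abs_add_le _ _
        _ ≤ _ := add_le_add (hP2 x ⟨hx.1, by simpa using hxs⟩) h1
        _ = _ := by ring
    · have h2 := hp3 (s⁻¹ • x) ⟨by
          rw [mem_preimage, smul_inv_smul₀ hs0.ne']; exact hx.1, hmem' x (by rw [← pow_succ]; exact hx.2)⟩
      rw [smul_inv_smul₀ hs0.ne'] at h2
      have e : u x - (P x + s ^ σ * p (s⁻¹ • x)) =
          s ^ σ * ((s ^ σ)⁻¹ * (u x - P x) - p (s⁻¹ • x)) := by field_simp; ring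
      rw [e, abs_mul, abs_of_pos hsσ, pow_succ, ← hs, Real.mul_rpow hs0.le hρ0.le]
      gcongr

/-- Derivatives up to order `d + 1` of a harmonic function which vanishes on a nearly flat piece of
the boundary of class `C ^ (d + 1, ε)`. -/
theorem exists_boundary_estimate (hn : 0 < n) {d : ℕ} (hd : 1 ≤ d) {ε : ℝ} (hε0 : 0 < ε)
    (hε1 : ε < 1) : ∃ κ C : ℝ, 0 < κ ∧ 0 < C ∧
    ∀ {ν : Eu n} {Ψ : Eu n → ℝ} {ψ : ℕ → Eu n → ℝ} {Ω : Set (Eu n)},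
    IsGraphNear d ε κ ν Ψ ψ Ω → ∀ {u : Eu n → ℝ},
    (∀ x ∈ Ω ∩ ball (0 : Eu n) 1, HarmAt u x) →
    ContinuousOn u (closure Ω ∩ ball (0 : Eu n) 1) →
    (∀ x ∈ Ω ∩ ball (0 : Eu n) 1, |u x| ≤ 1) →
    (∀ x ∈ frontier Ω ∩ ball (0 : Eu n) 1, u x = 0) →
    ∀ x, x ≠ 0 → ‖x‖ ≤ 1 / 4 → ball x ‖x‖ ⊆ Ω → ∀ L : List (Fin n), L.length ≤ d + 1 →
      |pdMulti L u x| ≤ C := by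
  obtain ⟨ρ, κ₀, C₀, hρ0, hρ1, hκ₀, -, hC₀, step⟩ := exists_approx_step (n := n) hn d hε1
  obtain ⟨C₁, hC₁, int⟩ := interior_estimate_le hn (d + 1)
  have hρε : ρ ^ ε < 1 := Real.rpow_lt_one hρ0.le hρ1 hε0
  have hρε0 : 0 < ρ ^ ε := Real.rpow_pos_of_pos hρ0 _
  have h1ρ : 0 < 1 - ρ := by linarith
  have h1ρε : 0 < 1 - ρ ^ ε := by linarith
  set σ := (d : ℝ) + 1 + ε with hσ
  have hσ0 : 0 ≤ σ := by positivity
  refine ⟨min κ₀ (κ₀ * (1 - ρ) / C₀),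
    C₁ * (2 / ρ) ^ σ + C₁ * (C₀ * (1 - ρ ^ ε)⁻¹ * 3 ^ (d + 1)),
    lt_min hκ₀ (by positivity), by positivity,
    fun {ν Ψ ψ Ω} G {u} hu hc hu1 hu0 x hx0 hx4 hxΩ L hL => ?_⟩
  have hκ' : C₀ * min κ₀ (κ₀ * (1 - ρ) / C₀) * (1 - ρ)⁻¹ ≤ κ₀ := by
    calc _ ≤ C₀ * (κ₀ * (1 - ρ) / C₀) * (1 - ρ)⁻¹ := by gcongr; exact min_le_right _ _
      _ = κ₀ := by field_simp
  have hx := norm_pos_iff.2 hx0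
  obtain ⟨j, hj1, hj2⟩ := exists_nat_pow_near_of_lt_one (x := 2 * ‖x‖) (by positivity)
    (by linarith) hρ0 hρ1
  obtain ⟨P, hP, hP1, -, hP3⟩ := exists_approx_iter hd hε0 hρ0 hρ1 hC₀ step
    (min_le_left _ _) hκ' G hu hc hu1 hu0 j
  have hρj : ρ ^ j ≤ 1 := pow_le_one₀ hρ0.le hρ1.le
  have hsub : ball x ‖x‖ ⊆ Ω ∩ ball (0 : Eu n) (ρ ^ j) := fun y hy => ⟨hxΩ hy, by
    rw [mem_ball, dist_eq_norm] at hy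
    rw [mem_ball_zero_iff]
    have := norm_add_le (y - x) x
    rw [sub_add_cancel] at this
    linarith⟩
  have hsub1 : ball x ‖x‖ ⊆ Ω ∩ ball (0 : Eu n) 1 := fun y hy =>
    ⟨(hsub hy).1, ball_subset_ball hρj (hsub hy).2⟩
  have h1 := int (fun y => u y - P y) x ‖x‖ _ hx (fun y hy => (hu y (hsub1 hy)).sub (hP.harmAt y))
    (fun y hy => hP3 y (hsub hy)) L hL
  have hgeom : ∑ i ∈ Finset.range j, (ρ ^ ε) ^ i ≤ (1 - ρ ^ ε)⁻¹ := by
    rw [← tsum_geometric_of_lt_one hρε0.le hρε]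
    exact (summable_geometric_of_lt_one hρε0.le hρε).sum_le_tsum _ fun i _ => by positivity
  have h2 := int P x 1 (C₀ * (1 - ρ ^ ε)⁻¹ * 3 ^ (d + 1)) one_pos (fun y _ => hP.harmAt y)
    (fun y hy => by
      refine (hP1 y).trans ?_
      have hy1 : 1 + ‖y‖ ≤ 3 := by
        rw [mem_ball, dist_eq_norm] at hy
        have := norm_add_le (y - x) x
        rw [sub_add_cancel] at this
        linarith
      gcongr) L hL
  rw [pdMulti_sub_harm hn isOpen_ball (fun y hy => hu y (hsub1 hy)) (fun y _ => hP.harmAt y) L x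
    (mem_ball_self hx)] at h1
  rw [one_pow, div_one] at h2
  have h3 : C₁ / ‖x‖ ^ L.length * (ρ ^ j) ^ σ ≤ C₁ * (2 / ρ) ^ σ := by
    have h4 : ρ ^ j ≤ 2 / ρ * ‖x‖ := by
      rw [div_mul_eq_mul_div, le_div_iff₀ hρ0, ← pow_succ]
      exact hj1.le
    have h5 : ‖x‖ ^ σ ≤ ‖x‖ ^ L.length := by
      rw [← Real.rpow_natCast]
      refine Real.rpow_le_rpow_of_exponent_ge hx (by linarith) ?_
      have : (L.length : ℝ) ≤ (d : ℝ) + 1 := by exact_mod_cast hL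
      linarith
    calc C₁ / ‖x‖ ^ L.length * (ρ ^ j) ^ σ
        ≤ C₁ / ‖x‖ ^ L.length * (2 / ρ * ‖x‖) ^ σ := by gcongr
      _ = C₁ / ‖x‖ ^ L.length * ((2 / ρ) ^ σ * ‖x‖ ^ σ) := by
        rw [Real.mul_rpow (by positivity) hx.le]
      _ ≤ C₁ / ‖x‖ ^ L.length * ((2 / ρ) ^ σ * ‖x‖ ^ L.length) := by gcongr
      _ = _ := by field_simp
  have h6 := abs_add_le (pdMulti L u x - pdMulti L P x) (pdMulti L P x)
  rw [sub_add_cancel] at h6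
  linarith

end BoundaryEstimate


section Charts

theorem homB_diag {j : ℕ} (M : ContinuousMultilinearMap ℝ (fun _ : Fin j => Eu n) ℝ) :
    HomB j ‖M‖ (fun x => M fun _ => x) := by
  induction j with
  | zero =>
    refine ⟨M 0, by
      have := M.le_opNorm 0
      rwa [Finset.univ_eq_empty, Finset.prod_empty, mul_one, Real.norm_eq_abs] at this, ?_⟩
    funext x
    congr 1
    exact Subsingleton.elim _ _
  | succ j ih =>
    refine ⟨norm_nonneg _, fun i x => M.curryLeft (EuclideanSpace.single i 1) fun _ => x,
      fun i => (ih _).mono ?_, ?_⟩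
    · refine (M.curryLeft.le_opNorm _).trans ?_
      rw [ContinuousMultilinearMap.curryLeft_norm]
      simp
    · funext x
      have h1 : M (fun _ => x) = M.curryLeft x fun _ => x := by
        rw [ContinuousMultilinearMap.curryLeft_apply]
        congr 1
        funext i
        refine Fin.cases ?_ (fun _ => ?_) i <;> simp
      rw [h1]
      conv_lhs => rw [← sum_single x]
      rw [map_sum, sum_apply]
      simp [sum_single]

theorem iteratedDeriv_line {m : ℕ} {g : Eu n → ℝ} (hg : ContDiff ℝ m g) (z h : Eu n) {j : ℕ}
    (hj : j ≤ m) (t : ℝ) : iteratedDeriv j (fun t : ℝ => g (z + t • h)) t =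
      iteratedFDeriv ℝ j g (z + t • h) (fun _ => h) := by
  have h1 : ContDiff ℝ m fun x => g (z + x) := hg.comp (contDiff_const.add contDiff_id)
  have h2 := (ContinuousLinearMap.toSpanSingleton ℝ h).iteratedFDeriv_comp_right h1 t
    (i := j) (by exact_mod_cast hj)
  have h3 : (fun t : ℝ => g (z + t • h)) =
      (fun x => g (z + x)) ∘ ContinuousLinearMap.toSpanSingleton ℝ h := by
    funext t; simp [ContinuousLinearMap.toSpanSingleton_apply]
  rw [iteratedDeriv_eq_iteratedFDeriv, h3, h2, iteratedFDeriv_comp_add_left]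
  simp [ContinuousLinearMap.toSpanSingleton_apply]

theorem abs_taylor_le {m : ℕ} {H e : ℝ≥0} {g : Eu n → ℝ} (hg : ContDiff ℝ (m + 1 : ℕ) g)
    (hH : HolderWith H e (iteratedFDeriv ℝ (m + 1) g)) (z h : Eu n) :
    |g (z + h) - ∑ j ∈ Finset.range (m + 2),
      ((Nat.factorial j : ℝ))⁻¹ * iteratedFDeriv ℝ j g z (fun _ => h)| ≤
      H * ‖h‖ ^ (e : ℝ) * ‖h‖ ^ (m + 1) := by
  set φ : ℝ → ℝ := fun t => g (z + t • h) with hφ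
  have hφc : ContDiff ℝ (m + 1 : ℕ) φ := hg.comp (by fun_prop)
  obtain ⟨t, ht, e1⟩ := taylor_mean_remainder_lagrange_iteratedDeriv (f := φ) (x₀ := 0) (x := 1)
    (n := m) zero_ne_one (by exact_mod_cast hφc.contDiffOn)
  rw [uIoo_of_lt zero_lt_one] at ht
  have hu : UniqueDiffOn ℝ (uIcc (0 : ℝ) 1) := uniqueDiffOn_uIcc zero_ne_one
  have e2 : taylorWithinEval φ m (uIcc (0 : ℝ) 1) 0 1 = ∑ j ∈ Finset.range (m + 1),
      ((Nat.factorial j : ℝ))⁻¹ * iteratedFDeriv ℝ j g z (fun _ => h) := by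
    rw [taylor_within_apply]
    refine Finset.sum_congr rfl fun j hj => ?_
    have hj' : j ≤ m + 1 := (Finset.mem_range.1 hj).le
    rw [iteratedDerivWithin_eq_iteratedDeriv hu
      ((hφc.of_le (by exact_mod_cast hj')).contDiffAt) (by simp), iteratedDeriv_line hg z h hj']
    simp
  rw [Finset.sum_range_succ, ← e2]
  have e3 : φ 1 = g (z + h) := by simp [hφ]
  rw [e3] at e1
  rw [← sub_sub, e1, iteratedDeriv_line hg z h le_rfl]
  have h1 : |iteratedFDeriv ℝ (m + 1) g (z + t • h) (fun _ => h) -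
      iteratedFDeriv ℝ (m + 1) g z (fun _ => h)| ≤ H * ‖h‖ ^ (e : ℝ) * ‖h‖ ^ (m + 1) := by
    have h2 := hH.dist_le (z + t • h) z
    rw [dist_eq_norm, dist_eq_norm, add_sub_cancel_left, norm_smul,
      Real.norm_of_nonneg ht.1.le] at h2
    have h3 := (iteratedFDeriv ℝ (m + 1) g (z + t • h) - iteratedFDeriv ℝ (m + 1) g z).le_opNorm
      fun _ => h
    simp only [Finset.prod_const, Finset.card_univ, Fintype.card_fin] at h3
    rw [← Real.norm_eq_abs]
    refine h3.trans ?_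
    have h4 : t * ‖h‖ ≤ ‖h‖ := mul_le_of_le_one_left (norm_nonneg _) ht.2.le
    have h5 : 0 ≤ t * ‖h‖ := mul_nonneg ht.1.le (norm_nonneg _)
    gcongr
    refine h2.trans ?_
    gcongr
  have hf : (1 : ℝ) ≤ Nat.factorial (m + 1) := by
    exact_mod_cast Nat.one_le_iff_ne_zero.2 (Nat.factorial_ne_zero _)
  have e4 : iteratedFDeriv ℝ (m + 1) g (z + t • h) (fun _ => h) * (1 - 0) ^ (m + 1) /
      (Nat.factorial (m + 1) : ℝ) - (Nat.factorial (m + 1) : ℝ)⁻¹ *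
        iteratedFDeriv ℝ (m + 1) g z (fun _ => h) = (Nat.factorial (m + 1) : ℝ)⁻¹ *
      (iteratedFDeriv ℝ (m + 1) g (z + t • h) (fun _ => h) -
        iteratedFDeriv ℝ (m + 1) g z (fun _ => h)) := by
    simp only [sub_zero, one_pow, mul_one]; ring
  rw [e4, abs_mul, abs_of_pos (by positivity)]
  exact (mul_le_of_le_one_left (abs_nonneg _) (inv_le_one_of_one_le₀ hf)).trans h1

theorem fderiv_eq_zero_of_invariant {g : Eu n → ℝ} {v z : Eu n} (hg : DifferentiableAt ℝ g z)
    (hv : ‖v‖ = 1) (hgv : ∀ x : Eu n, g x = g (x - ⟪x, v⟫ • v)) : fderiv ℝ g z v = 0 := by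
  have h1 : HasDerivAt (fun t : ℝ => g (z + t • v)) (fderiv ℝ g z v) 0 := by
    have h2 : HasDerivAt (fun t : ℝ => z + t • v) v 0 := by
      simpa using ((hasDerivAt_id (0 : ℝ)).smul_const v).const_add z
    have h3 : HasFDerivAt g (fderiv ℝ g z) (z + (0 : ℝ) • v) := by simpa using hg.hasFDerivAt
    exact h3.comp_hasDerivAt 0 h2
  have h2 : (fun t : ℝ => g (z + t • v)) = fun _ => g z := by
    funext t
    rw [hgv, hgv z, inner_add_left, real_inner_smul_left, real_inner_self_eq_norm_sq, hv]
    congr 1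
    module
  rw [h2] at h1
  exact h1.unique (hasDerivAt_const _ _)

/-- The map `x ↦ z + r • x` as a homeomorphism. -/
def affineHomeo (z : Eu n) {r : ℝ} (hr : r ≠ 0) : Eu n ≃ₜ Eu n :=
  (Homeomorph.smulOfNeZero r hr).trans (Homeomorph.addLeft z)

theorem frontier_affine_preimage (z : Eu n) {r : ℝ} (hr : r ≠ 0) (Ω : Set (Eu n)) :
    frontier ((fun x => z + r • x) ⁻¹' Ω) = (fun x => z + r • x) ⁻¹' frontier Ω :=
  ((affineHomeo z hr).preimage_frontier Ω).symm

theorem closure_affine_preimage (z : Eu n) {r : ℝ} (hr : r ≠ 0) (Ω : Set (Eu n)) :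
    closure ((fun x => z + r • x) ⁻¹' Ω) = (fun x => z + r • x) ⁻¹' closure Ω :=
  ((affineHomeo z hr).preimage_closure Ω).symm

theorem exists_isGraphNear_local {d : ℕ} (hd : 1 ≤ d) {ε ε' : ℝ} (hε : 0 < ε') (hεε : ε' ≤ ε)
    {D : Set (Eu n)} (hD : IsOpen D) (hbd : HasGraphBoundary D (CkHolder (d + 1) ε)) {κ : ℝ}
    (hκ : 0 < κ) {z₀ : Eu n} (hz₀ : z₀ ∈ frontier D) :
    ∃ t ∈ nhds z₀, ∃ r₁ : ℝ, 0 < r₁ ∧ ∀ z ∈ t, z ∈ frontier D → ∀ r, 0 < r → r ≤ r₁ →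
      ∃ ν Ψ ψ, IsGraphNear d ε' κ ν Ψ ψ ((fun x => z + r • x) ⁻¹' D) := by
  obtain ⟨v, hv, V, hV, hz₀V, g, ⟨hg, H, hH⟩, hgv, hDV, hfV⟩ := hbd z₀ hz₀
  obtain ⟨ρ, hρ, hρV⟩ := Metric.isOpen_iff.1 hV z₀ hz₀V
  have hcont : Continuous fun z => ∑ j ∈ Finset.range (d + 2), ‖iteratedFDeriv ℝ j g z‖ := by
    refine continuous_finsetSum _ fun j hj => (hg.continuous_iteratedFDeriv ?_).norm
    have : j ≤ d + 1 := Nat.lt_succ_iff.1 (Finset.mem_range.1 hj)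
    exact_mod_cast this
  obtain ⟨M, hM⟩ := (isCompact_closedBall z₀ ρ).exists_bound_of_continuousOn hcont.continuousOn
  have hM0 : 0 ≤ M := (norm_nonneg _).trans (hM z₀ (mem_closedBall_self hρ.le))
  set K := 1 + H + M + ∑ j ∈ Finset.range d, M * n ^ (j + 2) with hK
  have hS : 0 ≤ ∑ j ∈ Finset.range d, M * (n : ℝ) ^ (j + 2) :=
    Finset.sum_nonneg fun j _ => by positivity
  have hH0 : (0 : ℝ) ≤ H := H.2
  have hK0 : 0 < K := by linarith
  refine ⟨ball z₀ (ρ / 2), ball_mem_nhds _ (by linarith), min (min 1 (ρ / 2)) (κ / K),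
    by positivity, fun z hz hzD r hr hr1 => ?_⟩
  have hr1' : r ≤ 1 := hr1.trans ((min_le_left _ _).trans (min_le_left _ _))
  have hrρ : r ≤ ρ / 2 := hr1.trans ((min_le_left _ _).trans (min_le_right _ _))
  have hrκ : r * K ≤ κ := (le_div_iff₀ hK0).1 (hr1.trans (min_le_right _ _))
  have hzρ : z ∈ ball z₀ ρ := ball_subset_ball (by linarith) hz
  have hDz : ∀ j < d + 2, ‖iteratedFDeriv ℝ j g z‖ ≤ M := fun j hj => by
    have h1 := hM z (ball_subset_closedBall hzρ)
    rw [Real.norm_of_nonneg (Finset.sum_nonneg fun j _ => norm_nonneg _)] at h1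
    exact (Finset.single_le_sum (f := fun j => ‖iteratedFDeriv ℝ j g z‖)
      (fun j _ => norm_nonneg _) (Finset.mem_range.2 hj)).trans h1
  have hxV : ∀ x ∈ ball (0 : Eu n) 1, z + r • x ∈ V := fun x hx => hρV (by
    rw [mem_ball_zero_iff] at hx
    rw [mem_ball, dist_eq_norm] at hz ⊢
    have e : z + r • x - z₀ = (z - z₀) + r • x := by abel
    rw [e]
    have h1 := norm_add_le (z - z₀) (r • x)
    rw [norm_smul, Real.norm_of_nonneg hr.le] at h1
    nlinarith [norm_nonneg x])
  have hgd : Differentiable ℝ g := hg.differentiable (by norm_num)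
  have hgz : ⟪z, v⟫ = g z := by
    have : z ∈ frontier D ∩ V := ⟨hzD, hρV hzρ⟩
    rw [hfV] at this
    exact this.2
  set N : Eu n := v - (InnerProductSpace.toDual ℝ (Eu n)).symm (fderiv ℝ g z) with hN
  have hNx : ∀ x, ⟪x, N⟫ = ⟪x, v⟫ - fderiv ℝ g z x := fun x => by
    rw [hN, inner_sub_right, real_inner_comm _ x, real_inner_comm _ x,
      InnerProductSpace.toDual_symm_apply, real_inner_comm]
  have hN1 : 1 ≤ ‖N‖ := by
    have h1 := hNx v
    rw [fderiv_eq_zero_of_invariant (hgd z) hv hgv, sub_zero, real_inner_self_eq_norm_sq, hv] at h1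
    have h2 := real_inner_le_norm v N
    rw [h1, hv] at h2
    linarith
  have hN0 : 0 < ‖N‖ := by linarith
  set Ψ : Eu n → ℝ := fun x => (‖N‖ * r)⁻¹ * (g (z + r • x) - g z - fderiv ℝ g z (r • x)) with hΨ
  set ψ : ℕ → Eu n → ℝ := fun j x => (‖N‖ * r)⁻¹ *
    ((Nat.factorial (j + 2) : ℝ)⁻¹ * iteratedFDeriv ℝ (j + 2) g z fun _ => r • x) with hψ
  have hlin : ∀ x, lin (‖N‖⁻¹ • N) x = ‖N‖⁻¹ * (⟪x, v⟫ - fderiv ℝ g z x) := fun x => by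
    rw [lin_eq, real_inner_smul_right, hNx]
  have hmem : ∀ x, (lin (‖N‖⁻¹ • N) x < Ψ x ↔ ⟪z + r • x, v⟫ < g (z + r • x)) ∧
      (lin (‖N‖⁻¹ • N) x = Ψ x ↔ ⟪z + r • x, v⟫ = g (z + r • x)) := fun x => by
    rw [hlin, inner_add_left, real_inner_smul_left, hgz, hΨ]
    dsimp only
    rw [map_smul, smul_eq_mul, mul_inv, mul_assoc, mul_lt_mul_iff_right₀ (inv_pos.2 hN0),
      lt_inv_mul_iff₀ hr, mul_right_inj' (inv_ne_zero hN0.ne'), eq_inv_mul_iff_mul_eq₀ hr.ne']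
    constructor <;> constructor <;> intro h <;> linarith
  have hA : (‖N‖ * r)⁻¹ ≤ r⁻¹ := by
    gcongr
    exact le_mul_of_one_le_left hr.le hN1
  have hψB : ∀ j < d, HomB (j + 2) (r * M) (ψ j) := fun j hj => by
    have h1 := (homB_diag (iteratedFDeriv ℝ (j + 2) g z)).const_mul
      ((‖N‖ * r)⁻¹ * (Nat.factorial (j + 2) : ℝ)⁻¹ * r ^ (j + 2))
    have e : ψ j = fun x => (‖N‖ * r)⁻¹ * (Nat.factorial (j + 2) : ℝ)⁻¹ * r ^ (j + 2) *
        iteratedFDeriv ℝ (j + 2) g z fun _ => x := by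
      funext x
      have h2 := (iteratedFDeriv ℝ (j + 2) g z).map_smul_univ (fun _ => r) fun _ => x
      simp only [Finset.prod_const, Finset.card_univ, Fintype.card_fin, smul_eq_mul] at h2
      rw [hψ]
      dsimp only
      rw [h2]
      ring
    rw [e]
    refine h1.mono ?_
    have hf : (Nat.factorial (j + 2) : ℝ)⁻¹ ≤ 1 := inv_le_one_of_one_le₀ (by
      exact_mod_cast Nat.one_le_iff_ne_zero.2 (Nat.factorial_ne_zero _))
    have h3 : r ^ (j + 2) ≤ r ^ 2 := pow_le_pow_of_le_one hr.le hr1' (by omega)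
    rw [abs_of_pos (by positivity)]
    calc _ ≤ r⁻¹ * 1 * r ^ 2 * M := by
          gcongr
          exact hDz _ (by omega)
      _ = r * M := by field_simp
  have hσ0 : 0 ≤ (d : ℝ) + 1 + ε' := by positivity
  have hnear : ∀ x ∈ ball (0 : Eu n) 1, |Ψ x - ∑ j ∈ Finset.range d, ψ j x| ≤
      r * H * ‖x‖ ^ ((d : ℝ) + 1 + ε') := fun x hx => by
    have hx1 : ‖x‖ ≤ 1 := (mem_ball_zero_iff.1 hx).le
    have h1 := abs_taylor_le hg hH z (r • x)
    have e : Ψ x - ∑ j ∈ Finset.range d, ψ j x = (‖N‖ * r)⁻¹ *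
        (g (z + r • x) - ∑ j ∈ Finset.range (d + 2),
          ((Nat.factorial j : ℝ))⁻¹ * iteratedFDeriv ℝ j g z (fun _ => r • x)) := by
      rw [Finset.sum_range_succ', Finset.sum_range_succ', hψ]
      dsimp only
      rw [← Finset.mul_sum]
      simp [hΨ, iteratedFDeriv_one_apply]
      ring
    rw [e, abs_mul, abs_of_pos (by positivity)]
    have h2 : (ε.toNNReal : ℝ) = ε := Real.coe_toNNReal _ (hε.le.trans hεε)
    have hrx : ‖r • x‖ = r * ‖x‖ := by rw [norm_smul, Real.norm_of_nonneg hr.le]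
    have hrx0 : 0 ≤ r * ‖x‖ := by positivity
    have hrx1 : r * ‖x‖ ≤ 1 := by nlinarith [norm_nonneg x]
    rw [h2, hrx] at h1
    have h3 : (r * ‖x‖) ^ ε ≤ ‖x‖ ^ ε' :=
      (Real.rpow_le_rpow_of_exponent_ge' hrx0 hrx1 hε.le hεε).trans
        (Real.rpow_le_rpow hrx0 (mul_le_of_le_one_left (norm_nonneg _) hr1') hε.le)
    have h4 : ‖x‖ ^ ε' * ‖x‖ ^ (d + 1) = ‖x‖ ^ ((d : ℝ) + 1 + ε') := by
      rw [Real.rpow_add_of_nonneg (norm_nonneg _) (by positivity) hε.le, mul_comm]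
      congr 1
      rw [← Real.rpow_natCast]; push_cast; rfl
    have h5 : r ^ (d + 1) ≤ r ^ 2 := pow_le_pow_of_le_one hr.le hr1' (by omega)
    calc _ ≤ r⁻¹ * (H * (r * ‖x‖) ^ ε * (r * ‖x‖) ^ (d + 1)) := by gcongr
      _ = r⁻¹ * (H * (r * ‖x‖) ^ ε * (r ^ (d + 1) * ‖x‖ ^ (d + 1))) := by rw [mul_pow]
      _ ≤ r⁻¹ * (H * ‖x‖ ^ ε' * (r ^ 2 * ‖x‖ ^ (d + 1))) := by gcongr
      _ = r * H * (‖x‖ ^ ε' * ‖x‖ ^ (d + 1)) := by field_simp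
      _ = _ := by rw [h4]
  refine ⟨‖N‖⁻¹ • N, Ψ, ψ, ?_, hD.preimage (continuous_affine z r), hκ.le, fun x hx => ?_,
    fun x hx hxf => ?_, fun j hj => (hψB j hj).mono ?_, fun x hx => ?_, fun x hx => ?_⟩
  · rw [norm_smul, norm_inv, norm_norm, inv_mul_cancel₀ hN0.ne']
  · rw [(hmem x).1]
    have h1 : z + r • x ∈ D ∩ V ↔ z + r • x ∈ {x ∈ V | ⟪x, v⟫ < g x} := by rw [hDV]
    exact ⟨fun h => (h1.1 ⟨h, hxV x hx⟩).2, fun h => (h1.2 ⟨hxV x hx, h⟩).1⟩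
  · rw [(hmem x).2]
    rw [frontier_affine_preimage z hr.ne'] at hxf
    have h1 : z + r • x ∈ frontier D ∩ V := ⟨hxf, hxV x hx⟩
    rw [hfV] at h1
    exact h1.2
  · refine le_trans ?_ hrκ
    gcongr
    linarith
  · have hx1 : ‖x‖ ≤ 1 := (mem_ball_zero_iff.1 hx).le
    have h1 := hnear x hx
    have h2 : |∑ j ∈ Finset.range d, ψ j x| ≤
        r * (∑ j ∈ Finset.range d, M * (n : ℝ) ^ (j + 2)) * ‖x‖ ^ 2 := by
      rw [Finset.mul_sum, Finset.sum_mul]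
      refine (Finset.abs_sum_le_sum_abs _ _).trans (Finset.sum_le_sum fun j hj => ?_)
      refine ((hψB j (Finset.mem_range.1 hj)).abs_le x).trans ?_
      have h3 : ‖x‖ ^ (j + 2) ≤ ‖x‖ ^ 2 := pow_le_pow_of_le_one (norm_nonneg _) hx1 (by omega)
      rw [mul_pow]
      calc _ ≤ r * M * (n ^ (j + 2) * ‖x‖ ^ 2) := by gcongr
        _ = _ := by ring
    have h3 : ‖x‖ ^ ((d : ℝ) + 1 + ε') ≤ ‖x‖ ^ 2 := by
      rw [← Real.rpow_natCast]
      refine Real.rpow_le_rpow_of_exponent_ge' (norm_nonneg _) hx1 (by norm_num) ?_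
      have : (1 : ℝ) ≤ d := by exact_mod_cast hd
      push_cast; linarith
    have h4 := abs_add_le (Ψ x - ∑ j ∈ Finset.range d, ψ j x) (∑ j ∈ Finset.range d, ψ j x)
    rw [sub_add_cancel] at h4
    calc |Ψ x| ≤ r * H * ‖x‖ ^ 2 +
          r * (∑ j ∈ Finset.range d, M * (n : ℝ) ^ (j + 2)) * ‖x‖ ^ 2 := by
          refine h4.trans (add_le_add (h1.trans ?_) h2)
          gcongr
      _ = r * (H + ∑ j ∈ Finset.range d, M * (n : ℝ) ^ (j + 2)) * ‖x‖ ^ 2 := by ring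
      _ ≤ r * K * ‖x‖ ^ 2 := by gcongr; linarith
      _ ≤ κ * ‖x‖ ^ 2 := by gcongr
  · refine (hnear x hx).trans ?_
    have h3 : 0 ≤ ‖x‖ ^ ((d : ℝ) + 1 + ε') := Real.rpow_nonneg (norm_nonneg _) _
    have : r * H ≤ κ := le_trans (by gcongr; linarith) hrκ
    gcongr

/-- A bounded domain of class `C ^ (d + 1, ε)` is nearly flat at all its boundary points, at a
uniform scale. -/
theorem exists_isGraphNear {d : ℕ} (hd : 1 ≤ d) {ε ε' : ℝ} (hε : 0 < ε') (hεε : ε' ≤ ε)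
    {D : Set (Eu n)} (hD : IsOpen D) (hDb : Bornology.IsBounded D)
    (hbd : HasGraphBoundary D (CkHolder (d + 1) ε)) {κ : ℝ} (hκ : 0 < κ) :
    ∃ r₁ : ℝ, 0 < r₁ ∧ ∀ z ∈ frontier D, ∀ r, 0 < r → r ≤ r₁ →
      ∃ ν Ψ ψ, IsGraphNear d ε' κ ν Ψ ψ ((fun x => z + r • x) ⁻¹' D) := by
  have hcpt : IsCompact (frontier D) :=
    hDb.isCompact_closure.of_isClosed_subset isClosed_frontier frontier_subset_closure
  refine hcpt.induction_on (p := fun s => ∃ r₁ : ℝ, 0 < r₁ ∧ ∀ z ∈ s, ∀ r, 0 < r → r ≤ r₁ →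
    ∃ ν Ψ ψ, IsGraphNear d ε' κ ν Ψ ψ ((fun x => z + r • x) ⁻¹' D)) ?_ ?_ ?_ ?_
  · exact ⟨1, one_pos, fun z hz => absurd hz (notMem_empty z)⟩
  · rintro s t hst ⟨r₁, h1, h2⟩
    exact ⟨r₁, h1, fun z hz => h2 z (hst hz)⟩
  · rintro s t ⟨r₁, h1, h2⟩ ⟨r₂, h3, h4⟩
    refine ⟨min r₁ r₂, lt_min h1 h3, fun z hz r hr hr1 => ?_⟩
    rcases hz with hz | hz
    · exact h2 z hz r hr (hr1.trans (min_le_left _ _))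
    · exact h4 z hz r hr (hr1.trans (min_le_right _ _))
  · intro z₀ hz₀
    obtain ⟨t, ht, r₁, hr₁, h⟩ := exists_isGraphNear_local hd hε hεε hD hbd hκ hz₀
    exact ⟨t ∩ frontier D, Filter.inter_mem (mem_nhdsWithin_of_mem_nhds ht) self_mem_nhdsWithin,
      r₁, hr₁, fun z hz => h z hz.1 hz.2⟩

end Charts


section LocalEstimate

theorem compl_nonempty_of_isBounded (hn : 0 < n) {D : Set (Eu n)} (hb : Bornology.IsBounded D) :
    (Dᶜ).Nonempty := by
  have : Nonempty (Fin n) := ⟨⟨0, hn⟩⟩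
  rw [nonempty_compl]
  rintro rfl
  exact NormedSpace.unbounded_univ ℝ (Eu n) hb

theorem bdist_pos (hn : 0 < n) {D : Set (Eu n)} (hD : IsOpen D) (hb : Bornology.IsBounded D)
    {x : Eu n} (hx : x ∈ D) : 0 < bdist D x :=
  (hD.isClosed_compl.notMem_iff_infDist_pos (compl_nonempty_of_isBounded hn hb)).1
    (fun h => h hx)

theorem ball_bdist_subset (D : Set (Eu n)) (x : Eu n) : ball x (bdist D x) ⊆ D := by
  intro y hy
  by_contra h
  have := infDist_le_dist_of_mem (s := Dᶜ) (x := x) h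
  rw [mem_ball, dist_comm] at hy
  exact absurd hy (not_lt.2 this)

theorem exists_frontier_dist_eq (hn : 0 < n) {D : Set (Eu n)} (hD : IsOpen D)
    (hb : Bornology.IsBounded D) {x : Eu n} (hx : x ∈ D) :
    ∃ z ∈ frontier D, ‖x - z‖ = bdist D x := by
  obtain ⟨z, hz, e⟩ := hD.isClosed_compl.exists_infDist_eq_dist
    (compl_nonempty_of_isBounded hn hb) x
  have hpos := bdist_pos hn hD hb hx
  refine ⟨z, ?_, by rw [← dist_eq_norm]; exact e.symm⟩
  rw [hD.frontier_eq]
  refine ⟨closure_mono (ball_bdist_subset D x) ?_, hz⟩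
  rw [closure_ball _ hpos.ne', mem_closedBall, dist_comm]
  exact e.ge

/-- Scale-invariant estimate up to the boundary for harmonic functions vanishing on the part of
the boundary of a `C ^ (d + 1, ε)` domain which lies in a ball. -/
theorem exists_local_estimate (hn : 0 < n) {d : ℕ} (hd : 1 ≤ d) {ε : ℝ} (hε : 0 < ε)
    {D : Set (Eu n)} (hD : IsOpen D) (hDb : Bornology.IsBounded D)
    (hbd : HasGraphBoundary D (CkHolder (d + 1) ε)) {R : ℝ} (hR : 0 < R) :
    ∃ C : ℝ, 0 < C ∧ ∀ x ∈ D, ∀ r, 0 < r → r ≤ R → ∀ w : Eu n → ℝ, ∀ M : ℝ, 0 < M →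
      (∀ y ∈ D ∩ ball x r, HarmAt w y) → ContinuousOn w (closure D ∩ ball x r) →
      (∀ y ∈ frontier D ∩ ball x r, w y = 0) → (∀ y ∈ D ∩ ball x r, |w y| ≤ M) →
      ∀ L : List (Fin n), L.length ≤ d + 1 → |pdMulti L w x| ≤ C / r ^ L.length * M := by
  obtain ⟨κ, C, hκ, hC, hest⟩ := exists_boundary_estimate (n := n) hn hd
    (ε := min ε (1 / 2)) (by positivity) ((min_le_right _ _).trans_lt (by norm_num))
  obtain ⟨r₁, hr₁, hgr⟩ := exists_isGraphNear hd (ε := ε) (ε' := min ε (1 / 2)) (by positivity)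
    (min_le_left _ _) hD hDb hbd hκ
  obtain ⟨C₁, hC₁, int⟩ := interior_estimate_le hn (d + 1)
  set c := min (1 / 2) (r₁ / R) / 4 with hc
  have hc0 : 0 < c := by positivity
  have hc1 : c ≤ 1 := by
    have : min (1 / 2) (r₁ / R) ≤ 1 / 2 := min_le_left _ _
    linarith
  refine ⟨(C + C₁) / c ^ (d + 1), by positivity, fun x hx r hr hrR w M hM hw hwc hw0 hwM L hL => ?_⟩
  set s := min (r / 2) r₁ with hs
  have hs0 : 0 < s := by positivity
  have hsr : s ≤ r / 2 := min_le_left _ _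
  have hcs : c * r ≤ s / 4 := by
    have h1 : min (1 / 2) (r₁ / R) * r ≤ s := by
      refine le_min ?_ ?_
      · calc _ ≤ 1 / 2 * r := by gcongr; exact min_le_left _ _
          _ = r / 2 := by ring
      · calc _ ≤ r₁ / R * R := by gcongr; exact min_le_right _ _
          _ = r₁ := by field_simp
    rw [hc]; linarith
  have hfin : ∀ K t : ℝ, 0 ≤ K → K ≤ C + C₁ → c * r ≤ t →
      K / t ^ L.length * M ≤ (C + C₁) / c ^ (d + 1) / r ^ L.length * M := fun K t hK0 hK ht => by
    have h1 : c ^ (d + 1) * r ^ L.length ≤ t ^ L.length := by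
      calc c ^ (d + 1) * r ^ L.length ≤ c ^ L.length * r ^ L.length := by
            gcongr ?_ * _
            exact pow_le_pow_of_le_one hc0.le hc1 hL
        _ = (c * r) ^ L.length := (mul_pow _ _ _).symm
        _ ≤ t ^ L.length := by gcongr
    rw [div_div]
    gcongr
  rcases lt_or_ge (s / 4) (bdist D x) with hδ | hδ
  · have hsub : ball x (s / 4) ⊆ D ∩ ball x r := fun y hy =>
      ⟨ball_bdist_subset D x (ball_subset_ball hδ.le hy), ball_subset_ball (by linarith) hy⟩
    exact (int w x (s / 4) M (by positivity) (fun y hy => hw y (hsub hy))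
      (fun y hy => hwM y (hsub hy)) L hL).trans (hfin _ _ hC₁.le (by linarith) hcs)
  · obtain ⟨z, hz, hxz⟩ := exists_frontier_dist_eq hn hD hDb hx
    have hδ0 := bdist_pos hn hD hDb hx
    obtain ⟨ν, Ψ, ψ, G⟩ := hgr z hz s hs0 (min_le_right _ _)
    have hball : ∀ y ∈ ball (0 : Eu n) 1, z + s • y ∈ ball x r := fun y hy => by
      rw [mem_ball_zero_iff] at hy
      rw [mem_ball, dist_eq_norm]
      have e : z + s • y - x = s • y - (x - z) := by abel
      rw [e]
      have h1 := norm_sub_le (s • y) (x - z)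
      rw [norm_smul, Real.norm_of_nonneg hs0.le, hxz] at h1
      nlinarith
    have hxs : z + s • (s⁻¹ • (x - z)) = x := by
      rw [smul_inv_smul₀ hs0.ne']; abel
    have hns : ‖s⁻¹ • (x - z)‖ = s⁻¹ * bdist D x := by
      rw [norm_smul, Real.norm_of_nonneg (inv_pos.2 hs0).le, hxz]
    have h1 := hest G (u := fun y => M⁻¹ * w (z + s • y))
      (fun y hy => (HarmAt.comp_affine (hw _ ⟨hy.1, hball y hy.2⟩)).const_mul _)
      (continuousOn_const.mul (hwc.comp (continuous_affine z s).continuousOn fun y hy => by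
        rw [closure_affine_preimage z hs0.ne'] at hy
        exact ⟨hy.1, hball y hy.2⟩))
      (fun y hy => by
        rw [abs_mul, abs_of_pos (inv_pos.2 hM), inv_mul_le_one₀ hM]
        exact hwM _ ⟨hy.1, hball y hy.2⟩)
      (fun y hy => by
        rw [frontier_affine_preimage z hs0.ne'] at hy
        rw [hw0 _ ⟨hy.1, hball y hy.2⟩, mul_zero])
      (s⁻¹ • (x - z)) (by rw [← norm_pos_iff, hns]; positivity)
      (by rw [hns, inv_mul_le_iff₀ hs0]; linarith)
      (fun y hy => by
        refine ball_bdist_subset D x ?_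
        rw [mem_ball, dist_eq_norm, hns] at hy
        rw [mem_ball, dist_eq_norm]
        have e : z + s • y - x = s • (y - s⁻¹ • (x - z)) := by
          rw [smul_sub, smul_inv_smul₀ hs0.ne']; abel
        rw [e, norm_smul, Real.norm_of_nonneg hs0.le]
        calc _ < s * (s⁻¹ * bdist D x) := by gcongr
          _ = bdist D x := by field_simp) L hL
    have hO : IsOpen (D ∩ ball x r) := hD.inter isOpen_ball
    have h2 : (fun y => M⁻¹ * w (z + s • y)) = fun y => (fun y => M⁻¹ * w y) (z + s • y) := rfl
    have hxm : x ∈ D ∩ ball x r := ⟨hx, mem_ball_self hr⟩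
    rw [h2, pdMulti_comp_affine_harm hn hO (fun y hy => (hw y hy).const_mul M⁻¹) z s L _
      (by rw [hxs]; exact hxm), hxs, pdMulti_const_mul_harm hn hO hw M⁻¹ L x hxm, abs_mul, abs_mul,
      abs_of_pos (pow_pos hs0 _), abs_of_pos (inv_pos.2 hM)] at h1
    have h3 : |pdMulti L w x| ≤ C / s ^ L.length * M := by
      rw [div_mul_eq_mul_div, le_div_iff₀ (pow_pos hs0 _)]
      have : M⁻¹ * (|pdMulti L w x| * s ^ L.length) ≤ C := by linarith
      rw [inv_mul_le_iff₀ hM] at this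
      linarith
    exact h3.trans (hfin _ _ hC.le (by linarith) (by linarith))

end LocalEstimate


section FundamentalSolution

theorem harmAt_norm_rpow {x : Eu n} (hx : x ≠ 0) :
    HarmAt (fun y : Eu n => ‖y‖ ^ (2 - (n : ℝ))) x := by
  set p : ℝ := (2 - (n : ℝ)) / 2 with hp
  have e : (fun y : Eu n => ‖y‖ ^ (2 - (n : ℝ))) = fun y => nsq y ^ p := by
    funext y
    rw [nsq_eq, ← Real.rpow_natCast, ← Real.rpow_mul (norm_nonneg _), hp]
    congr 1
    push_cast; ring
  have hpos : ∀ y : Eu n, y ≠ 0 → 0 < nsq y := fun y hy => by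
    rw [nsq_eq]; exact pow_pos (norm_pos_iff.2 hy) 2
  have hd : ∀ y : Eu n, DifferentiableAt ℝ nsq y := fun y =>
    (contDiff_nsq (m := 1)).contDiffAt.differentiableAt (by norm_num)
  have hdr : ∀ (q : ℝ) (y : Eu n), y ≠ 0 → DifferentiableAt ℝ (fun z => nsq z ^ q) y :=
    fun q y hy => (hd y).rpow_const (Or.inl (hpos y hy).ne')
  have hpd : ∀ (q : ℝ) (i : Fin n) (y : Eu n), y ≠ 0 →
      pd i (fun z => nsq z ^ q) y = 2 * q * (nsq y ^ (q - 1) * y i) := fun q i y hy => by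
    have h1 := ((hd y).hasFDerivAt.rpow_const (p := q) (Or.inl (hpos y hy).ne')).fderiv
    have h2 : pd i nsq y = 2 * y i := by rw [pd_nsq]
    unfold pd at h2 ⊢
    rw [h1, smul_apply, h2, smul_eq_mul]
    ring
  rw [e]
  refine ⟨contDiff_nsq.contDiffAt.rpow_const_of_ne (hpos x hx).ne', ?_⟩
  have hpd2 : ∀ i, pd2 i i (fun z => nsq z ^ p) x =
      2 * p * (2 * (p - 1) * (nsq x ^ (p - 1 - 1) * x i) * x i + nsq x ^ (p - 1)) := fun i => by
    have h1 : pd i (fun z => nsq z ^ p) =ᶠ[nhds x]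
        fun z => 2 * p * (nsq z ^ (p - 1) * z i) := by
      filter_upwards [isOpen_ne.mem_nhds hx] with z hz using hpd p i z hz
    have h2 := pd_congr (i := i) h1
    have hdm : DifferentiableAt ℝ (fun z => nsq z ^ (p - 1) * z i) x :=
      (hdr _ x hx).mul (differentiableAt_coord _ _)
    rw [pd_const_mul _ hdm,
      pd_mul (hdr _ x hx) (differentiableAt_coord _ _), hpd _ _ _ hx, pd_coord, if_pos rfl,
      mul_one] at h2
    exact h2
  have hsum : ∑ i, x i * x i = nsq x := rfl
  have hn1 : nsq x ^ (p - 1) = nsq x ^ (p - 1 - 1) * nsq x := by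
    rw [← Real.rpow_add_one (hpos x hx).ne', sub_add_cancel]
  calc lapl (fun z => nsq z ^ p) x
      = ∑ i, 2 * p * (2 * (p - 1) * (nsq x ^ (p - 1 - 1) * x i) * x i + nsq x ^ (p - 1)) :=
        Finset.sum_congr rfl fun i _ => hpd2 i
    _ = 2 * p * (2 * (p - 1) * nsq x ^ (p - 1 - 1) * ∑ i, x i * x i + n * nsq x ^ (p - 1)) := by
        rw [← Finset.mul_sum, Finset.sum_add_distrib, Finset.mul_sum]
        congr 2
        · exact Finset.sum_congr rfl fun i _ => by ring
        · simp
    _ = 2 * p * (nsq x ^ (p - 1) * (2 * p - 2 + n)) := by rw [hsum, hn1]; ring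
    _ = 0 := by rw [hp]; ring

/-- The constant in the fundamental solution. -/
def fundConst (n : ℕ) : ℝ := ((n : ℝ) - 2)⁻¹ * (sphereArea n)⁻¹

theorem fundSol_eq (x : Eu n) : fundSol n x = -(fundConst n * ‖x‖ ^ (2 - (n : ℝ))) := rfl

theorem fundConst_pos (hn : 2 < n) : 0 < fundConst n := by
  have h1 : (2 : ℝ) < n := by exact_mod_cast hn
  have h2 : 0 < sphereArea n := by
    refine mul_pos (by linarith) (ENNReal.toReal_pos ?_ ?_)
    · exact (measure_ball_pos _ _ one_pos).ne'
    · exact measure_ball_lt_top.ne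
  have : (0 : ℝ) < (n : ℝ) - 2 := by linarith
  unfold fundConst
  positivity

theorem fundSol_neg (x : Eu n) : fundSol n (-x) = fundSol n x := by
  rw [fundSol_eq, fundSol_eq, norm_neg]

theorem fundSol_sub_comm (x y : Eu n) : fundSol n (x - y) = fundSol n (y - x) := by
  rw [← fundSol_neg, neg_sub]

theorem fundSol_nonpos (hn : 2 < n) (x : Eu n) : fundSol n x ≤ 0 := by
  rw [fundSol_eq, neg_nonpos]
  exact mul_nonneg (fundConst_pos hn).le (Real.rpow_nonneg (norm_nonneg _) _)

theorem fundSol_le_of_norm_le (hn : 2 < n) {x y : Eu n} (hx : x ≠ 0) (h : ‖x‖ ≤ ‖y‖) :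
    fundSol n x ≤ fundSol n y := by
  have h1 : (2 : ℝ) < n := by exact_mod_cast hn
  rw [fundSol_eq, fundSol_eq, neg_le_neg_iff]
  exact mul_le_mul_of_nonneg_left
    (Real.rpow_le_rpow_of_nonpos (norm_pos_iff.2 hx) h (by linarith)) (fundConst_pos hn).le

theorem harmAt_fundSol {x : Eu n} (hx : x ≠ 0) : HarmAt (fundSol n) x := by
  have h := (harmAt_norm_rpow hx).const_mul (-fundConst n)
  have e : fundSol n = fun y => -fundConst n * ‖y‖ ^ (2 - (n : ℝ)) := by
    funext y; rw [fundSol_eq, neg_mul]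
  rw [e]; exact h

theorem harmAt_fundSol_sub {x y : Eu n} (h : x ≠ y) : HarmAt (fun z => fundSol n (z - y)) x := by
  have h1 : HarmAt (fun z => fundSol n (-y + (1 : ℝ) • z)) x := HarmAt.comp_affine (by
    refine harmAt_fundSol ?_
    rw [one_smul, neg_add_eq_sub, sub_ne_zero]; exact h)
  simpa [neg_add_eq_sub] using h1

theorem abs_fundSol_le (hn : 2 < n) {x : Eu n} {r : ℝ} (hr : 0 < r) (h : r ≤ ‖x‖) :
    |fundSol n x| ≤ fundConst n / r ^ (n - 2) := by
  have h1 : (2 : ℝ) < n := by exact_mod_cast hn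
  have h2 := Real.rpow_le_rpow_of_nonpos hr h (z := 2 - (n : ℝ)) (by linarith)
  have h3 : r ^ (2 - (n : ℝ)) = (r ^ (n - 2))⁻¹ := by
    rw [← Real.rpow_natCast, ← Real.rpow_neg hr.le, Nat.cast_sub hn.le]
    congr 1
    push_cast; ring
  rw [abs_of_nonpos (fundSol_nonpos hn x), fundSol_eq, neg_neg, div_eq_mul_inv, ← h3]
  exact mul_le_mul_of_nonneg_left h2 (fundConst_pos hn).le

end FundamentalSolution

section GreenBounds

variable {D : Set (Eu n)} {U : Eu n → Eu n → ℝ}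

theorem IsGreenCorrection.harmAt (hU : IsGreenCorrection D U) (hD : IsOpen D) {y : Eu n}
    (hy : y ∈ D) : ∀ x ∈ D, HarmAt (fun x => U x y) x :=
  (isHarmonicOn_iff hD).1 (hU y hy).1

theorem ne_of_mem_frontier (hD : IsOpen D) {x y : Eu n} (hx : x ∈ frontier D) (hy : y ∈ D) :
    x ≠ y := by
  rintro rfl
  rw [hD.frontier_eq] at hx
  exact hx.2 hy

theorem bdist_le_of_mem_frontier (hD : IsOpen D) {x y : Eu n} (hx : x ∈ frontier D) :
    bdist D y ≤ ‖x - y‖ := by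
  rw [hD.frontier_eq] at hx
  have := infDist_le_dist_of_mem (s := Dᶜ) (x := y) hx.2
  rwa [dist_comm, dist_eq_norm] at this

theorem IsGreenCorrection.nonpos (hn : 2 < n) (hD : IsOpen D) (hDb : Bornology.IsBounded D)
    (hU : IsGreenCorrection D U) {x y : Eu n} (hx : x ∈ D) (hy : y ∈ D) : U x y ≤ 0 :=
  max_principle (by omega) hD hDb (hU y hy).2.1 (hU.harmAt hD hy)
    (fun z hz => by rw [(hU y hy).2.2 z hz]; exact fundSol_nonpos hn _) x hx

theorem IsGreenCorrection.abs_le (hn : 2 < n) (hD : IsOpen D) (hDb : Bornology.IsBounded D)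
    (hU : IsGreenCorrection D U) {x y : Eu n} (hx : x ∈ D) (hy : y ∈ D) :
    |U x y| ≤ fundConst n / bdist D y ^ (n - 2) :=
  abs_max_principle (by omega) hD hDb (hU y hy).2.1 (hU.harmAt hD hy)
    (fun z hz => by
      rw [(hU y hy).2.2 z hz]
      refine abs_fundSol_le hn (bdist_pos (by omega) hD hDb hy) ?_
      rw [norm_sub_rev]
      exact bdist_le_of_mem_frontier hD hz) x hx

theorem IsGreenCorrection.fundSol_le (hn : 2 < n) (hD : IsOpen D) (hDb : Bornology.IsBounded D)
    (hU : IsGreenCorrection D U) {x y : Eu n} (hx : x ∈ D) (hy : y ∈ D) (hxy : x ≠ y) :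
    fundSol n (x - y) ≤ U x y := by
  have hδ := bdist_pos (by omega) hD hDb hy
  have hxy' : 0 < ‖x - y‖ := norm_pos_iff.2 (sub_ne_zero.2 hxy)
  obtain ⟨η, hη0, hη⟩ := exists_between (lt_min hδ hxy')
  have hη1 := hη.trans_le (min_le_left _ _)
  have hη2 := hη.trans_le (min_le_right _ _)
  set O := D ∩ (closedBall y η)ᶜ with hO
  have hOo : IsOpen O := hD.inter isClosed_closedBall.isOpen_compl
  have hne : ∀ z ∈ closure O, z ≠ y := by
    intro z hz
    have h1 : z ∈ closure (closedBall y η)ᶜ := closure_mono inter_subset_right hz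
    rintro rfl
    rw [closure_compl, interior_closedBall _ hη0.ne'] at h1
    exact h1 (mem_ball_self hη0)
  have h1 := max_principle (u := fun z => fundSol n (z - y) - U z y) (M := 0) (by omega) hOo
    (hDb.subset inter_subset_left)
    (ContinuousOn.sub
      (fun z hz => (harmAt_fundSol_sub (hne z hz)).continuousAt.continuousWithinAt)
      ((hU y hy).2.1.mono (closure_mono inter_subset_left)))
    (fun z hz => (harmAt_fundSol_sub (hne z (subset_closure hz))).sub (hU.harmAt hD hy z hz.1))
    (fun z hz => by
      rcases frontier_inter_subset _ _ hz with h | h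
      · rw [(hU y hy).2.2 z h.1, fundSol_sub_comm, sub_self]
      · obtain ⟨-, h⟩ := h
        rw [frontier_compl, frontier_closedBall _ hη0.ne', mem_sphere, dist_eq_norm] at h
        have hzD : z ∈ D := by
          refine ball_bdist_subset D y ?_
          rw [mem_ball, dist_eq_norm, h]; exact hη1
        have h2 := neg_le_of_abs_le (hU.abs_le hn hD hDb hzD hy)
        have h3 : fundConst n / bdist D y ^ (n - 2) ≤ fundConst n / η ^ (n - 2) := by
          have := (fundConst_pos hn).le
          gcongr
        have h4 : fundSol n (z - y) = -(fundConst n / η ^ (n - 2)) := by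
          rw [fundSol_eq, h, div_eq_mul_inv, ← Real.rpow_natCast, ← Real.rpow_neg hη0.le,
            Nat.cast_sub hn.le]
          congr 3
          push_cast; ring
        linarith) x ⟨hx, fun h => by
          rw [mem_closedBall, dist_eq_norm] at h; linarith⟩
  linarith

/-- The Green's function is dominated by the fundamental solution. -/
theorem IsGreenCorrection.abs_green_le (hn : 2 < n) (hD : IsOpen D)
    (hDb : Bornology.IsBounded D) (hU : IsGreenCorrection D U) {x y : Eu n} (hx : x ∈ D)
    (hy : y ∈ D) (hxy : x ≠ y) : |fundSol n (x - y) - U x y| ≤ |fundSol n (x - y)| := by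
  have h1 := hU.fundSol_le hn hD hDb hx hy hxy
  have h2 := hU.nonpos hn hD hDb hx hy
  rw [abs_of_nonpos (by linarith), abs_of_nonpos (fundSol_nonpos hn _)]
  linarith

end GreenBounds


section HarmonicMeasure

variable {D : Set (Eu n)} {U : Eu n → Eu n → ℝ}

/-- Evaluation at a point of the solution of the Dirichlet problem extends to a continuous linear
functional on all continuous boundary data. -/
theorem exists_dirichlet_functional (hn : 0 < n) (hD : IsOpen D) (hDb : Bornology.IsBounded D)
    [CompactSpace (frontier D)] {x : Eu n} (hx : x ∈ D) :
    ∃ ℓ : C(frontier D, ℝ) →L[ℝ] ℝ, ∀ (u : Eu n → ℝ) (φ : C(frontier D, ℝ)),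
      (∀ z ∈ D, HarmAt u z) → ContinuousOn u (closure D) → (∀ z : frontier D, φ z = u z) →
      ℓ φ = u x := by
  let P : C(frontier D, ℝ) → (Eu n → ℝ) → Prop := fun φ u =>
    (∀ z ∈ D, HarmAt u z) ∧ ContinuousOn u (closure D) ∧ ∀ z : frontier D, φ z = u z
  have hadd : ∀ {φ ψ u v}, P φ u → P ψ v → P (φ + ψ) (fun z => u z + v z) :=
    fun h1 h2 => ⟨fun z hz => (h1.1 z hz).add (h2.1 z hz), h1.2.1.add h2.2.1,
      fun z => by rw [ContinuousMap.add_apply, h1.2.2, h2.2.2]⟩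
  have hsmul : ∀ (c : ℝ) {φ u}, P φ u → P (c • φ) (fun z => c * u z) :=
    fun c φ u h => ⟨fun z hz => (h.1 z hz).const_mul c, continuousOn_const.mul h.2.1,
      fun z => by rw [ContinuousMap.smul_apply, h.2.2, smul_eq_mul]⟩
  have hbound : ∀ {φ u}, P φ u → |u x| ≤ ‖φ‖ := fun {φ u} h =>
    abs_max_principle hn hD hDb h.2.1 h.1 (fun z hz => by
      have := φ.norm_coe_le_norm ⟨z, hz⟩
      rwa [h.2.2, Real.norm_eq_abs] at this) x hx
  have huniq : ∀ {φ u v}, P φ u → P φ v → u x = v x := fun {φ u v} h1 h2 => by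
    have h3 := hbound (hadd h1 (hsmul (-1) h2))
    rw [neg_one_smul, add_neg_cancel, norm_zero] at h3
    have h4 := abs_nonpos_iff.1 h3
    linarith
  let p : Submodule ℝ C(frontier D, ℝ) :=
    { carrier := {φ | ∃ u, P φ u}
      add_mem' := fun ⟨_, h1⟩ ⟨_, h2⟩ => ⟨_, hadd h1 h2⟩
      zero_mem' := ⟨fun _ => 0, fun z _ => harmAt_const 0 z, continuousOn_const, fun _ => rfl⟩
      smul_mem' := fun c _ ⟨_, h⟩ => ⟨_, hsmul c h⟩ }
  choose s hs using fun φ : p => φ.2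
  let f : p →ₗ[ℝ] ℝ :=
    { toFun := fun φ => s φ x
      map_add' := fun φ ψ => huniq (hs (φ + ψ)) (hadd (hs φ) (hs ψ))
      map_smul' := fun c φ => huniq (hs (c • φ)) (hsmul c (hs φ)) }
  obtain ⟨ℓ, hℓ, -⟩ := exists_extension_norm_eq (𝕜 := ℝ) p
    (f.mkContinuous 1 fun φ => by rw [one_mul]; exact hbound (hs φ))
  refine ⟨ℓ, fun u φ h1 h2 h3 => ?_⟩
  have hP : P φ u := ⟨h1, h2, h3⟩
  rw [hℓ ⟨φ, u, hP⟩]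
  exact huniq (hs ⟨φ, u, hP⟩) hP

/-- The correction is harmonic in its second variable. -/
theorem IsGreenCorrection.harmAt_snd (hn : 2 < n) (hD : IsOpen D) (hDb : Bornology.IsBounded D)
    (hU : IsGreenCorrection D U) {x : Eu n} (hx : x ∈ D) :
    ∀ y ∈ D, HarmAt (fun y => U x y) y := by
  have hK : IsCompact (frontier D) :=
    (hDb.isCompact_closure).of_isClosed_subset isClosed_frontier frontier_subset_closure
  have : CompactSpace (frontier D) := isCompact_iff_compactSpace.1 hK
  obtain ⟨ℓ, hℓ⟩ := exists_dirichlet_functional (by omega) hD hDb hx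
  intro y0 hy0
  set ρ := bdist D y0 / 2 with hρ
  have hδ := bdist_pos (by omega) hD hDb hy0
  have hρ0 : 0 < ρ := by positivity
  have hfar : ∀ y ∈ ball y0 ρ, ∀ ξ ∈ frontier D, ρ ≤ ‖y - ξ‖ := by
    intro y hy ξ hξ
    have h1 := bdist_le_of_mem_frontier hD hξ (y := y0)
    rw [mem_ball, dist_eq_norm] at hy
    have h2 : ‖ξ - y0‖ ≤ ‖y - y0‖ + ‖y - ξ‖ := by
      rw [show ξ - y0 = (y - y0) - (y - ξ) by abel]; exact norm_sub_le _ _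
    linarith
  obtain ⟨R, hR⟩ : ∃ R, ∀ y ∈ ball y0 ρ, ∀ ξ ∈ frontier D, ‖y - ξ‖ ≤ R := by
    obtain ⟨R1, h1⟩ := hK.isBounded.exists_norm_le
    obtain ⟨R2, h2⟩ := (isBounded_ball (x := y0) (r := ρ)).exists_norm_le
    exact ⟨R2 + R1, fun y hy ξ hξ => (norm_sub_le _ _).trans (add_le_add (h2 y hy) (h1 ξ hξ))⟩
  set S : Set (Eu n) := closedBall 0 R ∩ {v | ρ ≤ ‖v‖} with hS
  have hSc : IsCompact S :=
    (isCompact_closedBall _ _).inter_right (isClosed_le continuous_const continuous_norm)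
  have hΓ : UniformContinuousOn (fundSol n) S :=
    hSc.uniformContinuousOn_of_continuous fun v hv =>
      (harmAt_fundSol (norm_pos_iff.1 (hρ0.trans_le hv.2))).continuousAt.continuousWithinAt
  have hmem : ∀ y ∈ ball y0 ρ, ∀ ξ ∈ frontier D, y - ξ ∈ S := fun y hy ξ hξ =>
    ⟨mem_closedBall_zero_iff.2 (hR y hy ξ hξ), hfar y hy ξ hξ⟩
  have hballD : ball y0 ρ ⊆ D :=
    (ball_subset_ball (by rw [hρ]; linarith)).trans (ball_bdist_subset D y0)
  refine harmAt_of_approx (by omega) isOpen_ball (fun η hη => ?_) y0 (mem_ball_self hρ0)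
  obtain ⟨c, hc, hcη⟩ : ∃ c : ℝ, 0 < c ∧ ‖ℓ‖ * c ≤ η := by
    refine ⟨η / (‖ℓ‖ + 1), by positivity, ?_⟩
    rw [mul_div_assoc', div_le_iff₀ (by positivity)]
    nlinarith [norm_nonneg ℓ]
  obtain ⟨t, ht, hΓt⟩ := Metric.uniformContinuousOn_iff.1 hΓ c hc
  obtain ⟨T, -, hTf, hT⟩ :=
    finite_cover_balls_of_compact (isCompact_univ (X := frontier D)) ht
  have := hTf.fintype
  obtain ⟨f, hf⟩ := PartitionOfUnity.exists_isSubordinate (isClosed_univ (X := frontier D))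
    (fun i : T => ball (i : frontier D) t) (fun i => isOpen_ball) (by simpa using hT)
  have hsum : ∀ ξ, ∑ i, f i ξ = 1 := fun ξ => by
    rw [← finsum_eq_sum_of_fintype]; exact f.sum_eq_one (mem_univ ξ)
  refine ⟨fun y => ∑ i : T, ℓ (f i) * fundSol n (y - ((i : frontier D) : Eu n)),
    fun y hy => HarmAt.sum fun i _ => (harmAt_fundSol_sub
      (ne_of_mem_frontier hD (i : frontier D).2 (hballD hy)).symm).const_mul _,
    fun y hy => ?_⟩
  let Φ : C(frontier D, ℝ) := ⟨fun ξ => fundSol n (y - ξ), by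
    refine continuous_iff_continuousAt.2 fun ξ => ?_
    have hne : y - (ξ : Eu n) ≠ 0 := norm_pos_iff.1 (hρ0.trans_le (hfar y hy ξ ξ.2))
    exact (harmAt_fundSol hne).continuousAt.comp (f := fun ξ : frontier D => y - (ξ : Eu n))
      (by fun_prop)⟩
  have h1 : ℓ Φ = U x y := hℓ (fun x => U x y) Φ (hU.harmAt hD (hballD hy))
    (hU y (hballD hy)).2.1 fun z => ((hU y (hballD hy)).2.2 z z.2).symm
  have h2 : U x y - ∑ i : T, ℓ (f i) * fundSol n (y - ((i : frontier D) : Eu n)) =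
      ℓ (Φ - ∑ i : T, fundSol n (y - ((i : frontier D) : Eu n)) • f i) := by
    rw [map_sub, h1, map_sum]
    congr 1
    exact Finset.sum_congr rfl fun i _ => by rw [map_smul, smul_eq_mul, mul_comm]
  dsimp only
  rw [h2, ← Real.norm_eq_abs]
  refine (ℓ.le_opNorm _).trans ((mul_le_mul_of_nonneg_left ?_ (norm_nonneg _)).trans hcη)
  refine (ContinuousMap.norm_le _ hc.le).2 fun ξ => ?_
  have h3 : (Φ - ∑ i : T, fundSol n (y - ((i : frontier D) : Eu n)) • f i) ξ =
      ∑ i : T, f i ξ * (fundSol n (y - ξ) - fundSol n (y - ((i : frontier D) : Eu n))) := by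
    rw [ContinuousMap.sub_apply, ContinuousMap.sum_apply]
    simp only [mul_sub, Finset.sum_sub_distrib, ContinuousMap.smul_apply, smul_eq_mul]
    rw [← Finset.sum_mul, hsum, one_mul]
    congr 1
    exact Finset.sum_congr rfl fun i _ => mul_comm _ _
  rw [h3]
  refine (norm_sum_le _ _).trans ?_
  calc ∑ i : T, ‖f i ξ * (fundSol n (y - ξ) - fundSol n (y - ((i : frontier D) : Eu n)))‖
      ≤ ∑ i : T, f i ξ * c := Finset.sum_le_sum fun i _ => by
        rw [norm_mul, Real.norm_of_nonneg (f.nonneg i ξ)]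
        by_cases h0 : f i ξ = 0
        · rw [h0, zero_mul, zero_mul]
        · refine mul_le_mul_of_nonneg_left ?_ (f.nonneg i ξ)
          have h4 : ξ ∈ ball (i : frontier D) t := hf i (subset_tsupport _ h0)
          have h5 := hΓt (y - ξ) (hmem y hy ξ ξ.2) (y - ((i : frontier D) : Eu n))
            (hmem y hy _ (i : frontier D).2) (by
              rw [dist_sub_left]; exact h4)
          rw [dist_eq_norm] at h5
          exact h5.le
    _ = c := by rw [← Finset.sum_mul, hsum, one_mul]

end HarmonicMeasure

section Symmetry

variable {D : Set (Eu n)} {U : Eu n → Eu n → ℝ}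

theorem exists_exterior_ball {d : ℕ} (hd : 1 ≤ d) {ε : ℝ} (hε : 0 < ε) (hD : IsOpen D)
    (hDb : Bornology.IsBounded D) (hbd : HasGraphBoundary D (CkHolder (d + 1) ε)) {x₀ : Eu n}
    (hx₀ : x₀ ∈ frontier D) :
    ∃ (e : Eu n) (R : ℝ), 0 < R ∧ ‖x₀ - e‖ = R ∧ D ⊆ (ball e R)ᶜ := by
  obtain ⟨r, hr, h⟩ := exists_isGraphNear hd hε le_rfl hD hDb hbd one_pos
  obtain ⟨ν, Ψ, ψ, hG⟩ := h x₀ hx₀ r hr le_rfl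
  refine ⟨x₀ + (r / 4) • ν, r / 4, by positivity, ?_, fun y hy hyb => ?_⟩
  · rw [sub_add_cancel_left, norm_neg, norm_smul, hG.norm_eq, Real.norm_of_nonneg (by positivity),
      mul_one]
  · obtain ⟨x, hyx⟩ : ∃ x, y = x₀ + r • x :=
      ⟨r⁻¹ • (y - x₀), by rw [smul_inv_smul₀ hr.ne']; abel⟩
    have h1 : ‖x - (1 / 4 : ℝ) • ν‖ < 1 / 4 := by
      rw [mem_ball, dist_eq_norm, hyx,
        show x₀ + r • x - (x₀ + (r / 4) • ν) = r • (x - (1 / 4 : ℝ) • ν) by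
          rw [smul_sub, smul_smul]
          have : r / 4 = r * (1 / 4) := by ring
          rw [this, add_sub_add_left_eq_sub], norm_smul, Real.norm_of_nonneg hr.le] at hyb
      nlinarith
    have h2 : ‖x - (1 / 4 : ℝ) • ν‖ ^ 2 = ‖x‖ ^ 2 - lin ν x / 2 + 1 / 16 := by
      rw [norm_sub_sq_real, inner_smul_right, norm_smul, hG.norm_eq, lin_eq,
        Real.norm_of_nonneg (by norm_num)]
      ring
    have h3 : ‖x‖ ^ 2 < lin ν x / 2 := by
      have : ‖x - (1 / 4 : ℝ) • ν‖ ^ 2 < (1 / 4) ^ 2 := by gcongr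
      linarith
    have h4 : ‖x‖ < 1 := by
      have := norm_sub_norm_le x ((1 / 4 : ℝ) • ν)
      rw [norm_smul, hG.norm_eq, Real.norm_of_nonneg (by norm_num)] at this
      linarith
    have h5 := mem_ball_zero_iff.2 h4
    have h6 : x ∈ (fun x => x₀ + r • x) ⁻¹' D := by
      rw [mem_preimage, ← hyx]; exact hy
    have h7 := (hG.mem_iff x h5).1 h6
    have h8 := (abs_le.1 (hG.abs_le x h5)).2
    nlinarith [sq_nonneg ‖x‖]

/-- Comparison of the distance to a point with the weighted distance to its Kelvin reflection. -/
theorem norm_le_norm_kelvin {e x z : Eu n} {R : ℝ} (hR : 0 < R) (hx : R ≤ ‖x - e‖)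
    (hz : R ≤ ‖z - e‖) :
    ‖z - x‖ ≤ ‖(‖x - e‖ / R) • (z - (e + ((‖x - e‖ / R) ^ 2)⁻¹ • (x - e)))‖ := by
  set l := ‖x - e‖ / R with hl
  have hl1 : 1 ≤ l := (one_le_div hR).2 hx
  have hl0 : l ≠ 0 := by positivity
  have hb : ‖x - e‖ = l * R := by rw [hl]; field_simp
  have e1 : l • (z - (e + (l ^ 2)⁻¹ • (x - e))) = l • (z - e) - l⁻¹ • (x - e) := by
    rw [← sub_sub, smul_sub l (z - e), smul_smul]
    congr 2
    field_simp
  have e2 : z - x = (z - e) - (x - e) := by abel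
  rw [e1, e2]
  have h1 : ‖l • (z - e) - l⁻¹ • (x - e)‖ ^ 2 =
      l ^ 2 * ‖z - e‖ ^ 2 - 2 * ⟪z - e, x - e⟫ + R ^ 2 := by
    rw [norm_sub_sq_real, norm_smul, norm_smul, inner_smul_left, inner_smul_right, hb,
      Real.norm_of_nonneg (by positivity), Real.norm_of_nonneg (by positivity)]
    simp only [conj_trivial]
    field_simp
  have h2 : ‖(z - e) - (x - e)‖ ^ 2 = ‖z - e‖ ^ 2 - 2 * ⟪z - e, x - e⟫ + l ^ 2 * R ^ 2 := by
    rw [norm_sub_sq_real, hb]; ring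
  have h3 : R ^ 2 ≤ ‖z - e‖ ^ 2 := by gcongr
  have h4 : 1 ≤ l ^ 2 := one_le_pow₀ hl1
  refine (sq_le_sq₀ (norm_nonneg _) (norm_nonneg _)).1 ?_
  rw [h1, h2]
  nlinarith [mul_nonneg (sub_nonneg.2 h4) (sub_nonneg.2 h3)]

theorem IsGreenCorrection.le_kelvin (hn : 2 < n) (hD : IsOpen D) (hDb : Bornology.IsBounded D)
    (hU : IsGreenCorrection D U) {e : Eu n} {R : ℝ} (hR : 0 < R) (he : D ⊆ (ball e R)ᶜ)
    {x y : Eu n} (hx : x ∈ D) (hy : y ∈ D) :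
    U y x ≤ fundSol n ((‖x - e‖ / R) • (y - (e + ((‖x - e‖ / R) ^ 2)⁻¹ • (x - e)))) := by
  have hcl : ∀ z ∈ closure D, R ≤ ‖z - e‖ := fun z hz => by
    have := closure_minimal he isOpen_ball.isClosed_compl hz
    rw [mem_compl_iff, mem_ball, dist_eq_norm, not_lt] at this
    exact this
  have hx' : R < ‖x - e‖ := by
    have h1 : x ∈ interior (ball e R)ᶜ := interior_maximal he hD hx
    rw [interior_compl, closure_ball _ hR.ne', mem_compl_iff, mem_closedBall, dist_eq_norm,
      not_le] at h1
    exact h1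
  set l := ‖x - e‖ / R with hl
  have hl1 : 1 < l := (one_lt_div hR).2 hx'
  have hb : ‖x - e‖ = l * R := by rw [hl]; field_simp
  set p := e + (l ^ 2)⁻¹ • (x - e) with hp
  have hne : ∀ z ∈ closure D, z ≠ p := by
    rintro z hz rfl
    have h1 := hcl _ hz
    rw [hp, add_sub_cancel_left, norm_smul, hb, Real.norm_of_nonneg (by positivity)] at h1
    have h2 : (l ^ 2)⁻¹ * (l * R) = R / l := by field_simp
    rw [h2, le_div_iff₀ (by positivity)] at h1
    nlinarith
  have hV : ∀ z ∈ closure D, HarmAt (fun z => fundSol n (l • (z - p))) z := fun z hz => by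
    have h1 : HarmAt (fun z => fundSol n (-(l • p) + l • z)) z := HarmAt.comp_affine (by
      refine harmAt_fundSol ?_
      rw [neg_add_eq_sub, ← smul_sub]
      exact smul_ne_zero (by positivity) (sub_ne_zero.2 (hne z hz)))
    simpa [smul_sub, neg_add_eq_sub] using h1
  have h1 := max_principle (u := fun z => U z x - fundSol n (l • (z - p))) (M := 0) (by omega)
    hD hDb ((hU x hx).2.1.sub fun z hz => (hV z hz).continuousAt.continuousWithinAt)
    (fun z hz => (hU.harmAt hD hx z hz).sub (hV z (subset_closure hz)))
    (fun z hz => by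
      rw [(hU x hx).2.2 z hz, fundSol_sub_comm, sub_nonpos]
      exact fundSol_le_of_norm_le hn (sub_ne_zero.2 (ne_of_mem_frontier hD hz hx))
        (norm_le_norm_kelvin hR hx'.le (hcl z (frontier_subset_closure hz)))) y hy
  linarith

/-- The correction attains its boundary values in the second variable. -/
theorem IsGreenCorrection.tendsto_snd (hn : 2 < n) {d : ℕ} (hd : 1 ≤ d) {ε : ℝ} (hε : 0 < ε)
    (hD : IsOpen D) (hDb : Bornology.IsBounded D) (hbd : HasGraphBoundary D (CkHolder (d + 1) ε))
    (hU : IsGreenCorrection D U) {y x₀ : Eu n} (hy : y ∈ D) (hx₀ : x₀ ∈ frontier D) :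
    Filter.Tendsto (fun x => U y x) (nhdsWithin x₀ D) (nhds (fundSol n (y - x₀))) := by
  obtain ⟨e, R, hR, heR, he⟩ := exists_exterior_ball hd hε hD hDb hbd hx₀
  have hne : x₀ ≠ y := ne_of_mem_frontier hD hx₀ hy
  have hc : ContinuousAt (fundSol n) (y - x₀) :=
    (harmAt_fundSol (sub_ne_zero.2 hne.symm)).continuousAt
  have hl : ContinuousAt (fun x => fundSol n (y - x)) x₀ :=
    hc.comp (f := fun x => y - x) (by fun_prop)
  have hlim : ‖x₀ - e‖ / R = 1 := by rw [heR, div_self hR.ne']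
  have hu1 : ContinuousAt
      (fun x => (‖x - e‖ / R) • (y - (e + ((‖x - e‖ / R) ^ 2)⁻¹ • (x - e)))) x₀ := by
    have : ((‖x₀ - e‖ / R) ^ 2) ≠ 0 := by rw [hlim]; norm_num
    fun_prop (disch := assumption)
  have e0 : (‖x₀ - e‖ / R) • (y - (e + ((‖x₀ - e‖ / R) ^ 2)⁻¹ • (x₀ - e))) = y - x₀ := by
    rw [hlim]; simp
  have hu : Filter.Tendsto (fun x => fundSol n
      ((‖x - e‖ / R) • (y - (e + ((‖x - e‖ / R) ^ 2)⁻¹ • (x - e))))) (nhds x₀)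
      (nhds (fundSol n (y - x₀))) := by
    have h1 := hu1.tendsto
    rw [e0] at h1
    exact hc.tendsto.comp h1
  refine tendsto_of_tendsto_of_tendsto_of_le_of_le' (hl.tendsto.mono_left nhdsWithin_le_nhds)
    (hu.mono_left nhdsWithin_le_nhds) ?_ ?_
  · filter_upwards [self_mem_nhdsWithin, mem_nhdsWithin_of_mem_nhds (isOpen_ne.mem_nhds hne)]
      with x hx hxy
    exact hU.fundSol_le hn hD hDb hy hx (Ne.symm hxy)
  · filter_upwards [self_mem_nhdsWithin] with x hx
    exact hU.le_kelvin hn hD hDb hR he hx hy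

theorem IsGreenCorrection.symm (hn : 2 < n) {d : ℕ} (hd : 1 ≤ d) {ε : ℝ} (hε : 0 < ε)
    (hD : IsOpen D) (hDb : Bornology.IsBounded D) (hbd : HasGraphBoundary D (CkHolder (d + 1) ε))
    (hU : IsGreenCorrection D U) {x y : Eu n} (hx : x ∈ D) (hy : y ∈ D) : U x y = U y x := by
  classical
  set W : Eu n → ℝ := fun z => if z ∈ D then U y z else fundSol n (y - z) with hW
  have hWD : ∀ z ∈ D, W z = U y z := fun z hz => if_pos hz
  have hWF : ∀ z ∉ D, W z = fundSol n (y - z) := fun z hz => if_neg hz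
  have hharm : ∀ z ∈ D, HarmAt W z := fun z hz =>
    (hU.harmAt_snd hn hD hDb hy z hz).congr (by
      filter_upwards [hD.mem_nhds hz] with v hv using (hWD v hv).symm)
  have hfr : ∀ z ∈ frontier D, z ∉ D := fun z hz h => by
    rw [hD.frontier_eq] at hz; exact hz.2 h
  have hcont : ContinuousOn W (closure D) := by
    intro z hz
    by_cases hzD : z ∈ D
    · exact (hharm z hzD).continuousAt.continuousWithinAt
    have hzF : z ∈ frontier D := by rw [hD.frontier_eq]; exact ⟨hz, hzD⟩
    have e1 : closure D = D ∪ frontier D := by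
      rw [closure_eq_self_union_frontier]
    rw [ContinuousWithinAt, e1, nhdsWithin_union, hWF z hzD]
    refine Filter.Tendsto.sup ?_ ?_
    · refine (hU.tendsto_snd hn hd hε hD hDb hbd hy hzF).congr' ?_
      filter_upwards [self_mem_nhdsWithin] with v hv using (hWD v hv).symm
    · have hc : ContinuousAt (fun v => fundSol n (y - v)) z :=
        (harmAt_fundSol (sub_ne_zero.2 (ne_of_mem_frontier hD hzF hy).symm)).continuousAt.comp
          (f := fun v => y - v) (by fun_prop)
      refine (hc.tendsto.mono_left nhdsWithin_le_nhds).congr' ?_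
      filter_upwards [self_mem_nhdsWithin] with v hv using (hWF v (hfr v hv)).symm
  have h1 := abs_max_principle (u := fun z => W z - U z y) (M := 0) (by omega) hD hDb
    (hcont.sub (hU y hy).2.1) (fun z hz => (hharm z hz).sub (hU.harmAt hD hy z hz))
    (fun z hz => by
      rw [hWF z (hfr z hz), (hU y hy).2.2 z hz, sub_self, abs_zero]) x hx
  have h2 := abs_nonpos_iff.1 h1
  rw [hWD x hx] at h2
  linarith

end Symmetry

section Families

theorem hasDerivAt_comp_single {f : Eu n → ℝ} {y : Eu n} {i : Fin n} {t : ℝ}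
    (hf : DifferentiableAt ℝ f (y + t • EuclideanSpace.single i 1)) :
    HasDerivAt (fun s : ℝ => f (y + s • EuclideanSpace.single i 1))
      (pd i f (y + t • EuclideanSpace.single i 1)) t := by
  have h1 : HasDerivAt (fun s : ℝ => y + s • (EuclideanSpace.single i 1 : Eu n))
      ((1 : ℝ) • EuclideanSpace.single i 1) t :=
    ((hasDerivAt_id t).smul_const _).const_add y
  have h2 := hf.hasFDerivAt.comp_hasDerivAt t h1
  rw [one_smul] at h2
  exact h2

theorem abs_sub_sub_mul_pd_le {f : Eu n → ℝ} {y : Eu n} {i : Fin n} {h K : ℝ} (hh : 0 ≤ h)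
    (hf : ∀ t ∈ Icc 0 h, DifferentiableAt ℝ f (y + t • EuclideanSpace.single i 1))
    (hf' : ∀ t ∈ Icc 0 h, DifferentiableAt ℝ (pd i f) (y + t • EuclideanSpace.single i 1))
    (hK : ∀ t ∈ Icc 0 h, |pd i (pd i f) (y + t • EuclideanSpace.single i 1)| ≤ K) :
    |f (y + h • EuclideanSpace.single i 1) - f y - h * pd i f y| ≤ K * h * h := by
  have h0 : (0 : ℝ) ∈ Icc 0 h := ⟨le_rfl, hh⟩
  have hh' : h ∈ Icc 0 h := ⟨hh, le_rfl⟩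
  have hK0 : 0 ≤ K := (abs_nonneg _).trans (hK 0 h0)
  have e0 : y + (0 : ℝ) • (EuclideanSpace.single i 1 : Eu n) = y := by simp
  have h1 : ∀ t ∈ Icc 0 h, |pd i f (y + t • EuclideanSpace.single i 1) - pd i f y| ≤ K * h := by
    intro t ht
    have := (convex_Icc 0 h).norm_image_sub_le_of_norm_hasDerivWithin_le
      (fun s hs => (hasDerivAt_comp_single (hf' s hs)).hasDerivWithinAt) hK h0 ht
    rw [e0, sub_zero, Real.norm_eq_abs, Real.norm_of_nonneg ht.1] at this
    exact this.trans (mul_le_mul_of_nonneg_left ht.2 hK0)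
  have h2 := (convex_Icc 0 h).norm_image_sub_le_of_norm_hasDerivWithin_le
    (f := fun s => f (y + s • EuclideanSpace.single i 1) - s * pd i f y)
    (fun s hs => ((hasDerivAt_comp_single (hf s hs)).sub
      ((hasDerivAt_id s).mul_const (pd i f y))).hasDerivWithinAt)
    (C := K * h) (fun s hs => by rw [one_mul]; exact h1 s hs) h0 hh'
  rw [e0, zero_mul, sub_zero, sub_zero, Real.norm_eq_abs, Real.norm_of_nonneg hh] at h2
  rwa [sub_right_comm] at h2

/-- A family of harmonic functions on `V`, locally uniformly bounded, depending continuously on a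
parameter in `X` and harmonically on the parameter in `O`. -/
structure IsHarmFamily (O X V : Set (Eu n)) (F : Eu n → Eu n → ℝ) : Prop where
  continuousOn : ∀ y ∈ V, ContinuousOn (fun x => F x y) X
  harmAt_fst : ∀ y ∈ V, ∀ x ∈ O, HarmAt (fun x => F x y) x
  harmAt_snd : ∀ x ∈ X, ∀ y ∈ V, HarmAt (F x) y
  bounded : ∀ y ∈ V, ∃ ρ > 0, ∃ M, ball y ρ ⊆ V ∧ ∀ x ∈ X, ∀ z ∈ ball y ρ, |F x z| ≤ M

variable {O X V : Set (Eu n)} {F : Eu n → Eu n → ℝ}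

theorem IsHarmFamily.isOpen (h : IsHarmFamily O X V F) : IsOpen V :=
  Metric.isOpen_iff.2 fun y hy => by
    obtain ⟨ρ, hρ, M, h1, -⟩ := h.bounded y hy
    exact ⟨ρ, hρ, h1⟩

/-- The partial derivatives of a family of harmonic functions are uniform limits of difference
quotients. -/
theorem IsHarmFamily.exists_quotient (hn : 0 < n) (h : IsHarmFamily O X V F) {y : Eu n}
    (hy : y ∈ V) (i : Fin n) {η : ℝ} (hη : 0 < η) :
    ∃ z ∈ V, ∃ t : ℝ, ∀ x ∈ X, |pd i (F x) y - t * (F x z - F x y)| ≤ η := by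
  obtain ⟨ρ, hρ, M, hV, hM⟩ := h.bounded y hy
  obtain ⟨C, hC, int⟩ := interior_estimate_le hn 2
  set K := C / (ρ / 2) ^ 2 * |M| with hK
  have hK0 : 0 ≤ K := by positivity
  obtain ⟨s, hs0, hs⟩ := exists_between (lt_min (half_pos hρ) (div_pos hη (by linarith : 0 < K + 1)))
  have hs1 := hs.trans_le (min_le_left _ _)
  have hs2 := hs.trans_le (min_le_right _ _)
  rw [lt_div_iff₀ (by linarith)] at hs2
  have hseg : ∀ t ∈ Icc 0 s, y + t • EuclideanSpace.single i 1 ∈ ball y (ρ / 2) := by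
    intro t ht
    rw [mem_ball, dist_eq_norm, add_sub_cancel_left, norm_smul, PiLp.norm_single,
      norm_one, mul_one, Real.norm_of_nonneg ht.1]
    exact ht.2.trans_lt hs1
  have hsub : ball y (ρ / 2) ⊆ V := (ball_subset_ball (by linarith)).trans hV
  refine ⟨y + s • EuclideanSpace.single i 1, hsub (hseg s ⟨hs0.le, le_rfl⟩), s⁻¹, fun x hx => ?_⟩
  have h1 : ∀ L, ∀ z ∈ V, HarmAt (pdMulti L (F x)) z := fun L =>
    harmAt_pdMulti hn h.isOpen (h.harmAt_snd x hx) L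
  have h2 := abs_sub_sub_mul_pd_le (f := F x) (i := i) (K := K) hs0.le
    (fun t ht => (h.harmAt_snd x hx _ (hsub (hseg t ht))).differentiableAt)
    (fun t ht => (h1 [i] _ (hsub (hseg t ht))).differentiableAt)
    (fun t ht => by
      have hb : ball (y + t • EuclideanSpace.single i 1) (ρ / 2) ⊆ ball y ρ :=
        ball_subset_ball' (by have := mem_ball.1 (hseg t ht); linarith)
      exact int (F x) _ (ρ / 2) |M| (half_pos hρ)
        (fun z hz => h.harmAt_snd x hx z (hV (hb hz)))
        (fun z hz => (hM x hx z (hb hz)).trans (le_abs_self M)) [i, i] le_rfl)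
  set Q := F x (y + s • EuclideanSpace.single i 1) - F x y with hQ
  have e1 : pd i (F x) y - s⁻¹ * Q = -(s⁻¹ * (Q - s * pd i (F x) y)) := by
    field_simp; ring
  rw [e1, abs_neg, abs_mul, abs_of_pos (inv_pos.2 hs0)]
  calc s⁻¹ * |Q - s * pd i (F x) y| ≤ s⁻¹ * (K * s * s) := by gcongr
    _ = K * s := by field_simp
    _ ≤ η := by nlinarith

theorem IsHarmFamily.pd (hn : 0 < n) (hO : IsOpen O) (hOX : O ⊆ X) (h : IsHarmFamily O X V F)
    (i : Fin n) : IsHarmFamily O X V (fun x => _root_.pd i (F x)) where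
  continuousOn y hy := continuousOn_of_uniform_approx_of_continuousOn fun u hu => by
    obtain ⟨η, hη, hηu⟩ := Metric.mem_uniformity_dist.1 hu
    obtain ⟨z, hz, t, ht⟩ := h.exists_quotient hn hy i (half_pos hη)
    refine ⟨fun x => t * (F x z - F x y),
      continuousOn_const.mul ((h.continuousOn z hz).sub (h.continuousOn y hy)), fun x hx => hηu ?_⟩
    rw [Real.dist_eq]
    exact (ht x hx).trans_lt (half_lt_self hη)
  harmAt_fst y hy := harmAt_of_approx hn hO fun η hη => by
    obtain ⟨z, hz, t, ht⟩ := h.exists_quotient hn hy i hη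
    exact ⟨fun x => t * (F x z - F x y),
      fun x hx => ((h.harmAt_fst z hz x hx).sub (h.harmAt_fst y hy x hx)).const_mul t,
      fun x hx => ht x (hOX hx)⟩
  harmAt_snd x hx := harmAt_pdMulti hn h.isOpen (h.harmAt_snd x hx) [i]
  bounded y hy := by
    obtain ⟨ρ, hρ, M, hV, hM⟩ := h.bounded y hy
    obtain ⟨C, hC, int⟩ := interior_estimate_le hn 1
    refine ⟨ρ / 2, half_pos hρ, C / (ρ / 2) ^ 1 * |M|,
      (ball_subset_ball (by linarith)).trans hV, fun x hx z hz => ?_⟩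
    have hb : ball z (ρ / 2) ⊆ ball y ρ := ball_subset_ball' (by have := mem_ball.1 hz; linarith)
    exact int (F x) z (ρ / 2) |M| (half_pos hρ) (fun v hv => h.harmAt_snd x hx v (hV (hb hv)))
      (fun v hv => (hM x hx v (hb hv)).trans (le_abs_self M)) [i] le_rfl

theorem IsHarmFamily.pdMulti (hn : 0 < n) (hO : IsOpen O) (hOX : O ⊆ X)
    (h : IsHarmFamily O X V F) (L : List (Fin n)) :
    IsHarmFamily O X V (fun x => _root_.pdMulti L (F x)) := by
  induction L with
  | nil => exact h
  | cons i L ih => exact ih.pd hn hO hOX i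

/-- Interior estimates in both variables for a function harmonic in each of them. -/
theorem abs_pdMulti_pdMulti_le (hn : 0 < n) (k : ℕ) : ∃ C : ℝ, 0 < C ∧
    ∀ (F : Eu n → Eu n → ℝ) (a b : Eu n) (r M : ℝ), 0 < r →
      IsHarmFamily (ball a r) (ball a r) (ball b r) F →
      (∀ x ∈ ball a r, ∀ y ∈ ball b r, |F x y| ≤ M) →
      ∀ A B : List (Fin n), A.length ≤ k → B.length ≤ k →
      |_root_.pdMulti B (fun x => _root_.pdMulti A (F x) b) a| ≤
        C / r ^ (A.length + B.length) * M := by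
  obtain ⟨C, hC, int⟩ := interior_estimate_le hn k
  refine ⟨C * C, by positivity, fun F a b r M hr hF hM A B hA hB => ?_⟩
  refine (int (fun x => _root_.pdMulti A (F x) b) a r (C / r ^ A.length * M) hr
    ((hF.pdMulti hn isOpen_ball subset_rfl A).harmAt_fst b (mem_ball_self hr))
    (fun x hx => int (F x) b r M hr (hF.harmAt_snd x hx) (hM x hx) A hA) B hB).trans_eq ?_
  rw [pow_add]
  field_simp

end Families

section GreenEstimate

theorem pdMulti_zero (L : List (Fin n)) : pdMulti L (fun _ : Eu n => (0 : ℝ)) = fun _ => 0 := by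
  induction L with
  | nil => rfl
  | cons i L ih =>
    funext x
    change pd i (pdMulti L fun _ => 0) x = 0
    rw [ih, pd_const]

/-- Estimates up to the boundary in both variables for a function which is harmonic and vanishes
on the boundary in each variable. -/
theorem exists_two_sided_estimate (hn : 0 < n) {d : ℕ} (hd : 1 ≤ d) {ε : ℝ} (hε : 0 < ε)
    {D : Set (Eu n)} (hD : IsOpen D) (hDb : Bornology.IsBounded D)
    (hbd : HasGraphBoundary D (CkHolder (d + 1) ε)) {R : ℝ} (hR : 0 < R) :
    ∃ C : ℝ, 0 < C ∧ ∀ (F : Eu n → Eu n → ℝ), ∀ x ∈ D, ∀ y ∈ D, ∀ r, 0 < r → r ≤ R →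
      ∀ M : ℝ, 0 < M →
      IsHarmFamily (D ∩ ball x r) (closure D ∩ ball x r) (D ∩ ball y r) F →
      (∀ x' ∈ frontier D ∩ ball x r, ∀ y' ∈ D, F x' y' = 0) →
      (∀ x' ∈ D ∩ ball x r, ∃ w : Eu n → ℝ, (∀ y' ∈ D, F x' y' = w y') ∧
        ContinuousOn w (closure D ∩ ball y r) ∧ ∀ y' ∈ frontier D ∩ ball y r, w y' = 0) →
      (∀ x' ∈ D ∩ ball x r, ∀ y' ∈ D ∩ ball y r, |F x' y'| ≤ M) →
      ∀ A B : List (Fin n), A.length ≤ d + 1 → B.length ≤ d + 1 →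
      |pdMulti B (fun x' => pdMulti A (F x') y) x| ≤ C / r ^ (A.length + B.length) * M := by
  obtain ⟨C, hC, est⟩ := exists_local_estimate hn hd hε hD hDb hbd hR
  refine ⟨C * C, by positivity, fun F x hx y hy r hr hrR M hM hF hF0 hw hFM A B hA hB => ?_⟩
  have hyV : y ∈ D ∩ ball y r := ⟨hy, mem_ball_self hr⟩
  have hsub : D ∩ ball x r ⊆ closure D ∩ ball x r := inter_subset_inter_left _ subset_closure
  have hA' := hF.pdMulti hn (hD.inter isOpen_ball) hsub A
  refine (est x hx r hr hrR (fun x' => pdMulti A (F x') y) (C / r ^ A.length * M) (by positivity)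
    (hA'.harmAt_fst y hyV) (hA'.continuousOn y hyV) ?_ ?_ B hB).trans_eq ?_
  · intro x' hx'
    have h1 : F x' =ᶠ[nhds y] fun _ => 0 := by
      filter_upwards [hD.mem_nhds hy] with z hz using hF0 x' hx' z hz
    have h2 := (pdMulti_eventuallyEq h1 A).eq_of_nhds
    rwa [pdMulti_zero] at h2
  · intro x' hx'
    obtain ⟨w, hFw, hwc, hw0⟩ := hw x' hx'
    have h1 : F x' =ᶠ[nhds y] w := by
      filter_upwards [hD.mem_nhds hy] with z hz using hFw z hz
    rw [(pdMulti_eventuallyEq h1 A).eq_of_nhds]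
    refine est y hy r hr hrR w M hM (fun z hz => ?_) hwc hw0
      (fun z hz => by rw [← hFw z hz.1]; exact hFM x' hx' z hz) A hA
    refine (hF.harmAt_snd x' (hsub hx') z hz).congr ?_
    filter_upwards [hD.mem_nhds hz.1] with v hv using hFw v hv
  · rw [pow_add]
    field_simp

variable {D : Set (Eu n)} {U : Eu n → Eu n → ℝ}

theorem isHarmFamily_fundSol (hn : 2 < n) {x y : Eu n} {r : ℝ} (hr : 0 < r)
    (hfar : ∀ x' ∈ ball x r, ∀ y' ∈ ball y r, r ≤ ‖x' - y'‖) :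
    IsHarmFamily (ball x r) (ball x r) (ball y r) (fun x' y' => fundSol n (x' - y')) := by
  have hne : ∀ x' ∈ ball x r, ∀ y' ∈ ball y r, x' ≠ y' := fun x' hx' y' hy' =>
    sub_ne_zero.1 (norm_pos_iff.1 (hr.trans_le (hfar x' hx' y' hy')))
  have h1 : ∀ y' ∈ ball y r, ∀ x' ∈ ball x r, HarmAt (fun x' => fundSol n (x' - y')) x' :=
    fun y' hy' x' hx' => harmAt_fundSol_sub (hne x' hx' y' hy')
  refine ⟨fun y' hy' x' hx' => (h1 y' hy' x' hx').continuousAt.continuousWithinAt, h1,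
    fun x' hx' y' hy' => ?_, fun y' hy' => ?_⟩
  · simp only [fundSol_sub_comm x']
    exact harmAt_fundSol_sub (hne x' hx' y' hy').symm
  · obtain ⟨ρ, hρ, hb⟩ := Metric.isOpen_iff.1 isOpen_ball y' hy'
    exact ⟨ρ, hρ, fundConst n / r ^ (n - 2), hb, fun x' hx' z hz =>
      abs_fundSol_le hn hr (hfar x' hx' z (hb hz))⟩

theorem IsGreenCorrection.isHarmFamily_green (hn : 2 < n) (hD : IsOpen D)
    (hDb : Bornology.IsBounded D) (hU : IsGreenCorrection D U) {x y : Eu n} {r : ℝ} (hr : 0 < r)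
    (hfar : ∀ x' ∈ ball x r, ∀ y' ∈ ball y r, r ≤ ‖x' - y'‖) :
    IsHarmFamily (D ∩ ball x r) (closure D ∩ ball x r) (D ∩ ball y r)
      (fun x' y' => fundSol n (x' - y') - U x' y') := by
  have hΓ := isHarmFamily_fundSol hn hr hfar
  have hfr : ∀ x' ∈ closure D, x' ∉ D → ∀ z ∈ D, fundSol n (x' - z) - U x' z = 0 :=
    fun x' hx' hx'D z hz => by
      have hx'F : x' ∈ frontier D := by rw [hD.frontier_eq]; exact ⟨hx', hx'D⟩
      rw [(hU z hz).2.2 x' hx'F, fundSol_sub_comm, sub_self]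
  refine ⟨fun y' hy' => ?_, fun y' hy' x' hx' => ?_, fun x' hx' y' hy' => ?_, fun y' hy' => ?_⟩
  · exact ((hΓ.continuousOn y' hy'.2).mono inter_subset_right).sub
      ((hU y' hy'.1).2.1.mono inter_subset_left)
  · exact (hΓ.harmAt_fst y' hy'.2 x' hx'.2).sub (hU.harmAt hD hy'.1 x' hx'.1)
  · by_cases hx'D : x' ∈ D
    · exact (hΓ.harmAt_snd x' hx'.2 y' hy'.2).sub (hU.harmAt_snd hn hD hDb hx'D y' hy'.1)
    · refine (harmAt_const 0 y').congr ?_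
      filter_upwards [hD.mem_nhds hy'.1] with z hz using (hfr x' hx'.1 hx'D z hz).symm
  · obtain ⟨ρ, hρ, hb⟩ := Metric.isOpen_iff.1 (hD.inter isOpen_ball) y' hy'
    refine ⟨ρ, hρ, fundConst n / r ^ (n - 2), hb, fun x' hx' z hz => ?_⟩
    have hz' := hb hz
    have h1 := hfar x' hx'.2 z hz'.2
    by_cases hx'D : x' ∈ D
    · exact (hU.abs_green_le hn hD hDb hx'D hz'.1
        (sub_ne_zero.1 (norm_pos_iff.1 (hr.trans_le h1)))).trans (abs_fundSol_le hn hr h1)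
    · rw [hfr x' hx'.1 hx'D z hz'.1, abs_zero]
      have := (fundConst_pos hn).le
      positivity

/-- Near the diagonal the correction is estimated by interior estimates. -/
theorem IsGreenCorrection.exists_near_estimate (hn : 2 < n) (hD : IsOpen D)
    (hDb : Bornology.IsBounded D) (hU : IsGreenCorrection D U) (k : ℕ) :
    ∃ C : ℝ, 0 < C ∧ ∀ x ∈ D, ∀ y ∈ D, ∀ r, 0 < r → bdist D y = 4 * r → ‖x - y‖ ≤ r →
      ∀ A B : List (Fin n), A.length ≤ k → B.length ≤ k →
      |pdMulti B (fun x' => pdMulti A (U x') y) x| ≤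
        C / r ^ (A.length + B.length) * (fundConst n / r ^ (n - 2)) := by
  obtain ⟨C, hC, est⟩ := abs_pdMulti_pdMulti_le (n := n) (by omega) k
  refine ⟨C, hC, fun x hx y hy r hr hδ hxy A B hA hB => ?_⟩
  have hP := (fundConst_pos hn).le
  have hxD : ∀ x' ∈ ball x r, x' ∈ D := fun x' hx' => ball_bdist_subset D y (by
    rw [mem_ball, dist_eq_norm] at hx' ⊢
    have := norm_sub_le_norm_sub_add_norm_sub x' x y
    linarith)
  have hyD : ∀ y' ∈ ball y r, y' ∈ D := fun y' hy' => ball_bdist_subset D y (by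
    rw [mem_ball] at hy' ⊢; linarith)
  have hM : ∀ x' ∈ ball x r, ∀ y' ∈ ball y r, |U x' y'| ≤ fundConst n / r ^ (n - 2) :=
    fun x' hx' y' hy' => by
      refine (hU.abs_le hn hD hDb (hxD x' hx') (hyD y' hy')).trans ?_
      have h1 : bdist D y ≤ bdist D y' + dist y y' := infDist_le_infDist_add_dist
      rw [mem_ball, dist_comm] at hy'
      have h2 : r ≤ bdist D y' := by linarith
      gcongr
  refine est U x y r _ hr ⟨fun y' hy' x' hx' =>
    (hU.harmAt hD (hyD y' hy') x' (hxD x' hx')).continuousAt.continuousWithinAt,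
    fun y' hy' x' hx' => hU.harmAt hD (hyD y' hy') x' (hxD x' hx'),
    fun x' hx' y' hy' => hU.harmAt_snd hn hD hDb (hxD x' hx') y' (hyD y' hy'),
    fun y' hy' => ?_⟩ hM A B hA hB
  obtain ⟨ρ, hρ, hb⟩ := Metric.isOpen_iff.1 isOpen_ball y' hy'
  exact ⟨ρ, hρ, _, hb, fun x' hx' z hz => hM x' hx' z (hb hz)⟩

/-- Away from the diagonal the correction is estimated through the Green's function. -/
theorem IsGreenCorrection.exists_far_estimate (hn : 2 < n) {d : ℕ} (hd : 1 ≤ d) {ε : ℝ}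
    (hε : 0 < ε) (hD : IsOpen D) (hDb : Bornology.IsBounded D)
    (hbd : HasGraphBoundary D (CkHolder (d + 1) ε)) (hU : IsGreenCorrection D U) {R : ℝ}
    (hR : 0 < R) :
    ∃ C : ℝ, 0 < C ∧ ∀ x ∈ D, ∀ y ∈ D, ∀ r, 0 < r → r ≤ R → 4 * r ≤ ‖x - y‖ →
      ∀ A B : List (Fin n), A.length ≤ d + 1 → B.length ≤ d + 1 →
      |pdMulti B (fun x' => pdMulti A (U x') y) x| ≤
        C / r ^ (A.length + B.length) * (fundConst n / r ^ (n - 2)) := by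
  have hn0 : 0 < n := by omega
  obtain ⟨C₁, hC₁, est₁⟩ := abs_pdMulti_pdMulti_le hn0 (d + 1)
  obtain ⟨C₂, hC₂, est₂⟩ := exists_two_sided_estimate hn0 hd hε hD hDb hbd hR
  refine ⟨C₁ + C₂, by positivity, fun x hx y hy r hr hrR hxy A B hA hB => ?_⟩
  have hP := fundConst_pos hn
  have hfar : ∀ x' ∈ ball x r, ∀ y' ∈ ball y r, r ≤ ‖x' - y'‖ := fun x' hx' y' hy' => by
    rw [mem_ball'] at hx'
    rw [mem_ball] at hy'
    have := dist_triangle4 x x' y' y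
    rw [← dist_eq_norm] at hxy ⊢
    linarith
  have hΓ := isHarmFamily_fundSol hn hr hfar
  have hG := hU.isHarmFamily_green hn hD hDb hr hfar
  have hΓM : ∀ x' ∈ ball x r, ∀ y' ∈ ball y r,
      |fundSol n (x' - y')| ≤ fundConst n / r ^ (n - 2) := fun x' hx' y' hy' =>
    abs_fundSol_le hn hr (hfar x' hx' y' hy')
  have hne : ∀ x' ∈ ball x r, ∀ y' ∈ ball y r, x' ≠ y' := fun x' hx' y' hy' =>
    sub_ne_zero.1 (norm_pos_iff.1 (hr.trans_le (hfar x' hx' y' hy')))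
  have b1 := est₁ _ x y r _ hr hΓ hΓM A B hA hB
  have b2 := est₂ _ x hx y hy r hr hrR (fundConst n / r ^ (n - 2)) (by positivity) hG
    (fun x' hx' y' hy' => by
      rw [(hU y' hy').2.2 x' hx'.1, fundSol_sub_comm, sub_self])
    (fun x' hx' => ⟨fun y' => fundSol n (y' - x') - U y' x', fun y' hy' => by
        rw [hU.symm hn hd hε hD hDb hbd hx'.1 hy', fundSol_sub_comm],
      ContinuousOn.sub (fun y' hy' => (harmAt_fundSol_sub
        (hne x' hx'.2 y' hy'.2).symm).continuousAt.continuousWithinAt)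
        ((hU x' hx'.1).2.1.mono inter_subset_left),
      fun y' hy' => by
        dsimp only
        rw [(hU x' hx'.1).2.2 y' hy'.1, fundSol_sub_comm, sub_self]⟩)
    (fun x' hx' y' hy' => (hU.abs_green_le hn hD hDb hx'.1 hy'.1
      (hne x' hx'.2 y' hy'.2)).trans (hΓM x' hx'.2 y' hy'.2)) A B hA hB
  have hO : IsOpen (D ∩ ball x r) := hD.inter isOpen_ball
  have hsub : D ∩ ball x r ⊆ closure D ∩ ball x r := inter_subset_inter_left _ subset_closure
  have hxO : x ∈ D ∩ ball x r := ⟨hx, mem_ball_self hr⟩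
  have hyV : y ∈ D ∩ ball y r := ⟨hy, mem_ball_self hr⟩
  have e1 : (fun x' => pdMulti A (U x') y) =ᶠ[nhds x] fun x' =>
      pdMulti A (fun y' => fundSol n (x' - y')) y -
        pdMulti A (fun y' => fundSol n (x' - y') - U x' y') y := by
    filter_upwards [hO.mem_nhds hxO] with x' hx'
    rw [← pdMulti_sub_harm hn0 hG.isOpen (fun z hz => hΓ.harmAt_snd x' hx'.2 z hz.2)
      (hG.harmAt_snd x' (hsub hx')) A y hyV]
    simp only [sub_sub_cancel]
  rw [(pdMulti_eventuallyEq e1 B).eq_of_nhds, pdMulti_sub_harm hn0 hO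
    (fun z hz => (hΓ.pdMulti hn0 isOpen_ball subset_rfl A).harmAt_fst y hyV.2 z hz.2)
    ((hG.pdMulti hn0 hO hsub A).harmAt_fst y hyV) B x hxO]
  refine (abs_sub _ _).trans ((add_le_add b1 b2).trans_eq ?_)
  rw [add_div, add_mul]

end GreenEstimate

/-- Theorem 2.2: if ∂D is of class C^{k₀,ε} (k₀ ≥ 2), then for all
multi-indices α, β with |α| = k ≤ k₀, |β| = ℓ ≤ k₀,
|∂^{k+ℓ}U(x,y)/∂x^β∂y^α| ≤ C (|x−y| + δ(y))^{−(n+k+ℓ−2)} for all x, y ∈ D. -/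
theorem stmt4 {n : ℕ} (hn : 2 < n) (k₀ : ℕ) (hk₀ : 2 ≤ k₀) (ε : ℝ) (hε : 0 < ε)
    (D : Set (Eu n)) (hD : IsBddDomain D) (hbd : HasGraphBoundary D (CkHolder k₀ ε))
    (U : Eu n → Eu n → ℝ) (hU : IsGreenCorrection D U) :
    ∃ C : ℝ, 0 < C ∧ ∀ A B : List (Fin n), A.length ≤ k₀ → B.length ≤ k₀ →
      ∀ x ∈ D, ∀ y ∈ D,
      |pdMulti B (fun x' => pdMulti A (fun y' => U x' y') y) x| ≤
        C / (‖x - y‖ + bdist D y) ^ (n + A.length + B.length - 2) := by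
  obtain ⟨hDo, -, hDb⟩ := hD
  obtain ⟨d, rfl⟩ : ∃ d, k₀ = d + 1 := ⟨k₀ - 1, by omega⟩
  have hd : 1 ≤ d := by omega
  obtain ⟨R, hR⟩ := hDb.exists_norm_le
  obtain ⟨C₁, hC₁, near⟩ := hU.exists_near_estimate hn hDo hDb (d + 1)
  obtain ⟨C₂, hC₂, far⟩ := hU.exists_far_estimate hn hd hε hDo hDb hbd
    (R := |R| + 1) (by positivity)
  have hP := fundConst_pos hn
  refine ⟨(C₁ + C₂) * fundConst n * 20 ^ (n + 2 * (d + 1)), by positivity,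
    fun A B hA hB x hx y hy => ?_⟩
  have hδ := bdist_pos (by omega) hDo hDb hy
  have hs : 0 < ‖x - y‖ + bdist D y := by positivity
  have key : ∀ K r : ℝ, K ≤ C₁ + C₂ → 0 < r → ‖x - y‖ + bdist D y ≤ 20 * r →
      K / r ^ (A.length + B.length) * (fundConst n / r ^ (n - 2)) ≤
        (C₁ + C₂) * fundConst n * 20 ^ (n + 2 * (d + 1)) /
          (‖x - y‖ + bdist D y) ^ (n + A.length + B.length - 2) := by
    intro K r hK hr hsr
    have e1 : n + A.length + B.length - 2 = A.length + B.length + (n - 2) := by omega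
    rw [div_mul_div_comm, ← pow_add, ← e1, div_le_div_iff₀ (by positivity) (by positivity)]
    set N := n + A.length + B.length - 2 with hN
    have h1 : (‖x - y‖ + bdist D y) ^ N ≤ 20 ^ (n + 2 * (d + 1)) * r ^ N :=
      calc (‖x - y‖ + bdist D y) ^ N ≤ (20 * r) ^ N := by gcongr
        _ = 20 ^ N * r ^ N := mul_pow _ _ _
        _ ≤ 20 ^ (n + 2 * (d + 1)) * r ^ N := by
            gcongr
            · norm_num
            · omega
    calc K * fundConst n * (‖x - y‖ + bdist D y) ^ N
        ≤ (C₁ + C₂) * fundConst n * (20 ^ (n + 2 * (d + 1)) * r ^ N) := by gcongr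
      _ = _ := by ring
  rcases le_or_gt (‖x - y‖) (bdist D y / 4) with h | h
  · exact (near x hx y hy (bdist D y / 4) (by positivity) (by ring) h A B hA hB).trans
      (key C₁ _ (by linarith) (by positivity) (by linarith))
  · have h0 : 0 < ‖x - y‖ := by linarith
    have h1 : ‖x - y‖ / 4 ≤ |R| + 1 := by
      have := norm_sub_le x y
      have := hR x hx
      have := hR y hy
      have := le_abs_self R
      have := abs_nonneg R
      linarith
    exact (far x hx y hy (‖x - y‖ / 4) (by positivity) h1 (by linarith) A B hA hB).trans
      (key C₂ _ (by linarith) (by positivity) (by linarith))
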